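/- Let (G,σ) be a flow-admissible signed graph with at least one edge. Then (G,σ) has a signed-circuit cover 𝓕 with ℓ(𝓕) < (19/6)|E(G)|, i.e., 6ℓ(𝓕) < 19|E(G)|. -/

import Mathlib

open SimpleGraph Set

variable {V : Type*}

/-- `J` is a `T`-join of `G`: a set of edges of `G` such that a vertex has odd degree
in the spanning subgraph with edge set `J` iff it belongs to `T`. -/
def IsTJoin (G : SimpleGraph V) (T : Set V) (J : Set (Sym2 V)) : Prop :=
  J ⊆ G.edgeSet ∧ ∀ v : V, (Odd {e ∈ J | v ∈ e}.ncard ↔ v ∈ T)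

/-- The edge set of the maximal bridgeless subgraph of `G`: all non-bridge edges. -/
def nonBridgeEdges (G : SimpleGraph V) : Set (Sym2 V) :=
  {e ∈ G.edgeSet | ¬ G.IsBridge e}

/-- A graph is 2-edge-connected if it is connected, has at least two vertices,
and has no bridge. -/
def TwoEdgeConnected (G : SimpleGraph V) : Prop :=
  G.Connected ∧ Nontrivial V ∧ ∀ e, ¬ G.IsBridge e

/-- `H` is the edge set of an even subgraph of `G`: every vertex has even degree. -/
def IsEvenEdgeSet (G : SimpleGraph V) (H : Set (Sym2 V)) : Prop :=
  H ⊆ G.edgeSet ∧ ∀ v : V, Even {e ∈ H | v ∈ e}.ncard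

/-! Signed graphs: a signature is `σ : Sym2 V → Bool`, `σ e = true` meaning `e` is negative. -/

/-- The set of negative edges of `(G, σ)`. -/
def negEdgeSet (G : SimpleGraph V) (σ : Sym2 V → Bool) : Set (Sym2 V) :=
  {e ∈ G.edgeSet | σ e = true}

/-- The set of positive edges of `(G, σ)`. -/
def posEdgeSet (G : SimpleGraph V) (σ : Sym2 V → Bool) : Set (Sym2 V) :=
  {e ∈ G.edgeSet | σ e = false}

/-- `G⁺`: the spanning subgraph of `G` on the positive edges. -/
def gplus (G : SimpleGraph V) (σ : Sym2 V → Bool) : SimpleGraph V :=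
  G.deleteEdges {e | σ e = true}

/-- `C` is the edge set and `S` the vertex set of a cycle of `G`. -/
def IsCycleSet (G : SimpleGraph V) (C : Set (Sym2 V)) (S : Set V) : Prop :=
  ∃ (v : V) (w : G.Walk v v), w.IsCycle ∧ C = {e | e ∈ w.edges} ∧ S = {x | x ∈ w.support}

/-- `C` (with vertex set `S`) is a negative cycle: it has an odd number of negative edges. -/
def IsNegCycle (G : SimpleGraph V) (σ : Sym2 V → Bool) (C : Set (Sym2 V)) (S : Set V) : Prop :=
  IsCycleSet G C S ∧ Odd {e ∈ C | σ e = true}.ncard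

/-- `C` is (the edge set of) a positive cycle: it has an even number of negative edges. -/
def IsPosCycle (G : SimpleGraph V) (σ : Sym2 V → Bool) (C : Set (Sym2 V)) : Prop :=
  (∃ S, IsCycleSet G C S) ∧ Even {e ∈ C | σ e = true}.ncard

/-- `B` is a short barbell whose two negative cycles have edge sets `C₁` and `C₂`:
the two negative cycles meet in exactly one vertex. -/
def IsShortBarbellWith (G : SimpleGraph V) (σ : Sym2 V → Bool)
    (B C₁ C₂ : Set (Sym2 V)) : Prop :=
  ∃ S₁ S₂, IsNegCycle G σ C₁ S₁ ∧ IsNegCycle G σ C₂ S₂ ∧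
    (∃ v, S₁ ∩ S₂ = {v}) ∧ B = C₁ ∪ C₂

/-- `B` is a long barbell whose two negative cycles have edge sets `C₁` and `C₂`:
two vertex-disjoint negative cycles joined by a path meeting them only in its endpoints. -/
def IsLongBarbellWith (G : SimpleGraph V) (σ : Sym2 V → Bool)
    (B C₁ C₂ : Set (Sym2 V)) : Prop :=
  ∃ (S₁ S₂ : Set V) (u v : V) (p : G.Walk u v), IsNegCycle G σ C₁ S₁ ∧ IsNegCycle G σ C₂ S₂ ∧
    Disjoint S₁ S₂ ∧ p.IsPath ∧ u ∈ S₁ ∧ v ∈ S₂ ∧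
    {x | x ∈ p.support} ∩ S₁ = {u} ∧ {x | x ∈ p.support} ∩ S₂ = {v} ∧
    B = C₁ ∪ C₂ ∪ {e | e ∈ p.edges}

/-- `B` is a barbell whose two negative cycles have edge sets `C₁` and `C₂`. -/
def IsBarbellWith (G : SimpleGraph V) (σ : Sym2 V → Bool) (B C₁ C₂ : Set (Sym2 V)) : Prop :=
  IsShortBarbellWith G σ B C₁ C₂ ∨ IsLongBarbellWith G σ B C₁ C₂

/-- `B` is (the edge set of) a barbell of `(G, σ)`. -/
def IsBarbell (G : SimpleGraph V) (σ : Sym2 V → Bool) (B : Set (Sym2 V)) : Prop :=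
  ∃ C₁ C₂, IsBarbellWith G σ B C₁ C₂

/-- A signed-circuit is a positive cycle or a barbell. -/
def IsSignedCircuit (G : SimpleGraph V) (σ : Sym2 V → Bool) (D : Set (Sym2 V)) : Prop :=
  IsPosCycle G σ D ∨ IsBarbell G σ D

open Classical in
/-- `τ(G,σ)`: `|E(G)|` if there is no barbell, otherwise the minimum over all barbells of
the total number of edges of its two negative cycles. -/
noncomputable def tau (G : SimpleGraph V) (σ : Sym2 V → Bool) : ℕ :=
  if ∃ B, IsBarbell G σ B then
    sInf {n | ∃ B C₁ C₂, IsBarbellWith G σ B C₁ C₂ ∧ n = C₁.ncard + C₂.ncard}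
  else G.edgeSet.ncard

/-- The length of a family of signed-circuits (counted with multiplicity). -/
noncomputable def circuitLength (𝓕 : Multiset (Set (Sym2 V))) : ℕ := (𝓕.map Set.ncard).sum

/-- `𝓕` is a signed-circuit cover of `(G, σ)`. -/
def IsSignedCircuitCover (G : SimpleGraph V) (σ : Sym2 V → Bool)
    (𝓕 : Multiset (Set (Sym2 V))) : Prop :=
  (∀ C ∈ 𝓕, IsSignedCircuit G σ C) ∧ ∀ e ∈ G.edgeSet, ∃ C ∈ 𝓕, e ∈ C

/-- `e` has exactly one endpoint in `U`. -/
def Crosses (U : Set V) (e : Sym2 V) : Prop :=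
  ∃ x y, e = s(x, y) ∧ x ∈ U ∧ y ∉ U

open Classical in
/-- The signature obtained from `σ` by switching at the vertex set `U`. -/
noncomputable def switchSign (σ : Sym2 V → Bool) (U : Set V) : Sym2 V → Bool :=
  fun e => if Crosses U e then !(σ e) else σ e

/-- Two signatures are equivalent if one is obtained from the other by switching. -/
def EquivSign (σ σ' : Sym2 V → Bool) : Prop := ∃ U : Set V, σ' = switchSign σ U

/-- The minimum number of negative edges lying entirely inside `W`, over all signatures
equivalent to `σ` (the negativeness of the signed subgraph induced on `W`). -/
noncomputable def negOn (G : SimpleGraph V) (σ : Sym2 V → Bool) (W : Set V) : ℕ :=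
  sInf {n | ∃ U : Set V,
    n = {e | e ∈ G.edgeSet ∧ (∀ x ∈ e, x ∈ W) ∧ switchSign σ U e = true}.ncard}

/-- The negativeness `ε(G,σ)`. -/
noncomputable def negativeness (G : SimpleGraph V) (σ : Sym2 V → Bool) : ℕ :=
  negOn G σ Set.univ

/-- The signed subgraph induced on `W` is balanced. -/
def BalancedOn (G : SimpleGraph V) (σ : Sym2 V → Bool) (W : Set V) : Prop :=
  negOn G σ W = 0

/-- `(G, σ)` is flow-admissible: each connected component has negativeness ≠ 1, and
for every bridge, neither of the two components obtained by deleting it is balanced. -/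
def FlowAdmissible (G : SimpleGraph V) (σ : Sym2 V → Bool) : Prop :=
  ∀ x : V,
    negOn G σ {y | G.Reachable x y} ≠ 1 ∧
    ∀ e ∈ G.edgeSet, G.IsBridge e → (∀ z ∈ e, G.Reachable x z) →
      ∀ z ∈ e, ¬ BalancedOn G σ {y | (G.deleteEdges {e}).Reachable z y}

/-- `{e, f}` is a 2-edge-cut of `G`. -/
def IsTwoEdgeCut (G : SimpleGraph V) (e f : Sym2 V) : Prop :=
  e ∈ G.edgeSet ∧ f ∈ G.edgeSet ∧ e ≠ f ∧ ¬ G.IsBridge e ∧ ¬ G.IsBridge f ∧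
    ¬ (G.deleteEdges {e, f}).Connected


open SimpleGraph Set
namespace SCC
open scoped Classical
set_option linter.all false

section Flow
variable {V E : Type*} [Fintype V] [Fintype E] {R : Type*} [CommRing R]

/-- boundary of an edge weighting in a (multi)graph with source and target maps -/
noncomputable def fb (R : Type*) [CommRing R] (s t : E → V) : (E → R) →ₗ[R] (V → R) where
  toFun f v := ∑ e, f e * ((if s e = v then 1 else 0) - (if t e = v then 1 else 0))
  map_add' f g := by
    funext v; simp [add_mul, Finset.sum_add_distrib]
  map_smul' r f := by
    funext v; simp [mul_assoc, Finset.mul_sum]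

lemma fb_apply (s t : E → V) (f : E → R) (v : V) :
    fb R s t f v = ∑ e, f e * ((if s e = v then 1 else 0) - (if t e = v then 1 else 0)) := rfl

lemma fb_cut (s t : E → V) (f : E → R) (W : Finset V) :
    ∑ v ∈ W, fb R s t f v =
      ∑ e, f e * ((if s e ∈ W then 1 else 0) - (if t e ∈ W then 1 else 0)) := by
  simp only [fb_apply]
  rw [Finset.sum_comm]
  refine Finset.sum_congr rfl fun e _ => ?_
  rw [← Finset.mul_sum]
  congr 1
  rw [Finset.sum_sub_distrib]
  simp

lemma fb_single (s t : E → V) (e : E) :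
    fb R s t (Pi.single e 1) = Pi.single (s e) 1 - Pi.single (t e) 1 := by
  funext v
  rw [fb_apply, Finset.sum_eq_single e]
  · simp [Pi.single_apply, eq_comm]
  · intro b _ hb; simp [hb]
  · simp

/-- the edges inside `X` -/
def ein (s t : E → V) (X : Finset V) : Set E := {e | s e ∈ X ∧ t e ∈ X}

/-- weighting supported on `A` -/
def sup (f : E → R) (A : Set E) : Prop := ∀ e, e ∉ A → f e = 0

lemma sup.add {f g : E → R} {A : Set E} (hf : sup f A) (hg : sup g A) : sup (f + g) A :=
  fun e he => by simp [hf e he, hg e he]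
lemma sup.sub {f g : E → R} {A : Set E} (hf : sup f A) (hg : sup g A) : sup (f - g) A :=
  fun e he => by simp [hf e he, hg e he]
lemma sup.neg {f : E → R} {A : Set E} (hf : sup f A) : sup (-f) A :=
  fun e he => by simp [hf e he]
lemma sup.smul {f : E → R} {A : Set E} (r : R) (hf : sup f A) : sup (r • f) A :=
  fun e he => by simp [hf e he]
lemma sup.mono {f : E → R} {A B : Set E} (hf : sup f A) (h : A ⊆ B) : sup f B :=
  fun e he => hf e (fun h' => he (h h'))
lemma sup.sum {ι : Type*} (I : Finset ι) {f : ι → E → R} {A : Set E} (hf : ∀ i ∈ I, sup (f i) A) :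
    sup (∑ i ∈ I, f i) A := fun e he => by
  rw [Finset.sum_apply]; exact Finset.sum_eq_zero fun i hi => hf i hi e he
lemma sup.single {e : E} {A : Set E} (h : e ∈ A) (r : R) : sup (Pi.single e r : E → R) A :=
  fun e' he' => by
    rw [Pi.single_apply, if_neg]; rintro rfl; exact he' h
lemma sup_zero {A : Set E} : sup (0 : E → R) A := fun _ _ => rfl

lemma fb_out {s t : E → V} {f : E → R} {X : Finset V} (hf : sup f (ein s t X)) {v : V}
    (hv : v ∉ X) : fb R s t f v = 0 := by
  rw [fb_apply]
  refine Finset.sum_eq_zero fun e _ => ?_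
  by_cases he : e ∈ ein s t X
  · have h1 : s e ≠ v := fun h => hv (h ▸ he.1)
    have h2 : t e ≠ v := fun h => hv (h ▸ he.2)
    simp [h1, h2]
  · simp [hf e he]

/-- restriction of a weighting to `ein Y` when no support edge crosses `Y` -/
lemma fb_restrict {s t : E → V} {f : E → R} {Y : Finset V}
    (h : ∀ e, f e ≠ 0 → (s e ∈ Y ↔ t e ∈ Y)) (v : V) :
    fb R s t (fun e => if e ∈ ein s t Y then f e else 0) v = if v ∈ Y then fb R s t f v else 0 := by
  rw [fb_apply]
  split_ifs with hv
  · rw [fb_apply]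
    refine Finset.sum_congr rfl fun e _ => ?_
    by_cases he : f e = 0
    · simp [he]
    by_cases hs : s e ∈ Y
    · have : e ∈ ein s t Y := ⟨hs, (h e he).1 hs⟩
      simp [this]
    · have h1 : s e ≠ v := fun h => hs (h ▸ hv)
      have h2 : t e ≠ v := fun h' => hs ((h e he).2 (h' ▸ hv))
      simp [h1, h2]
  · refine Finset.sum_eq_zero fun e _ => ?_
    by_cases he : e ∈ ein s t Y
    · have h1 : s e ≠ v := fun h => hv (h ▸ he.1)
      have h2 : t e ≠ v := fun h => hv (h ▸ he.2)
      simp [h1, h2]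
    · simp [he]

/-- `e` joins `x` and `y` -/
def Inc (s t : E → V) (e : E) (x y : V) : Prop := (s e = x ∧ t e = y) ∨ (s e = y ∧ t e = x)

lemma Inc.symm {s t : E → V} {e : E} {x y : V} (h : Inc s t e x y) : Inc s t e y x := by unfold Inc at *; tauto

lemma Inc.unit {s t : E → V} {e : E} {x y : V} (h : Inc s t e x y) :
    ∃ r : R, (r = 1 ∨ r = -1) ∧ fb R s t (Pi.single e r) = Pi.single x 1 - Pi.single y 1 := by
  rcases h with ⟨rfl, rfl⟩ | ⟨rfl, rfl⟩
  · exact ⟨1, Or.inl rfl, fb_single s t e⟩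
  · refine ⟨-1, Or.inr rfl, ?_⟩
    rw [Pi.single_neg, map_neg, fb_single]; simp

/-- the number of edges with one end in `A` and the other in `B` -/
noncomputable def dc (s t : E → V) (A B : Finset V) : ℕ :=
  (Finset.univ.filter fun e => (s e ∈ A ∧ t e ∈ B) ∨ (s e ∈ B ∧ t e ∈ A)).card

lemma dc_comm (s t : E → V) (A B : Finset V) : dc s t A B = dc s t B A := by
  unfold dc; congr 1; ext e; simp; tauto

lemma dc_union (s t : E → V) (A B C : Finset V) (h : Disjoint B C) (hA : Disjoint A C) (hB : Disjoint A B) :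
    dc s t A (B ∪ C) = dc s t A B + dc s t A C := by
  unfold dc
  rw [← Finset.card_union_of_disjoint]
  · congr 1; ext e; simp; tauto
  · rw [Finset.disjoint_left] at *
    intro e; simp only [Finset.mem_filter, Finset.mem_univ, true_and]
    rintro (⟨h1, h2⟩ | ⟨h1, h2⟩) (⟨h3, h4⟩ | ⟨h3, h4⟩)
    · exact h h2 h4
    · exact hB h4 h2
    · exact hB h3 h1
    · exact h h1 h3

/-- two path lemma -/
lemma two_path (s t : E → V) (U : Finset V)
    (hU : ∀ W ⊆ U, W.Nonempty → W ≠ U → 2 ≤ dc s t W (U \ W)) (u v : V) (hu : u ∈ U) (hv : v ∈ U) :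
    ∃ f : E → ℤ, sup f (ein s t U) ∧ (∀ e, |f e| ≤ 1) ∧
      fb ℤ s t f = (2 : ℤ) • (Pi.single u 1 - Pi.single v 1) := by
  by_cases huv : u = v
  · exact ⟨0, sup_zero, by simp, by simp [huv]⟩
  have step : ∀ j : ℤ, 0 ≤ j → j ≤ 1 → (∃ f : E → ℤ, sup f (ein s t U) ∧ (∀ e, |f e| ≤ 1) ∧
      fb ℤ s t f = j • (Pi.single u 1 - Pi.single v 1)) →
      (∃ f : E → ℤ, sup f (ein s t U) ∧ (∀ e, |f e| ≤ 1) ∧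
      fb ℤ s t f = (j+1) • (Pi.single u 1 - Pi.single v 1)) := by
    rintro j hj0 hj ⟨f, hf, hf1, hfb⟩
    let P : Finset V → Prop := fun W => W ⊆ U ∧ u ∈ W ∧ ∀ w ∈ W, ∃ g : E → ℤ, sup g (ein s t W) ∧
      (∀ e, |f e + g e| ≤ 1) ∧ fb ℤ s t g = Pi.single u 1 - Pi.single w 1
    have hP0 : P {u} := by
      refine ⟨by simpa using hu, by simp, ?_⟩
      intro w hw
      rw [Finset.mem_singleton] at hw
      subst hw
      exact ⟨0, sup_zero, by simpa using hf1, by simp⟩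
    obtain ⟨W, hW, hmax⟩ := Finset.exists_max_image (Finset.univ.filter P) Finset.card ⟨{u}, by simpa using hP0⟩
    rw [Finset.mem_filter] at hW
    obtain ⟨-, hWU, huW, hWg⟩ := hW
    by_cases hvW : v ∈ W
    · obtain ⟨g, hg, hfg, hgb⟩ := hWg v hvW
      refine ⟨f + g, hf.add (hg.mono fun e he => ⟨hWU he.1, hWU he.2⟩), hfg, ?_⟩
      rw [map_add, hfb, hgb, add_smul, one_smul]
    exfalso
    -- every leaving edge is saturated
    have hsat : ∀ e w z r, w ∈ W → z ∈ U → z ∉ W → Inc s t e w z → (r = 1 ∨ r = -1) →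
        fb ℤ s t (Pi.single e r) = Pi.single w 1 - Pi.single z 1 → f e = r := by
      intro e w z r hw hz hzW hinc hr hrb
      by_contra hne
      have hP : P (insert z W) := by
        refine ⟨Finset.insert_subset hz hWU, by simp [huW], ?_⟩
        have hsub : ein s t W ⊆ ein s t (insert z W) := fun e he =>
          ⟨Finset.mem_insert_of_mem he.1, Finset.mem_insert_of_mem he.2⟩
        intro w' hw'
        rcases Finset.mem_insert.1 hw' with rfl | hw'
        · obtain ⟨g, hg, hfg, hgb⟩ := hWg w hw
          have heW : e ∉ ein s t W := by
            rintro ⟨h1, h2⟩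
            rcases hinc with ⟨rfl, rfl⟩ | ⟨rfl, rfl⟩
            · exact hzW h2
            · exact hzW h1
          have hein : e ∈ ein s t (insert w' W) := by
            rcases hinc with ⟨rfl, rfl⟩ | ⟨rfl, rfl⟩
            · exact ⟨by simp [hw], by simp⟩
            · exact ⟨by simp, by simp [hw]⟩
          refine ⟨g + Pi.single e r, (hg.mono hsub).add (sup.single hein r), ?_, ?_⟩
          · intro e'
            by_cases h : e' = e
            · subst h
              have := abs_le.1 (hf1 e')
              simp only [Pi.add_apply, hg e' heW, Pi.single_eq_same]
              rw [abs_le]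
              rcases hr with rfl | rfl <;> omega
            · simpa [Pi.single_apply, h] using hfg e'
          · rw [map_add, hgb, hrb]; abel
        · obtain ⟨g, hg, h⟩ := hWg w' hw'
          exact ⟨g, hg.mono hsub, h⟩
      have := hmax (insert z W) (by simpa using hP)
      rw [Finset.card_insert_of_notMem hzW] at this
      omega
    have hcut := fb_cut s t f W
    rw [hfb] at hcut
    have hL : ∑ x ∈ W, (j • (Pi.single u 1 - Pi.single v 1 : V → ℤ)) x = j := by
      simp [← Finset.mul_sum, Finset.sum_sub_distrib, Pi.single_apply, huW, hvW]
    rw [hL] at hcut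
    have hd : (dc s t W (U \ W) : ℤ) = ∑ e, f e * ((if s e ∈ W then 1 else 0) - (if t e ∈ W then 1 else 0)) := by
      unfold dc
      rw [Finset.card_filter, Nat.cast_sum]
      refine Finset.sum_congr rfl fun e _ => ?_
      by_cases he : e ∈ ein s t U
      · obtain ⟨h1, h2⟩ := he
        by_cases hs : s e ∈ W <;> by_cases ht : t e ∈ W
        · simp [hs, ht]
        · have := hsat e (s e) (t e) 1 hs h2 ht (Or.inl ⟨rfl, rfl⟩) (Or.inl rfl) (fb_single s t e)
          simp [hs, ht, h2, this]
        · have := hsat e (t e) (s e) (-1) ht h1 hs (Or.inr ⟨rfl, rfl⟩) (Or.inr rfl)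
            (by rw [Pi.single_neg, map_neg, fb_single]; simp)
          simp [hs, ht, h1, this]
        · simp [hs, ht]
      · rw [hf e he]
        have : ¬ ((s e ∈ W ∧ t e ∈ U \ W) ∨ (s e ∈ U \ W ∧ t e ∈ W)) := by
          rintro (⟨h1, h2⟩ | ⟨h1, h2⟩)
          · exact he ⟨hWU h1, (Finset.mem_sdiff.1 h2).1⟩
          · exact he ⟨(Finset.mem_sdiff.1 h1).1, hWU h2⟩
        rw [if_neg this]; simp
    have := hU W hWU ⟨u, huW⟩ (by rintro rfl; exact hvW hv)
    omega
  have h1 := step 0 le_rfl (by norm_num) ⟨0, sup_zero, by simp, by simp⟩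
  have h2 := step 1 (by norm_num) le_rfl h1
  exact h2
end Flow
end SCC

open SimpleGraph Set
namespace SCC
open scoped Classical
set_option linter.all false

section Flow
variable {V E : Type*} [Fintype V] [Fintype E]

def Good (s t : E → V) (X : Finset V) (c : E → ZMod 2) : Prop :=
  sup c (ein s t X) ∧ fb (ZMod 2) s t c = 0 ∧
  (∀ u ∈ X, ∀ v ∈ X, ∃ p : E → ZMod 3, sup p (ein s t X) ∧
    fb (ZMod 3) s t p = Pi.single u 1 - Pi.single v 1) ∧
  ∀ a : E → ZMod 3, ∃ g : E → ZMod 3, sup g (ein s t X) ∧ fb (ZMod 3) s t g = 0 ∧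
    ∀ e ∈ ein s t X, c e = 0 → g e ≠ a e

lemma good_base (s t : E → V) (v : V) : Good s t {v} 0 := by
  refine ⟨sup_zero, map_zero _, ?_, ?_⟩
  · intro u hu w hw
    rw [Finset.mem_singleton] at hu hw
    subst hu; subst hw
    exact ⟨0, sup_zero, by simp⟩
  · intro a
    refine ⟨fun e => if e ∈ ein s t {v} then a e + 1 else 0, fun e he => by simp [he], ?_, ?_⟩
    · funext x
      rw [fb_apply]
      refine Finset.sum_eq_zero fun e _ => ?_
      by_cases he : e ∈ ein s t {v}
      · have h1 : s e = v := by simpa using he.1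
        have h2 : t e = v := by simpa using he.2
        simp [h1, h2]
      · simp [he]
    · intro e he _
      simp [he]

lemma ein_mono {s t : E → V} {X Y : Finset V} (h : X ⊆ Y) : ein s t X ⊆ ein s t Y :=
  fun _ he => ⟨h he.1, h he.2⟩

lemma good_step (s t : E → V) (X : Finset V) (c : E → ZMod 2) (hX : Good s t X c) (U : Finset V)
    (hXU : Disjoint X U)
    (hU : ∀ W ⊆ U, W.Nonempty → W ≠ U → 2 ≤ dc s t W (U \ W))
    (e1 e2 : E) (hne : e1 ≠ e2) (u v x1 x2 : V) (hu : u ∈ U) (hv : v ∈ U) (hx1 : x1 ∈ X) (hx2 : x2 ∈ X)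
    (h1 : Inc s t e1 u x1) (h2 : Inc s t e2 v x2) :
    ∃ Y ⊆ U, Y.Nonempty ∧ ∃ c', Good s t (X ∪ Y) c' := by
  obtain ⟨f, hf, hf1, hfb⟩ := two_path s t U hU u v hu hv
  obtain ⟨hc, hcb, hcon, hflex⟩ := hX
  -- the set Y
  let Y : Finset V := Finset.univ.filter fun w => ∃ p : E → ZMod 3, (∀ e, p e ≠ 0 → f e ≠ 0) ∧
    fb (ZMod 3) s t p = Pi.single u 1 - Pi.single w 1
  have huY : u ∈ Y := by
    simp only [Y, Finset.mem_filter, Finset.mem_univ, true_and]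
    exact ⟨0, by simp, by simp⟩
  have hYU : Y ⊆ U := by
    intro w hw
    simp only [Y, Finset.mem_filter, Finset.mem_univ, true_and] at hw
    obtain ⟨p, hp, hpb⟩ := hw
    by_contra hwU
    have hps : sup p (ein s t U) := fun e he => by
      by_contra h; exact hp e h (hf e he)
    have := fb_out hps hwU
    rw [hpb] at this
    have hwu : w ≠ u := by rintro rfl; exact hwU hu
    simp [Pi.single_apply, hwu] at this
  have hclosed : ∀ e w z, f e ≠ 0 → Inc s t e w z → w ∈ Y → z ∈ Y := by
    intro e w z he hinc hw
    simp only [Y, Finset.mem_filter, Finset.mem_univ, true_and] at hw ⊢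
    obtain ⟨p, hp, hpb⟩ := hw
    obtain ⟨r, hr, hrb⟩ := hinc.unit (R := ZMod 3)
    refine ⟨p + Pi.single e r, ?_, ?_⟩
    · intro e' h'
      by_cases h : e' = e
      · subst h; exact he
      · apply hp; simpa [Pi.single_apply, h] using h'
    · rw [map_add, hpb, hrb]; abel
  have hclosed' : ∀ e, f e ≠ 0 → (s e ∈ Y ↔ t e ∈ Y) := fun e he =>
    ⟨hclosed e _ _ he (Or.inl ⟨rfl, rfl⟩), hclosed e _ _ he (Or.inr ⟨rfl, rfl⟩)⟩
  have hvY : v ∈ Y := by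
    by_contra hvY
    have hcut := fb_cut s t f Y
    rw [hfb] at hcut
    have hL : ∑ x ∈ Y, ((2 : ℤ) • (Pi.single u 1 - Pi.single v 1 : V → ℤ)) x = 2 := by
      simp [← Finset.mul_sum, Finset.sum_sub_distrib, Pi.single_apply, huY, hvY]
    rw [hL, Finset.sum_eq_zero] at hcut
    · norm_num at hcut
    · intro e _
      by_cases he : f e = 0
      · simp [he]
      · simp [hclosed' e he]
  have hXY : Disjoint X Y := Finset.disjoint_of_subset_right hYU hXU
  -- core edges
  let F : Set E := {e | e ∈ ein s t Y ∧ f e ≠ 0}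
  let core : Set E := ein s t X ∪ F ∪ {e1}
  have hFY : ∀ w ∈ Y, ∃ p : E → ZMod 3, sup p F ∧
      fb (ZMod 3) s t p = Pi.single u 1 - Pi.single w 1 := by
    intro w hw
    have hw' := hw
    simp only [Y, Finset.mem_filter, Finset.mem_univ, true_and] at hw'
    obtain ⟨p, hp, hpb⟩ := hw'
    refine ⟨fun e => if e ∈ ein s t Y then p e else 0, ?_, ?_⟩
    · intro e he
      by_cases h : e ∈ ein s t Y
      · simp only [h, if_true]
        by_contra hpe
        exact he ⟨h, hp e hpe⟩
      · simp [h]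
    · funext z
      rw [fb_restrict (fun e he => hclosed' e (hp e he))]
      split_ifs with hz
      · rw [hpb]
      · have h1 : z ≠ u := by rintro rfl; exact hz huY
        have h2 : z ≠ w := by rintro rfl; exact hz hw
        simp [Pi.single_apply, h1, h2]
  have hcore0 : ∀ w ∈ X ∪ Y, ∃ p : E → ZMod 3, sup p core ∧
      fb (ZMod 3) s t p = Pi.single x1 1 - Pi.single w 1 := by
    intro w hw
    rcases Finset.mem_union.1 hw with hw | hw
    · obtain ⟨p, hp, hpb⟩ := hcon x1 hx1 w hw
      exact ⟨p, hp.mono (fun e he => Or.inl (Or.inl he)), hpb⟩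
    · obtain ⟨p, hp, hpb⟩ := hFY w hw
      obtain ⟨r, hr, hrb⟩ := h1.symm.unit (R := ZMod 3)
      refine ⟨Pi.single e1 r + p, (sup.single (show e1 ∈ core from Or.inr rfl) r).add (hp.mono fun e he => Or.inl (Or.inr he)), ?_⟩
      rw [map_add, hrb, hpb]; abel
  have hcore : ∀ w ∈ X ∪ Y, ∀ z ∈ X ∪ Y, ∃ p : E → ZMod 3, sup p core ∧
      fb (ZMod 3) s t p = Pi.single w 1 - Pi.single z 1 := by
    intro w hw z hz
    obtain ⟨p, hp, hpb⟩ := hcore0 w hw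
    obtain ⟨q, hq, hqb⟩ := hcore0 z hz
    exact ⟨q - p, hq.sub hp, by rw [map_sub, hpb, hqb]; abel⟩
  have hcsub : core ⊆ ein s t (X ∪ Y) := by
    rintro e ((he | he) | he)
    · exact ein_mono Finset.subset_union_left he
    · exact ein_mono Finset.subset_union_right he.1
    · rw [Set.mem_singleton_iff] at he; subst he
      rcases h1 with ⟨rfl, rfl⟩ | ⟨rfl, rfl⟩
      · exact ⟨Finset.mem_union_right _ huY, Finset.mem_union_left _ hx1⟩
      · exact ⟨Finset.mem_union_left _ hx1, Finset.mem_union_right _ huY⟩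
  have he2 : e2 ∈ ein s t (X ∪ Y) := by
    rcases h2 with ⟨rfl, rfl⟩ | ⟨rfl, rfl⟩
    · exact ⟨Finset.mem_union_right _ hvY, Finset.mem_union_left _ hx2⟩
    · exact ⟨Finset.mem_union_left _ hx2, Finset.mem_union_right _ hvY⟩
  have hnotX : ∀ e w x, Inc s t e w x → w ∈ Y → e ∉ ein s t X := by
    rintro e w x (⟨rfl, rfl⟩ | ⟨rfl, rfl⟩) hw he
    · exact Finset.disjoint_left.1 hXY he.1 hw
    · exact Finset.disjoint_left.1 hXY he.2 hw
  have hnotY : ∀ e w x, Inc s t e w x → x ∈ X → e ∉ ein s t Y := by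
    rintro e w x (⟨rfl, rfl⟩ | ⟨rfl, rfl⟩) hw he
    · exact Finset.disjoint_left.1 hXY hw he.2
    · exact Finset.disjoint_left.1 hXY hw he.1
  have he2c : e2 ∉ core := by
    rintro ((he | he) | he)
    · exact hnotX _ _ _ h2 hvY he
    · exact hnotY _ _ _ h2 hx2 he.1
    · exact hne he.symm
  -- fundamental circuits
  have hfund : ∀ q, ∃ z : E → ZMod 3, q ∈ ein s t (X ∪ Y) → q ∉ core →
      (z q = 1 ∧ (∀ e, e ∉ core → e ≠ q → z e = 0) ∧ fb (ZMod 3) s t z = 0) := by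
    intro q
    by_cases hq : q ∈ ein s t (X ∪ Y)
    · by_cases hqc : q ∈ core
      · exact ⟨0, fun _ h => absurd hqc h⟩
      obtain ⟨p, hp, hpb⟩ := hcore (t q) hq.2 (s q) hq.1
      refine ⟨Pi.single q 1 + p, fun _ _ => ⟨by simp [hp q hqc], ?_, ?_⟩⟩
      · intro e he heq
        simp [hp e he, Pi.single_apply, heq]
      · rw [map_add, fb_single, hpb]; abel
    · exact ⟨0, fun h => absurd h hq⟩
  choose z hz using hfund
  -- c'
  let c' : E → ZMod 2 := c + fun e => if e ∈ ein s t Y then (f e : ZMod 2) else 0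
  have hcX : ∀ e ∈ ein s t X, c' e = c e := by
    intro e he
    have : e ∉ ein s t Y := fun h => Finset.disjoint_left.1 hXY he.1 h.1
    simp [c', this]
  refine ⟨Y, hYU, ⟨u, huY⟩, c', ?_, ?_, ?_, ?_⟩
  · refine (hc.mono (ein_mono Finset.subset_union_left)).add ?_
    intro e he
    have : e ∉ ein s t Y := fun h => he (ein_mono Finset.subset_union_right h)
    simp [this]
  · rw [map_add, hcb, zero_add]
    funext w
    have h' : ∀ e, ((f e : ℤ) : ZMod 2) ≠ 0 → (s e ∈ Y ↔ t e ∈ Y) := fun e he =>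
      hclosed' e (fun h => he (by simp [h]))
    rw [fb_restrict h']
    split_ifs with hw
    · have : fb (ZMod 2) s t (fun e => (f e : ZMod 2)) w = ((fb ℤ s t f w : ℤ) : ZMod 2) := by
        rw [fb_apply, fb_apply]
        push_cast
        rfl
      rw [this, hfb]
      simp only [Pi.smul_apply, smul_eq_mul, Int.cast_mul, Pi.zero_apply]
      have : ((2 : ℤ) : ZMod 2) = 0 := by decide
      rw [this, zero_mul]
    · rfl
  · intro w hw x hx
    obtain ⟨p, hp, hpb⟩ := hcore w hw x hx
    exact ⟨p, hp.mono hcsub, hpb⟩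
  · intro a
    let Q : Finset E := Finset.univ.filter fun q => q ∈ ein s t (X ∪ Y) ∧ q ∉ core ∧ q ≠ e2
    let g1 : E → ZMod 3 := ∑ q ∈ Q, (a q + 1) • z q
    have hg1 : sup g1 (ein s t (X ∪ Y)) := by
      refine sup.sum _ fun q hq => ?_
      simp only [Q, Finset.mem_filter, Finset.mem_univ, true_and] at hq
      refine sup.smul _ fun e he => ?_
      exact (hz q hq.1 hq.2.1).2.1 e (fun h => he (hcsub h)) (by rintro rfl; exact he hq.1)
    have hg1b : fb (ZMod 3) s t g1 = 0 := by
      rw [map_sum]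
      refine Finset.sum_eq_zero fun q hq => ?_
      simp only [Q, Finset.mem_filter, Finset.mem_univ, true_and] at hq
      rw [map_smul, (hz q hq.1 hq.2.1).2.2, smul_zero]
    have hg1Q : ∀ q ∈ Q, g1 q = a q + 1 := by
      intro q hq
      have hq0 := hq
      simp only [Q, Finset.mem_filter, Finset.mem_univ, true_and] at hq
      simp only [g1]
      rw [Finset.sum_apply, Finset.sum_eq_single q]
      · simp [(hz q hq.1 hq.2.1).1]
      · intro b hb hbq
        simp only [Q, Finset.mem_filter, Finset.mem_univ, true_and] at hb
        simp [(hz b hb.1 hb.2.1).2.1 q hq.2.1 hbq.symm]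
      · intro h; exact absurd hq0 h
    obtain ⟨hz1, hz2, hz3⟩ := hz e2 he2 he2c
    have hze1 : z e2 e1 ≠ 0 := by
      intro h0
      have hcut := fb_cut s t (z e2) Y
      rw [hz3] at hcut
      rw [Finset.sum_eq_single e2] at hcut
      · rw [hz1] at hcut
        rcases h2 with ⟨ha, hb⟩ | ⟨ha, hb⟩
        · have h3 : x2 ∉ Y := Finset.disjoint_left.1 hXY hx2
          simp [ha, hb, hvY, h3] at hcut
        · have h3 : x2 ∉ Y := Finset.disjoint_left.1 hXY hx2
          simp [ha, hb, hvY, h3] at hcut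
      · intro e _ hee
        by_cases hec : e ∈ core
        · rcases hec with (he | he) | he
          · have h3 := Finset.disjoint_left.1 hXY he.1
            have h4 := Finset.disjoint_left.1 hXY he.2
            simp [h3, h4]
          · simp [he.1.1, he.1.2]
          · rw [Set.mem_singleton_iff] at he
            simp [he, h0]
        · simp [hz2 e hec hee]
      · simp
    obtain ⟨k, hk1, hk2⟩ : ∃ k : ZMod 3, g1 e1 + k * z e2 e1 ≠ a e1 ∧ g1 e2 + k ≠ a e2 := by
      generalize g1 e1 = p1 at *
      generalize g1 e2 = p2 at *
      generalize z e2 e1 = p3 at *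
      generalize a e1 = p4 at *
      generalize a e2 = p5 at *
      revert p1 p2 p3 p4 p5
      decide
    obtain ⟨g3, hg3, hg3b, hg3a⟩ := hflex (fun e => a e - (g1 e + k * z e2 e))
    have hze2s : sup (z e2) (ein s t (X ∪ Y)) := fun e he =>
      hz2 e (fun h => he (hcsub h)) (by rintro rfl; exact he he2)
    refine ⟨g1 + k • z e2 + g3, (hg1.add (hze2s.smul k)).add (hg3.mono (ein_mono Finset.subset_union_left)), ?_, ?_⟩
    · rw [map_add, map_add, map_smul, hg1b, hz3, hg3b]; simp
    · intro e he hce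
      by_cases heX : e ∈ ein s t X
      · rw [hcX e heX] at hce
        have := hg3a e heX hce
        intro h
        apply this
        simp only [Pi.add_apply, Pi.smul_apply, smul_eq_mul] at h
        rw [← h]; ring
      simp only [Pi.add_apply, Pi.smul_apply, smul_eq_mul, hg3 e heX, add_zero]
      by_cases heF : e ∈ F
      · exfalso
        have h1 := abs_le.1 (hf1 e)
        have h2 := heF.2
        have h3 : f e = 1 ∨ f e = -1 := by omega
        simp only [c', Pi.add_apply, hc e heX, heF.1, if_true, zero_add] at hce
        rcases h3 with h3 | h3 <;> rw [h3] at hce <;> revert hce <;> decide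
      by_cases hee1 : e = e1
      · subst hee1; exact hk1
      by_cases hee2 : e = e2
      · subst hee2; rw [hz1, mul_one]; exact hk2
      have hec : e ∉ core := by
        rintro ((h | h) | h)
        · exact heX h
        · exact heF h
        · exact hee1 h
      rw [hz2 e hec hee2, mul_zero, add_zero, hg1Q e (by simp [Q, he, hec, hee2])]
      simp

end Flow
end SCC

open SimpleGraph Set
namespace SCC
open scoped Classical
set_option linter.all false

section Flow
variable {V E : Type*} [Fintype V] [Fintype E]

noncomputable def cut (s t : E → V) (W : Finset V) : Finset E :=
  Finset.univ.filter fun e => ¬ (s e ∈ W ↔ t e ∈ W)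

lemma fb_cut' {R : Type*} [CommRing R] (s t : E → V) (f : E → R) (W : Finset V) :
    ∑ v ∈ W, fb R s t f v =
      ∑ e ∈ cut s t W, f e * ((if s e ∈ W then 1 else 0) - (if t e ∈ W then 1 else 0)) := by
  rw [fb_cut]
  symm
  apply Finset.sum_subset (Finset.subset_univ _)
  intro e _ he
  simp only [cut, Finset.mem_filter, Finset.mem_univ, true_and, not_not] at he
  simp [he]

noncomputable def coll (u w : V) (x : V) : V := if x = w then u else x

lemma fb_coll {R : Type*} [CommRing R] (s t : E → V) (g : E → R) (u w : V) (huw : u ≠ w)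
    (h : fb R (coll u w ∘ s) (coll u w ∘ t) g = 0) :
    (∀ v, v ≠ u → v ≠ w → fb R s t g v = 0) ∧ fb R s t g w = - fb R s t g u := by
  constructor
  · intro v hu hw
    refine Eq.trans ?_ (congrFun h v)
    rw [fb_apply, fb_apply]
    refine Finset.sum_congr rfl fun e _ => ?_
    have : ∀ x, (coll u w x = v) = (x = v) := by
      intro x; unfold coll
      split_ifs with hx
      · subst hx; simp [hu.symm, hw.symm]
      · rfl
    simp [this]
  · have h1 := congrFun h u
    rw [fb_apply] at h1
    rw [eq_neg_iff_add_eq_zero, fb_apply, fb_apply, ← Finset.sum_add_distrib]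
    refine Eq.trans ?_ h1
    refine Finset.sum_congr rfl fun e _ => ?_
    have : ∀ x, (if coll u w x = u then (1 : R) else 0) = (if x = w then 1 else 0) + (if x = u then 1 else 0) := by
      intro x; unfold coll
      by_cases hx : x = w
      · subst hx; simp [huw.symm]
      · simp [hx]
    simp only [Function.comp, this]
    ring

lemma coll_fix {R : Type*} [CommRing R] (s t : E → V) (g : E → R) (u w : V) (huw : u ≠ w)
    (h : fb R (coll u w ∘ s) (coll u w ∘ t) g = 0) (e1 : E) (h1 : Inc s t e1 u w) :
    ∃ g2 : E → R, fb R s t g2 = 0 ∧ ∀ e, e ≠ e1 → g2 e = g e := by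
  obtain ⟨r, hr, hrb⟩ := h1.unit (R := R)
  obtain ⟨ha, hb⟩ := fb_coll s t g u w huw h
  refine ⟨g - (fb R s t g u) • Pi.single e1 r, ?_, ?_⟩
  · rw [map_sub, map_smul, hrb]
    funext v
    by_cases hu : v = u
    · subst hu; simp [huw]
    by_cases hw : v = w
    · subst hw; simp [hu, hb, Pi.single_apply]
    · simp [hu, hw, ha v hu hw, Pi.single_apply]
  · intro e he
    simp [Pi.single_apply, he]

lemma cut_coll (s t : E → V) (u w : V) (W : Finset V) :
    cut (coll u w ∘ s) (coll u w ∘ t) W = cut s t (Finset.univ.filter fun x => coll u w x ∈ W) := by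
  ext e; simp [cut]

theorem six (n : ℕ) : ∀ (s t : E → V) (S : Finset V), S.card = n → (∀ e, s e ∈ S ∧ t e ∈ S) →
    (∀ W, (cut s t W).card ≠ 1) →
    ∃ (c : E → ZMod 2) (g : E → ZMod 3), fb (ZMod 2) s t c = 0 ∧ fb (ZMod 3) s t g = 0 ∧
      ∀ e, c e = 0 → g e ≠ 0 := by
  induction n with
  | zero =>
    intro s t S hS hE _
    rw [Finset.card_eq_zero] at hS
    subst hS
    exact ⟨0, 0, map_zero _, map_zero _, fun e => absurd (hE e).1 (by simp)⟩
  | succ n ih =>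
    intro s t S hS hE hcut
    by_cases hsmall : ∃ W : Finset V, (∃ u ∈ S, u ∈ W) ∧ (∃ w ∈ S, w ∉ W) ∧ (cut s t W).card ≤ 2
    · obtain ⟨W, ⟨u, huS, huW⟩, ⟨w, hwS, hwW⟩, hW⟩ := hsmall
      have hIH : ∀ u w, u ∈ S → w ∈ S → u ≠ w → ∃ (c : E → ZMod 2) (g : E → ZMod 3),
          fb (ZMod 2) (coll u w ∘ s) (coll u w ∘ t) c = 0 ∧
          fb (ZMod 3) (coll u w ∘ s) (coll u w ∘ t) g = 0 ∧ ∀ e, c e = 0 → g e ≠ 0 := by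
        intro u w hu hw huw
        refine ih (coll u w ∘ s) (coll u w ∘ t) (S.erase w) (by rw [Finset.card_erase_of_mem hw, hS]; rfl) ?_ ?_
        · have : ∀ x ∈ S, coll u w x ∈ S.erase w := by
            intro x hx
            unfold coll
            split_ifs with h
            · exact Finset.mem_erase.2 ⟨huw, hu⟩
            · exact Finset.mem_erase.2 ⟨h, hx⟩
          exact fun e => ⟨this _ (hE e).1, this _ (hE e).2⟩
        · intro W; rw [cut_coll]; exact hcut _
      by_cases h0 : (cut s t W).card = 0
      · have huw : u ≠ w := by rintro rfl; exact hwW huW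
        obtain ⟨c, g, hc, hg, hcg⟩ := hIH u w huS hwS huw
        have key : ∀ {R : Type} [CommRing R] (f : E → R), fb R (coll u w ∘ s) (coll u w ∘ t) f = 0 →
            fb R s t f = 0 := by
          intro R _ f hf
          obtain ⟨ha, hb⟩ := fb_coll s t f u w huw hf
          have h1 := fb_cut' s t f W
          rw [Finset.card_eq_zero.1 h0, Finset.sum_empty, Finset.sum_eq_single u] at h1
          · funext v
            by_cases hu : v = u
            · subst hu; exact h1
            by_cases hw : v = w
            · subst hw; rw [hb, h1]; simp
            exact ha v hu hw
          · intro b hb1 hb2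
            exact ha b hb2 (by rintro rfl; exact hwW hb1)
          · intro h; exact absurd huW h
        exact ⟨c, g, key c hc, key g hg, hcg⟩
      · have h2 : (cut s t W).card = 2 := by have := hcut W; omega
        obtain ⟨e1, e2, hne, hW2⟩ := Finset.card_eq_two.1 h2
        have he1 : e1 ∈ cut s t W := by rw [hW2]; simp
        have he2 : e2 ∈ cut s t W := by rw [hW2]; simp
        simp only [cut, Finset.mem_filter, Finset.mem_univ, true_and] at he1 he2
        have huw : s e1 ≠ t e1 := by intro h; rw [h] at he1; exact he1 Iff.rfl
        obtain ⟨c, g, hc, hg, hcg⟩ := hIH (s e1) (t e1) (hE e1).1 (hE e1).2 huw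
        obtain ⟨c2, hc2, hc2e⟩ := coll_fix s t c _ _ huw hc e1 (Or.inl ⟨rfl, rfl⟩)
        obtain ⟨g2, hg2, hg2e⟩ := coll_fix s t g _ _ huw hg e1 (Or.inl ⟨rfl, rfl⟩)
        have key : ∀ {R : Type} [CommRing R] (f : E → R), fb R s t f = 0 → (f e1 = 0 ↔ f e2 = 0) := by
          intro R _ f hf
          have h1 := fb_cut' s t f W
          rw [hf, hW2, Finset.sum_pair hne] at h1
          simp only [Pi.zero_apply, Finset.sum_const_zero] at h1
          have hu : ∀ e, ¬ (s e ∈ W ↔ t e ∈ W) → ((if s e ∈ W then (1:R) else 0) - (if t e ∈ W then 1 else 0) = 1 ∨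
              (if s e ∈ W then (1:R) else 0) - (if t e ∈ W then 1 else 0) = -1) := by
            intro e he
            by_cases h : s e ∈ W <;> by_cases h' : t e ∈ W
            · exact absurd (iff_of_true h h') he
            · simp [h, h']
            · simp [h, h']
            · exact absurd (iff_of_false h h') he
          constructor
          · intro h; rw [h] at h1
            rcases hu e2 he2 with h' | h' <;> rw [h'] at h1 <;> simpa using h1.symm
          · intro h; rw [h] at h1
            rcases hu e1 he1 with h' | h' <;> rw [h'] at h1 <;> simpa using h1.symm
        refine ⟨c2, g2, hc2, hg2, ?_⟩
        intro e he
        by_cases hee : e = e1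
        · subst hee
          rw [Ne, key g2 hg2, hg2e e2 hne.symm]
          rw [key c2 hc2, hc2e e2 hne.symm] at he
          exact hcg _ he
        · rw [hg2e e hee]; rw [hc2e e hee] at he; exact hcg e he
    · push Not at hsmall
      have hSne : S.Nonempty := by rw [← Finset.card_pos]; omega
      obtain ⟨v, hv⟩ := hSne
      obtain ⟨X, hX, hmax⟩ := Finset.exists_max_image
        (Finset.univ.filter fun X : Finset V => X ⊆ S ∧ X.Nonempty ∧ ∃ c, Good s t X c) Finset.card
        ⟨{v}, by simp only [Finset.mem_filter, Finset.mem_univ, true_and]; exact ⟨by simpa using hv, by simp, 0, good_base s t v⟩⟩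
      simp only [Finset.mem_filter, Finset.mem_univ, true_and] at hX hmax
      obtain ⟨hXS, hXne, c, hc⟩ := hX
      by_cases hXS' : X = S
      · subst hXS'
        obtain ⟨hc1, hc2, hc3, hc4⟩ := hc
        obtain ⟨g, hg, hgb, hga⟩ := hc4 0
        exact ⟨c, g, hc2, hgb, fun e he => hga e (hE e) he⟩
      exfalso
      have hdc : ∀ W ⊆ S, dc s t W (S \ W) = (cut s t W).card := by
        intro W hW
        unfold dc cut
        congr 1; ext e
        have := hE e
        simp only [Finset.mem_filter, Finset.mem_univ, true_and, Finset.mem_sdiff]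
        tauto
      have hRne : (S \ X).Nonempty := by
        rw [Finset.sdiff_nonempty]; intro h; exact hXS' (Finset.Subset.antisymm hXS h)
      obtain ⟨U, hU, hmin⟩ := Finset.exists_min_image
        (Finset.univ.filter fun U : Finset V => U ⊆ S \ X ∧ U.Nonempty ∧ dc s t U ((S \ X) \ U) ≤ 1) Finset.card
        ⟨S \ X, by
          simp only [Finset.mem_filter, Finset.mem_univ, true_and]
          refine ⟨Finset.Subset.refl _, hRne, ?_⟩
          rw [Finset.sdiff_self]; simp [dc]⟩
      simp only [Finset.mem_filter, Finset.mem_univ, true_and] at hU hmin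
      obtain ⟨hUR, hUne, hU1⟩ := hU
      have hUX : Disjoint X U := by
        rw [Finset.disjoint_left]; intro x hx hxU; exact (Finset.mem_sdiff.1 (hUR hxU)).2 hx
      have hUS : U ⊆ S := hUR.trans Finset.sdiff_subset
      -- at least two edges to X
      have hUX2 : 2 ≤ dc s t U X := by
        have h3 : 2 < (cut s t U).card := by
          obtain ⟨a, ha⟩ := hUne
          obtain ⟨b, hb⟩ := hXne
          exact hsmall U ⟨a, hUS ha, ha⟩ ⟨b, hXS hb, Finset.disjoint_left.1 hUX hb⟩
        rw [← hdc U hUS] at h3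
        have : S \ U = X ∪ ((S \ X) \ U) := by
          ext x; simp only [Finset.mem_sdiff, Finset.mem_union]
          have h1 := @hXS x; have h2 : x ∈ X → x ∉ U := fun h => Finset.disjoint_left.1 hUX h
          tauto
        rw [this, dc_union] at h3
        · omega
        · rw [Finset.disjoint_left]; intro x hx; simp [hx]
        · rw [Finset.disjoint_left]; intro x hx; simp [hx]
        · exact hUX.symm
      have hUcut : ∀ W ⊆ U, W.Nonempty → W ≠ U → 2 ≤ dc s t W (U \ W) := by
        have aux : ∀ W ⊆ U, W.Nonempty → W ≠ U → 2 ≤ dc s t W (U \ W) + dc s t W ((S \ X) \ U) := by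
          intro W hW hWne hWU
          by_contra hlt
          have : (S \ X) \ W = (U \ W) ∪ ((S \ X) \ U) := by
            ext x; simp only [Finset.mem_sdiff, Finset.mem_union]
            have h1 := @hW x; have h2 := @hUR x; simp only [Finset.mem_sdiff] at h2
            tauto
          have h1 := hmin W ⟨hW.trans hUR, hWne, ?_⟩
          · exact hWU (Finset.eq_of_subset_of_card_le hW h1)
          · rw [this, dc_union]
            · omega
            · rw [Finset.disjoint_left]; intro x hx; simp at hx; simp [hx.1]
            · rw [Finset.disjoint_left]; intro x hx; simp [hW hx]
            · rw [Finset.disjoint_left]; intro x hx; simp [hx]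
        intro W hW hWne hWU
        have h1 := aux W hW hWne hWU
        have h2 := aux (U \ W) Finset.sdiff_subset (by
          rw [Finset.sdiff_nonempty]; intro h; exact hWU (Finset.Subset.antisymm hW h)) (by
          intro h
          obtain ⟨x, hx⟩ := hWne
          have : x ∈ U \ W := by rw [h]; exact hW hx
          exact (Finset.mem_sdiff.1 this).2 hx)
        have h3 : U \ (U \ W) = W := by
          rw [Finset.sdiff_sdiff_eq_self hW]
        rw [h3, dc_comm s t (U \ W) W] at h2
        have h4 : dc s t U ((S \ X) \ U) = dc s t W ((S \ X) \ U) + dc s t (U \ W) ((S \ X) \ U) := by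
          conv_lhs => rw [← Finset.union_sdiff_of_subset hW]
          rw [dc_comm, Finset.union_sdiff_of_subset hW, dc_comm s t W, dc_comm s t (U \ W), ← dc_union, Finset.union_sdiff_of_subset hW]
          · rw [Finset.disjoint_left]; intro x hx; simp [hx]
          · rw [Finset.disjoint_left]; intro x hx; simp at hx; simp [hx]
          · rw [Finset.disjoint_left]; intro x hx hxW; simp at hx; exact hx.2 (hW hxW)
        omega
      obtain ⟨e1, he1, e2, he2, hne⟩ := Finset.one_lt_card.1 (show 1 < dc s t U X from hUX2)
      have hI : ∀ e ∈ (Finset.univ.filter fun e => (s e ∈ U ∧ t e ∈ X) ∨ (s e ∈ X ∧ t e ∈ U)),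
          ∃ u x, u ∈ U ∧ x ∈ X ∧ Inc s t e u x := by
        intro e he
        simp only [Finset.mem_filter, Finset.mem_univ, true_and] at he
        rcases he with ⟨h1, h2⟩ | ⟨h1, h2⟩
        · exact ⟨_, _, h1, h2, Or.inl ⟨rfl, rfl⟩⟩
        · exact ⟨_, _, h2, h1, Or.inr ⟨rfl, rfl⟩⟩
      obtain ⟨u, x1, hu, hx1, hi1⟩ := hI e1 he1
      obtain ⟨v, x2, hv, hx2, hi2⟩ := hI e2 he2
      obtain ⟨Y, hYU, hYne, c', hc'⟩ := good_step s t X c hc U hUX hUcut e1 e2 hne u v x1 x2 hu hv hx1 hx2 hi1 hi2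
      have := hmax (X ∪ Y) ⟨Finset.union_subset hXS (hYU.trans hUS), hXne.mono Finset.subset_union_left, c', hc'⟩
      rw [Finset.card_union_of_disjoint (Finset.disjoint_of_subset_right hYU hUX)] at this
      have := hYne.card_pos
      omega

end Flow
end SCC

open SimpleGraph Set
namespace SCC
open scoped Classical
set_option linter.all false

section Flow
variable {V E : Type*} [Fintype V] [Fintype E]

lemma fb_cast (k : ℕ) (s t : E → V) (F : E → ℤ) (v : V) :
    fb (ZMod k) s t (fun e => (F e : ZMod k)) v = ((fb ℤ s t F v : ℤ) : ZMod k) := by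
  rw [fb_apply, fb_apply]; push_cast; rfl

lemma lift_flow (k : ℕ) (hk : 0 < k) (s t : E → V) (f : E → ZMod k) (hf : fb (ZMod k) s t f = 0) :
    ∃ F : E → ℤ, fb ℤ s t F = 0 ∧ (∀ e, |F e| < k) ∧ ∀ e, (F e : ZMod k) = f e := by
  haveI : NeZero k := ⟨hk.ne'⟩
  let P : (E → ℤ) → Prop := fun F => (∀ e, |F e| < k) ∧ ∀ e, (F e : ZMod k) = f e
  have hex : ∃ n : ℕ, ∃ F, P F ∧ (∑ v, (fb ℤ s t F v).natAbs) = n := by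
    refine ⟨_, fun e => ((f e).val : ℤ), ⟨?_, ?_⟩, rfl⟩
    · intro e
      have := ZMod.val_lt (f e)
      show |((f e).val : ℤ)| < k
      rw [abs_of_nonneg (by positivity)]
      exact_mod_cast this
    · intro e; simp
  obtain ⟨F, hF, hFn⟩ := Nat.find_spec hex
  have hmin : ∀ F', P F' → (∑ v, (fb ℤ s t F v).natAbs) ≤ (∑ v, (fb ℤ s t F' v).natAbs) := by
    intro F' hF'
    rw [hFn]
    exact Nat.find_min' hex ⟨F', hF', rfl⟩
  refine ⟨F, ?_, hF.1, hF.2⟩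
  have hdvd : ∀ v, (k : ℤ) ∣ fb ℤ s t F v := by
    intro v
    rw [← ZMod.intCast_zmod_eq_zero_iff_dvd, ← fb_cast]
    have : (fun e => (F e : ZMod k)) = f := funext hF.2
    rw [this, hf]; rfl
  by_contra hne
  have hsum : ∑ v, fb ℤ s t F v = 0 := by
    rw [fb_cut]; simp
  obtain ⟨v, hv⟩ : ∃ v, 0 < fb ℤ s t F v := by
    by_contra hno
    push Not at hno
    apply hne
    funext v
    have := (Finset.sum_eq_zero_iff_of_nonpos (fun v _ => hno v)).1 hsum v (Finset.mem_univ v)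
    exact this
  let Q : Finset V → Prop := fun W => v ∈ W ∧ ∀ w ∈ W, ∃ F', P F' ∧ (∀ e, e ∉ ein s t W → F' e = F e) ∧
    fb ℤ s t F' = fb ℤ s t F - (k : ℤ) • (Pi.single v 1 - Pi.single w 1)
  have hQ0 : Q {v} := by
    refine ⟨by simp, fun w hw => ?_⟩
    rw [Finset.mem_singleton] at hw; subst hw
    exact ⟨F, hF, fun _ _ => rfl, by simp⟩
  obtain ⟨W, hW, hmax⟩ := Finset.exists_max_image (Finset.univ.filter Q) Finset.card ⟨{v}, by simpa using hQ0⟩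
  simp only [Finset.mem_filter, Finset.mem_univ, true_and] at hW hmax
  obtain ⟨hvW, hWF⟩ := hW
  have hnn : ∀ w ∈ W, 0 ≤ fb ℤ s t F w := by
    intro w hw
    by_contra hneg
    push Not at hneg
    obtain ⟨F', hF', -, hb⟩ := hWF w hw
    have hvw : v ≠ w := by rintro rfl; omega
    have hlt : (∑ x, (fb ℤ s t F' x).natAbs) < (∑ x, (fb ℤ s t F x).natAbs) := by
      have hvk := Int.le_of_dvd hv (hdvd v)
      have hwk := Int.le_of_dvd (by omega : 0 < - fb ℤ s t F w) ((dvd_neg).2 (hdvd w))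
      rw [hb]
      apply Finset.sum_lt_sum
      · intro x _
        by_cases h1 : x = v
        · subst h1
          simp [Pi.single_apply, hvw]
          omega
        by_cases h2 : x = w
        · subst h2
          simp [Pi.single_apply, h1]
          omega
        · simp [Pi.single_apply, h1, h2]
      · refine ⟨v, Finset.mem_univ _, ?_⟩
        simp [Pi.single_apply, hvw]
        omega
    have := hmin F' hF'
    omega
  have hsat : ∀ e w z r, w ∈ W → z ∉ W → Inc s t e w z → (r = 1 ∨ r = -1) →
      fb ℤ s t (Pi.single e r) = Pi.single w 1 - Pi.single z 1 → F e * r ≤ 0 := by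
    intro e w z r hw hz hinc hr hrb
    by_contra hpos
    push Not at hpos
    have hQ : Q (insert z W) := by
      refine ⟨by simp [hvW], ?_⟩
      have hsub : ein s t W ⊆ ein s t (insert z W) := ein_mono (Finset.subset_insert _ _)
      intro w' hw'
      rcases Finset.mem_insert.1 hw' with rfl | hw'
      · obtain ⟨F', hF', hoff, hb⟩ := hWF w hw
        have heW : e ∉ ein s t W := by
          rintro ⟨h1, h2⟩
          rcases hinc with ⟨rfl, rfl⟩ | ⟨rfl, rfl⟩
          · exact hz h2
          · exact hz h1
        have hein : e ∈ ein s t (insert w' W) := by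
          rcases hinc with ⟨rfl, rfl⟩ | ⟨rfl, rfl⟩
          · exact ⟨by simp [hw], by simp⟩
          · exact ⟨by simp, by simp [hw]⟩
        refine ⟨F' - (k : ℤ) • Pi.single e r, ⟨?_, ?_⟩, ?_, ?_⟩
        · intro e'
          by_cases h : e' = e
          · subst h
            have h1 := abs_lt.1 (hF.1 e')
            simp only [Pi.sub_apply, Pi.smul_apply, Pi.single_eq_same, smul_eq_mul, hoff e' heW]
            rw [abs_lt]
            rcases hr with rfl | rfl <;> constructor <;> linarith
          · simpa [Pi.single_apply, h] using hF'.1 e'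
        · intro e'
          simp [hF'.2 e']
        · intro e' he'
          have h1 : e' ≠ e := by rintro rfl; exact he' hein
          simp [Pi.single_apply, h1, hoff e' (fun h => he' (hsub h))]
        · rw [map_sub, map_smul, hrb, hb]
          simp only [smul_sub]; abel
      · obtain ⟨F', hF', hoff, hb⟩ := hWF w' hw'
        exact ⟨F', hF', fun e he => hoff e (fun h => he (hsub h)), hb⟩
    have := hmax (insert z W) hQ
    rw [Finset.card_insert_of_notMem hz] at this
    omega
  have hcut := fb_cut s t F W
  have hpos : 0 < ∑ x ∈ W, fb ℤ s t F x := Finset.sum_pos' hnn ⟨v, hvW, hv⟩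
  rw [hcut] at hpos
  apply absurd hpos
  push Not
  apply Finset.sum_nonpos
  intro e _
  by_cases hs : s e ∈ W <;> by_cases ht : t e ∈ W
  · simp [hs, ht]
  · have := hsat e (s e) (t e) 1 hs ht (Or.inl ⟨rfl, rfl⟩) (Or.inl rfl) (fb_single s t e)
    simpa [hs, ht] using this
  · have := hsat e (t e) (s e) (-1) ht hs (Or.inr ⟨rfl, rfl⟩) (Or.inr rfl)
            (by rw [Pi.single_neg, map_neg, fb_single]; simp)
    simpa [hs, ht] using this
  · simp [hs, ht]

/-- indicator of nonzero -/
def nz (x : ZMod 2) : ℕ := if x = 0 then 0 else 1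

theorem cover53 (s t : E → V) (hcut : ∀ W, (cut s t W).card ≠ 1) :
    ∃ x : Fin 3 → E → ZMod 2, (∀ i, fb (ZMod 2) s t (x i) = 0) ∧ (∀ e, ∃ i, x i e ≠ 0) ∧
      3 * ∑ i, ∑ e, nz (x i e) ≤ 5 * Fintype.card E := by
  obtain ⟨c, g, hc, hg, hcg⟩ := six _ s t Finset.univ rfl (fun e => by simp) hcut
  obtain ⟨χ, hχ, hχ1, hχc⟩ := lift_flow 2 (by norm_num) s t c hc
  have hχ3 : fb (ZMod 3) s t (fun e => (χ e : ZMod 3)) = 0 := by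
    funext v; rw [fb_cast, hχ]; simp
  let gt : ZMod 3 → E → ZMod 3 := fun r => g + r • fun e => (χ e : ZMod 3)
  have hgt : ∀ r, fb (ZMod 3) s t (gt r) = 0 := by
    intro r; rw [map_add, map_smul, hg, hχ3]; simp
  have hχv : ∀ e, (c e = 0 ∧ χ e = 0) ∨ (c e ≠ 0 ∧ (χ e = 1 ∨ χ e = -1)) := by
    intro e
    have h1 := abs_lt.1 (hχ1 e)
    have h2 := hχc e
    have h3 : χ e = 0 ∨ χ e = 1 ∨ χ e = -1 := by push_cast at h1; omega
    rcases h3 with h3 | h3 | h3 <;> rw [h3] at h2 <;> rw [← h2, h3] <;> simp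
  -- choose r
  let m : ZMod 3 → ℕ := fun r => ∑ e, if c e ≠ 0 ∧ gt r e = 0 then 1 else 0
  have hm : ∑ r, m r = ∑ e, nz (c e) := by
    simp only [m]
    rw [Finset.sum_comm]
    refine Finset.sum_congr rfl fun e _ => ?_
    rcases hχv e with ⟨h1, h2⟩ | ⟨h1, h2⟩
    · simp [h1, nz]
    · simp only [ne_eq, h1, not_false_eq_true, true_and, nz, if_false, gt, Pi.add_apply, Pi.smul_apply, smul_eq_mul]
      generalize g e = y
      rcases h2 with h2 | h2 <;> rw [h2] <;> revert y <;> decide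
  obtain ⟨r, hr⟩ : ∃ r, ∑ e, nz (c e) ≤ 3 * m r := by
    by_contra hno
    push Not at hno
    have h0 := hno 0; have h1 := hno 1; have h2 := hno 2
    have : ∑ r, m r = m 0 + m 1 + m 2 := Fin.sum_univ_three m
    omega
  obtain ⟨G, hG, hG3, hGc⟩ := lift_flow 3 (by norm_num) s t (gt r) (hgt r)
  let α : E → ZMod 2 := fun e => (G e : ZMod 2)
  have hα : fb (ZMod 2) s t α = 0 := by
    funext v; rw [fb_cast, hG]; simp
  obtain ⟨χ', hχ', hχ'1, hχ'c⟩ := lift_flow 2 (by norm_num) s t α hα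
  have hdiv : ∀ e, (2 : ℤ) ∣ G e - χ' e := by
    intro e
    have := hχ'c e
    simp only [α] at this
    rw [ZMod.intCast_eq_intCast_iff_dvd_sub] at this
    exact_mod_cast this
  choose B hB using hdiv
  have hBfb : fb ℤ s t B = 0 := by
    have : (2 : ℤ) • fb ℤ s t B = 0 := by
      rw [← map_smul]
      have : (2 : ℤ) • B = G - χ' := by funext e; simp [hB e]
      rw [this, map_sub, hG, hχ']; simp
    funext v
    have := congrFun this v
    simpa using this
  let β : E → ZMod 2 := fun e => (B e : ZMod 2)
  have hβ : fb (ZMod 2) s t β = 0 := by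
    funext v; rw [fb_cast, hBfb]; simp
  have hval : ∀ e, (gt r e = 0 → α e = 0 ∧ β e = 0) ∧ (gt r e ≠ 0 → α e ≠ 0 ∨ β e ≠ 0) := by
    intro e
    have h1 := abs_lt.1 (hG3 e)
    have h2 := abs_lt.1 (hχ'1 e)
    have h3 := hGc e
    have h4 := hB e
    push_cast at h1 h2
    have h5 : G e = 0 ∨ G e = 1 ∨ G e = -1 ∨ G e = 2 ∨ G e = -2 := by omega
    simp only [α, β]
    rw [← h3]
    rcases h5 with h5 | h5 | h5 | h5 | h5
    · have : B e = 0 := by omega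
      rw [h5, this]; simp
    · rw [h5]; constructor
      · intro h; exact absurd h (by decide)
      · intro _; left; decide
    · rw [h5]; constructor
      · intro h; exact absurd h (by decide)
      · intro _; left; decide
    · have : B e = 1 := by omega
      rw [h5, this]; decide
    · have : B e = -1 := by omega
      rw [h5, this]; decide
  have hc0 : ∀ e, c e = 0 → gt r e ≠ 0 := by
    intro e he
    rcases hχv e with ⟨h1, h2⟩ | ⟨h1, h2⟩
    · simp only [gt, Pi.add_apply, Pi.smul_apply, h2]
      simpa using hcg e he
    · exact absurd he h1
  have hnz : ∀ e, c e ≠ 0 ∨ α e ≠ 0 ∨ β e ≠ 0 := by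
    intro e
    by_cases he : c e = 0
    · exact Or.inr ((hval e).2 (hc0 e he))
    · exact Or.inl he
  let X : Fin 6 → Fin 3 → E → ZMod 2 := fun j => match j with
    | 0 => ![c, α, β]
    | 1 => ![c, β, α + β]
    | 2 => ![c, α, α + β]
    | 3 => ![c + α, α, β]
    | 4 => ![c + β, β, α + β]
    | 5 => ![c + (α + β), α + β, α]
  have hXfl : ∀ j i, fb (ZMod 2) s t (X j i) = 0 := by
    intro j i
    fin_cases j <;> fin_cases i <;> simp [X, hc, hα, hβ, map_add]
  have hXcov : ∀ j e, ∃ i, X j i e ≠ 0 := by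
    intro j e
    have := hnz e
    have h3 : ∀ (p q r : ZMod 2), (p ≠ 0 ∨ q ≠ 0 ∨ r ≠ 0) →
      (p ≠ 0 ∨ q ≠ 0 ∨ r ≠ 0) ∧ (p ≠ 0 ∨ r ≠ 0 ∨ q + r ≠ 0) ∧ (p ≠ 0 ∨ q ≠ 0 ∨ q + r ≠ 0) ∧
      (p + q ≠ 0 ∨ q ≠ 0 ∨ r ≠ 0) ∧ (p + r ≠ 0 ∨ r ≠ 0 ∨ q + r ≠ 0) ∧ (p + (q + r) ≠ 0 ∨ q + r ≠ 0 ∨ q ≠ 0) := by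
      decide
    obtain ⟨a0, a1, a2, a3, a4, a5⟩ := h3 _ _ _ this
    have wrap : ∀ (Y : Fin 3 → E → ZMod 2), (Y 0 e ≠ 0 ∨ Y 1 e ≠ 0 ∨ Y 2 e ≠ 0) → ∃ i, Y i e ≠ 0 := by
      rintro Y (h | h | h)
      exacts [⟨_, h⟩, ⟨_, h⟩, ⟨_, h⟩]
    fin_cases j
    · exact wrap _ a0
    · exact wrap _ a1
    · exact wrap _ a2
    · exact wrap _ a3
    · exact wrap _ a4
    · exact wrap _ a5
  have hT : ∑ j, ∑ i, ∑ e, nz (X j i e) ≤ 10 * Fintype.card E := by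
    have hpt : ∀ e, (∑ j, ∑ i, nz (X j i e)) + 6 * (if c e ≠ 0 ∧ gt r e = 0 then 1 else 0) ≤ 10 + 2 * nz (c e) := by
      intro e
      have h1 := hval e
      have h2 := hc0 e
      have hX6 : (∑ j, ∑ i, nz (X j i e)) = (nz (c e) + nz (α e) + nz (β e)) +
        (nz (c e) + nz (β e) + nz (α e + β e)) + (nz (c e) + nz (α e) + nz (α e + β e)) +
        (nz (c e + α e) + nz (α e) + nz (β e)) + (nz (c e + β e) + nz (β e) + nz (α e + β e)) +
        (nz (c e + (α e + β e)) + nz (α e + β e) + nz (α e)) := by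
        simp only [Fin.sum_univ_three, Fin.sum_univ_six]
        rfl
      rw [hX6]
      clear hX6
      generalize c e = p at *
      generalize gt r e = q at *
      generalize α e = a at *
      generalize β e = b at *
      revert p q a b
      decide
    have hs := Finset.sum_le_sum (fun e (_ : e ∈ Finset.univ) => hpt e)
    rw [Finset.sum_add_distrib, ← Finset.mul_sum, Finset.sum_add_distrib, ← Finset.mul_sum] at hs
    have e1 : ∑ e, ∑ j, ∑ i, nz (X j i e) = ∑ j, ∑ i, ∑ e, nz (X j i e) := by
      rw [Finset.sum_comm]
      refine Finset.sum_congr rfl fun j _ => ?_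
      rw [Finset.sum_comm]
    rw [e1] at hs
    simp only [Finset.sum_const, Finset.card_univ, smul_eq_mul] at hs
    simp only [m] at hr
    omega
  obtain ⟨j, hj⟩ : ∃ j, 6 * ∑ i, ∑ e, nz (X j i e) ≤ 10 * Fintype.card E := by
    by_contra hno
    push Not at hno
    have := Finset.sum_lt_sum_of_nonempty (s := (Finset.univ : Finset (Fin 6))) (by simp) (fun j _ => hno j)
    have h6 : ∑ j, 6 * ∑ i, ∑ e, nz (X j i e) = 6 * ∑ j, ∑ i, ∑ e, nz (X j i e) := by
      rw [Finset.mul_sum]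
    rw [h6] at this
    simp only [Finset.sum_const, Finset.card_univ, Fintype.card_fin, smul_eq_mul] at this
    omega
  exact ⟨X j, hXfl j, hXcov j, by omega⟩

end Flow
end SCC

open SimpleGraph Set
namespace SCC
open scoped Classical
set_option linter.all false

section Basics
variable {V : Type*} [Fintype V]

/-- degree parity -/
noncomputable def bd (X : Finset (Sym2 V)) (v : V) : ZMod 2 := ∑ e ∈ X, if v ∈ e then 1 else 0
/-- sign parity -/
noncomputable def sg (σ : Sym2 V → Bool) (X : Finset (Sym2 V)) : ZMod 2 := ∑ e ∈ X, if σ e = true then 1 else 0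

def Ev (X : Finset (Sym2 V)) : Prop := ∀ v, bd X v = 0

lemma z2_self (a : ZMod 2) : a + a = 0 := by revert a; decide
lemma z2_cases (a : ZMod 2) : a = 0 ∨ a = 1 := by revert a; decide
lemma z2_ne (a : ZMod 2) (h : a ≠ 0) : a = 1 := (z2_cases a).resolve_left h

lemma sum_sd {α : Type*} [DecidableEq α] (X Y : Finset α) (f : α → ZMod 2) :
    ∑ e ∈ symmDiff X Y, f e = ∑ e ∈ X, f e + ∑ e ∈ Y, f e := by
  have h1 : symmDiff X Y = (X \ Y) ∪ (Y \ X) := rfl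
  have h2 : ∑ e ∈ X, f e = ∑ e ∈ X \ Y, f e + ∑ e ∈ X ∩ Y, f e := by
    rw [add_comm, Finset.sum_inter_add_sum_sdiff]
  have h3 : ∑ e ∈ Y, f e = ∑ e ∈ Y \ X, f e + ∑ e ∈ X ∩ Y, f e := by
    rw [Finset.inter_comm, add_comm, Finset.sum_inter_add_sum_sdiff]
  rw [h1, Finset.sum_union, h2, h3]
  · have := z2_self (∑ e ∈ X ∩ Y, f e)
    linear_combination -this
  · rw [Finset.disjoint_left]; intro a ha; simp only [Finset.mem_sdiff] at *; tauto

lemma bd_sd (X Y : Finset (Sym2 V)) (v : V) : bd (symmDiff X Y) v = bd X v + bd Y v := sum_sd _ _ _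
lemma sg_sd (σ : Sym2 V → Bool) (X Y : Finset (Sym2 V)) : sg σ (symmDiff X Y) = sg σ X + sg σ Y := sum_sd _ _ _
lemma bd_union {X Y : Finset (Sym2 V)} (h : Disjoint X Y) (v : V) : bd (X ∪ Y) v = bd X v + bd Y v :=
  Finset.sum_union h
lemma sg_union (σ : Sym2 V → Bool) {X Y : Finset (Sym2 V)} (h : Disjoint X Y) : sg σ (X ∪ Y) = sg σ X + sg σ Y :=
  Finset.sum_union h
lemma bd_sdiff {X Y : Finset (Sym2 V)} (h : Y ⊆ X) (v : V) : bd (X \ Y) v = bd X v + bd Y v := by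
  have := Finset.sum_sdiff (f := fun e : Sym2 V => if v ∈ e then (1 : ZMod 2) else 0) h
  unfold bd; rw [← this, add_assoc, z2_self, add_zero]
lemma sg_sdiff (σ : Sym2 V → Bool) {X Y : Finset (Sym2 V)} (h : Y ⊆ X) : sg σ (X \ Y) = sg σ X + sg σ Y := by
  have := Finset.sum_sdiff (f := fun e : Sym2 V => if σ e = true then (1 : ZMod 2) else 0) h
  unfold sg; rw [← this, add_assoc, z2_self, add_zero]
@[simp] lemma bd_empty (v : V) : bd (∅ : Finset (Sym2 V)) v = 0 := rfl
@[simp] lemma sg_empty (σ : Sym2 V → Bool) : sg σ (∅ : Finset (Sym2 V)) = 0 := rfl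

lemma Ev.sd {X Y : Finset (Sym2 V)} (hX : Ev X) (hY : Ev Y) : Ev (symmDiff X Y) := fun v => by
  rw [bd_sd, hX, hY, add_zero]
lemma Ev.sdiff {X Y : Finset (Sym2 V)} (hX : Ev X) (hY : Ev Y) (h : Y ⊆ X) : Ev (X \ Y) := fun v => by
  rw [bd_sdiff h, hX, hY, add_zero]
lemma Ev.union {X Y : Finset (Sym2 V)} (hX : Ev X) (hY : Ev Y) (h : Disjoint X Y) : Ev (X ∪ Y) := fun v => by
  rw [bd_union h, hX, hY, add_zero]

/-- point indicator -/
noncomputable def pt (u v : V) : ZMod 2 := if v = u then 1 else 0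

lemma bd_single (u v : V) (h : u ≠ v) (x : V) : bd {s(u, v)} x = pt u x + pt v x := by
  unfold bd pt
  rw [Finset.sum_singleton]
  simp only [Sym2.mem_iff]
  by_cases h1 : x = u
  · subst h1; simp [h]
  · by_cases h2 : x = v
    · subst h2; simp [h.symm]
    · simp [h1, h2]

/-- the edge crosses `A` -/
def cr (A : Set V) (e : Sym2 V) : Prop := Crosses A e

lemma cr_mk (A : Set V) (x y : V) : Crosses A s(x, y) ↔ ¬ (x ∈ A ↔ y ∈ A) := by
  constructor
  · rintro ⟨a, b, h, ha, hb⟩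
    rw [Sym2.eq_iff] at h
    rcases h with ⟨rfl, rfl⟩ | ⟨rfl, rfl⟩ <;> tauto
  · intro h
    by_cases hx : x ∈ A
    · exact ⟨x, y, rfl, hx, fun hy => h ⟨fun _ => hy, fun _ => hx⟩⟩
    · refine ⟨y, x, Sym2.eq_swap, ?_, hx⟩
      by_contra hy; exact h ⟨fun h => absurd h hx, fun h => absurd h hy⟩

/-- handshake across a cut -/
lemma sum_bd (G : SimpleGraph V) (X : Finset (Sym2 V)) (hX : ∀ e ∈ X, e ∈ G.edgeSet) (A : Finset V) :
    ∑ v ∈ A, bd X v = ∑ e ∈ X, if Crosses (A : Set V) e then 1 else 0 := by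
  unfold bd
  rw [Finset.sum_comm]
  refine Finset.sum_congr rfl fun e he => ?_
  have hG := hX e he
  induction e using Sym2.ind with
  | _ x y =>
    have hxy : x ≠ y := G.ne_of_adj hG
    have : ∀ v, (if v ∈ s(x, y) then (1 : ZMod 2) else 0) = (if v = x then 1 else 0) + (if v = y then 1 else 0) := by
      intro v
      by_cases h1 : v = x
      · subst h1; simp [hxy]
      · by_cases h2 : v = y
        · subst h2; simp [hxy.symm]
        · simp [h1, h2]
    simp only [this, Finset.sum_add_distrib, Finset.sum_ite_eq', cr_mk, Finset.mem_coe]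
    by_cases h1 : x ∈ A <;> by_cases h2 : y ∈ A <;> simp [h1, h2]
    decide

variable (G : SimpleGraph V)

/-- edges of a walk as a finset -/
noncomputable def we {G : SimpleGraph V} {u v : V} (w : G.Walk u v) : Finset (Sym2 V) := w.edges.toFinset

lemma mem_we {G : SimpleGraph V} {u v : V} (w : G.Walk u v) (e : Sym2 V) : e ∈ we w ↔ e ∈ w.edges := by
  simp [we]

@[simp] lemma we_nil {G : SimpleGraph V} {u : V} : we (Walk.nil : G.Walk u u) = ∅ := by simp [we]
lemma we_append {G : SimpleGraph V} {u v x : V} (p : G.Walk u v) (q : G.Walk v x) :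
    we (p.append q) = we p ∪ we q := by
  ext e; simp [mem_we]
lemma we_reverse {G : SimpleGraph V} {u v : V} (p : G.Walk u v) : we p.reverse = we p := by
  ext e; simp [mem_we]
lemma we_cons {G : SimpleGraph V} {u v x : V} (h : G.Adj u v) (p : G.Walk v x) :
    we (Walk.cons h p) = insert s(u, v) (we p) := by
  ext e; simp [mem_we]
lemma we_sub {G : SimpleGraph V} {u v : V} (p : G.Walk u v) : ∀ e ∈ we p, e ∈ G.edgeSet := by
  intro e he; rw [mem_we] at he; exact p.edges_subset_edgeSet he

lemma bd_path {G : SimpleGraph V} {u v : V} (p : G.Walk u v) (hp : p.IsPath) (x : V) :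
    bd (we p) x = pt u x + pt v x := by
  induction p with
  | nil => simp [z2_self]
  | @cons a b c h p ih =>
    rw [Walk.cons_isPath_iff] at hp
    rw [we_cons]
    have hne : s(a, b) ∉ we p := by
      rw [mem_we]; intro he
      exact hp.2 (p.fst_mem_support_of_mem_edges he)
    rw [← Finset.singleton_union, bd_union (by simpa using hne), ih hp.1, bd_single a b h.ne]
    have := z2_self (pt b x)
    linear_combination this

lemma sum_pt (A : Finset V) (u : V) : ∑ v ∈ A, pt u v = if u ∈ A then 1 else 0 := by
  simp [pt]

/-- path extraction from an odd vertex -/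
lemma odd_path (X : Finset (Sym2 V)) (hX : ∀ e ∈ X, e ∈ G.edgeSet) (u : V) (hu : bd X u = 1) :
    ∃ v, v ≠ u ∧ bd X v = 1 ∧ ∃ p : G.Walk u v, p.IsPath ∧ we p ⊆ X := by
  let A : Finset V := Finset.univ.filter fun v => ∃ p : G.Walk u v, we p ⊆ X
  have hcr : ∀ e ∈ X, ¬ Crosses (A : Set V) e := by
    rintro e he ⟨x, y, rfl, hx, hy⟩
    simp only [A, Finset.coe_filter, Finset.mem_univ, true_and, Set.mem_setOf_eq] at hx hy
    obtain ⟨p, hp⟩ := hx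
    have hadj : G.Adj x y := hX _ he
    refine hy ⟨p.append (Walk.cons hadj Walk.nil), ?_⟩
    rw [we_append, we_cons]
    intro e' he'
    simp at he'
    rcases he' with h | h
    · rw [h]; exact he
    · exact hp h
  have hs : ∑ v ∈ A, bd X v = 0 := by
    rw [sum_bd G X hX]
    exact Finset.sum_eq_zero fun e he => by rw [if_neg (hcr e he)]
  have huA : u ∈ A := by
    simp only [A, Finset.mem_filter, Finset.mem_univ, true_and]
    exact ⟨Walk.nil, by simp⟩
  rw [← Finset.add_sum_erase _ _ huA, hu] at hs
  obtain ⟨v, hv, hv1⟩ : ∃ v ∈ A.erase u, bd X v ≠ 0 := by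
    by_contra hno
    push Not at hno
    rw [Finset.sum_eq_zero hno] at hs
    revert hs; decide
  rw [Finset.mem_erase] at hv
  have hvA := hv.2
  simp only [A, Finset.mem_filter, Finset.mem_univ, true_and] at hvA
  obtain ⟨p, hp⟩ := hvA
  refine ⟨v, hv.1, z2_ne _ hv1, p.bypass, p.bypass_isPath, ?_⟩
  intro e he
  rw [mem_we] at he
  exact hp ((mem_we _ _).2 (p.edges_bypass_subset_edges he))

/-- `C` is the edge set of a cycle of `G` -/
def IsCyc (C : Finset (Sym2 V)) : Prop := ∃ (v : V) (w : G.Walk v v), w.IsCycle ∧ C = we w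

/-- vertices met by an edge set -/
noncomputable def vs (C : Finset (Sym2 V)) : Finset V := Finset.univ.filter fun v => ∃ e ∈ C, v ∈ e

lemma mem_vs {C : Finset (Sym2 V)} {v : V} : v ∈ vs C ↔ ∃ e ∈ C, v ∈ e := by simp [vs]

lemma vs_mono {C D : Finset (Sym2 V)} (h : C ⊆ D) : vs C ⊆ vs D := by
  intro v hv; rw [mem_vs] at *; obtain ⟨e, he, hv⟩ := hv; exact ⟨e, h he, hv⟩

/-- a cycle through a given edge of an even set -/
lemma cyc_through (X : Finset (Sym2 V)) (hX : ∀ e ∈ X, e ∈ G.edgeSet) (hev : Ev X) (e : Sym2 V) (he : e ∈ X) :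
    ∃ C, IsCyc G C ∧ e ∈ C ∧ C ⊆ X := by
  induction e using Sym2.ind with
  | _ u v =>
    have hadj : G.Adj u v := hX _ he
    have hb : ∀ x, bd (X \ {s(u, v)}) x = pt u x + pt v x := by
      intro x
      rw [bd_sdiff (by simpa using he), hev x, zero_add, bd_single u v hadj.ne]
    obtain ⟨y, hy, hy1, p, hp, hpX⟩ := odd_path G (X \ {s(u, v)}) (fun e he => hX e (Finset.mem_sdiff.1 he).1) v
      (by rw [hb]; simp [pt, hadj.ne'])
    have hyu : y = u := by
      rw [hb] at hy1
      by_contra hne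
      simp [pt, hne, hy] at hy1
    subst hyu
    refine ⟨we (Walk.cons hadj p), ⟨_, _, ?_, rfl⟩, ?_, ?_⟩
    · rw [Walk.cons_isCycle_iff]
      refine ⟨hp, fun h => ?_⟩
      have := hpX ((mem_we _ _).2 h)
      simp at this
    · rw [we_cons]; simp
    · rw [we_cons]
      intro e' he'
      rcases Finset.mem_insert.1 he' with rfl | h
      · exact he
      · exact (Finset.mem_sdiff.1 (hpX h)).1

variable {G}

lemma IsCyc.sub {C : Finset (Sym2 V)} (h : IsCyc G C) : ∀ e ∈ C, e ∈ G.edgeSet := by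
  obtain ⟨v, w, hw, rfl⟩ := h; exact we_sub w

lemma IsCyc.nonempty {C : Finset (Sym2 V)} (h : IsCyc G C) : C.Nonempty := by
  obtain ⟨v, w, hw, rfl⟩ := h
  cases w with
  | nil => exact absurd rfl hw.ne_nil
  | cons h p => rw [we_cons]; simp

lemma IsCyc.ev {C : Finset (Sym2 V)} (h : IsCyc G C) : Ev C := by
  obtain ⟨v, w, hw, rfl⟩ := h
  cases w with
  | nil => exact absurd rfl hw.ne_nil
  | @cons _ b _ h p =>
    rw [Walk.cons_isCycle_iff] at hw
    intro x
    rw [we_cons, ← Finset.singleton_union, bd_union (by simpa [mem_we] using hw.2), bd_path p hw.1,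
      bd_single _ _ h.ne]
    have h1 := z2_self (pt b x)
    have h2 := z2_self (pt v x)
    linear_combination h1 + h2

lemma mem_vs_we {u v : V} (w : G.Walk u v) (hw : ¬ w.Nil) (x : V) : x ∈ vs (we w) ↔ x ∈ w.support := by
  rw [mem_vs, Walk.mem_support_iff_exists_mem_edges_of_not_nil hw]
  simp [mem_we]

lemma IsCyc.walk {C : Finset (Sym2 V)} (h : IsCyc G C) {x y : V} (hx : x ∈ vs C) (hy : y ∈ vs C) :
    ∃ p : G.Walk x y, p.IsPath ∧ we p ⊆ C := by
  obtain ⟨v, w, hw, rfl⟩ := h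
  rw [mem_vs_we w hw.not_nil] at hx hy
  let q := (w.takeUntil x hx).reverse.append (w.takeUntil y hy)
  refine ⟨q.bypass, q.bypass_isPath, ?_⟩
  intro e he
  rw [mem_we] at he ⊢
  have := q.edges_bypass_subset_edges he
  simp only [q, Walk.edges_append, Walk.edges_reverse, List.mem_append, List.mem_reverse] at this
  rcases this with h | h
  · exact w.edges_takeUntil_subset_edges hx h
  · exact w.edges_takeUntil_subset_edges hy h

lemma IsCyc.cycleSet {C : Finset (Sym2 V)} (h : IsCyc G C) : IsCycleSet G (C : Set (Sym2 V)) (vs C : Set V) := by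
  obtain ⟨v, w, hw, rfl⟩ := h
  refine ⟨v, w, hw, ?_, ?_⟩
  · ext e; simp [mem_we]
  · ext x; simp [mem_vs_we w hw.not_nil]

end Basics
end SCC

open SimpleGraph Set
namespace SCC
open scoped Classical
set_option linter.all false

section Decomp
variable {V : Type*} [Fintype V] (G : SimpleGraph V) (σ : Sym2 V → Bool)

/-- decomposition of an edge set into edge-disjoint cycles -/
def Dec (X : Finset (Sym2 V)) (L : List (Finset (Sym2 V))) : Prop :=
  (∀ C ∈ L, IsCyc G C) ∧ L.Pairwise Disjoint ∧ ∀ e, e ∈ X ↔ ∃ C ∈ L, e ∈ C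

variable {G}

lemma Dec.perm {X : Finset (Sym2 V)} {L L' : List (Finset (Sym2 V))} (h : Dec G X L) (hp : L.Perm L') :
    Dec G X L' := by
  refine ⟨fun C hC => h.1 C (hp.mem_iff.2 hC), ?_, fun e => ?_⟩
  · exact (hp.pairwise_iff (fun h => h.symm)).1 h.2.1
  · rw [h.2.2]; simp only [hp.mem_iff]

lemma Dec.nil : Dec G ∅ [] := ⟨by simp, by simp, by simp⟩

lemma Dec.single {C : Finset (Sym2 V)} (h : IsCyc G C) : Dec G C [C] :=
  ⟨by simpa using h, by simp, by simp⟩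

lemma Dec.append {X Y : Finset (Sym2 V)} {L L' : List (Finset (Sym2 V))} (h : Dec G X L) (h' : Dec G Y L')
    (hd : Disjoint X Y) : Dec G (X ∪ Y) (L ++ L') := by
  refine ⟨?_, ?_, ?_⟩
  · intro C hC
    rcases List.mem_append.1 hC with hC | hC
    · exact h.1 C hC
    · exact h'.1 C hC
  · rw [List.pairwise_append]
    refine ⟨h.2.1, h'.2.1, fun C hC D hD => ?_⟩
    rw [Finset.disjoint_left] at hd ⊢
    intro e he he'
    exact hd ((h.2.2 e).2 ⟨C, hC, he⟩) ((h'.2.2 e).2 ⟨D, hD, he'⟩)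
  · intro e
    rw [Finset.mem_union, h.2.2, h'.2.2]
    simp only [List.mem_append]
    constructor
    · rintro (⟨C, hC, he⟩ | ⟨C, hC, he⟩)
      · exact ⟨C, Or.inl hC, he⟩
      · exact ⟨C, Or.inr hC, he⟩
    · rintro ⟨C, hC | hC, he⟩
      · exact Or.inl ⟨C, hC, he⟩
      · exact Or.inr ⟨C, hC, he⟩

lemma Dec.of_cons {X C : Finset (Sym2 V)} {L : List (Finset (Sym2 V))} (h : Dec G X (C :: L)) :
    C ⊆ X ∧ Dec G (X \ C) L := by
  have hC : C ⊆ X := fun e he => (h.2.2 e).2 ⟨C, by simp, he⟩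
  refine ⟨hC, fun D hD => h.1 D (by simp [hD]), (List.pairwise_cons.1 h.2.1).2, fun e => ?_⟩
  rw [Finset.mem_sdiff, h.2.2]
  have hd := (List.pairwise_cons.1 h.2.1).1
  constructor
  · rintro ⟨⟨D, hD, he⟩, hne⟩
    rcases List.mem_cons.1 hD with rfl | hD
    · exact absurd he hne
    · exact ⟨D, hD, he⟩
  · rintro ⟨D, hD, he⟩
    exact ⟨⟨D, by simp [hD], he⟩, fun h => Finset.disjoint_left.1 (hd D hD) h he⟩

lemma Dec.card {X : Finset (Sym2 V)} {L : List (Finset (Sym2 V))} (h : Dec G X L) :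
    (L.map Finset.card).sum = X.card := by
  induction L generalizing X with
  | nil =>
    have : X = ∅ := by
      ext e; rw [h.2.2]; simp
    simp [this]
  | cons C L ih =>
    obtain ⟨h1, h2⟩ := h.of_cons
    rw [List.map_cons, List.sum_cons, ih h2, Finset.card_sdiff_of_subset h1]
    have := Finset.card_le_card h1
    omega

lemma Dec.sg {X : Finset (Sym2 V)} {L : List (Finset (Sym2 V))} (h : Dec G X L) :
    (L.map (sg σ)).sum = sg σ X := by
  induction L generalizing X with
  | nil =>
    have : X = ∅ := by
      ext e; rw [h.2.2]; simp
    simp [this]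
  | cons C L ih =>
    obtain ⟨h1, h2⟩ := h.of_cons
    rw [List.map_cons, List.sum_cons, ih h2, sg_sdiff _ h1]
    linear_combination z2_self (SCC.sg σ C)

lemma Dec.length {X : Finset (Sym2 V)} {L : List (Finset (Sym2 V))} (h : Dec G X L) :
    L.length ≤ X.card := by
  rw [← h.card]
  have : ∀ n ∈ L.map Finset.card, 1 ≤ n := by
    intro n hn
    obtain ⟨C, hC, rfl⟩ := List.mem_map.1 hn
    exact (h.1 C hC).nonempty.card_pos
  have := List.length_le_sum_of_one_le _ this
  simpa using this

lemma Dec.nodup {X : Finset (Sym2 V)} {L : List (Finset (Sym2 V))} (h : Dec G X L) : L.Nodup := by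
  refine List.Pairwise.imp_of_mem ?_ h.2.1
  intro a b ha hb hd hab
  subst hab
  obtain ⟨e, he⟩ := (h.1 a ha).nonempty
  exact Finset.disjoint_left.1 hd he he

lemma exists_dec (X : Finset (Sym2 V)) (hX : ∀ e ∈ X, e ∈ G.edgeSet) (hev : Ev X) : ∃ L, Dec G X L := by
  induction hn : X.card using Nat.strong_induction_on generalizing X with
  | _ n ih =>
    rcases X.eq_empty_or_nonempty with rfl | ⟨e, he⟩
    · exact ⟨[], Dec.nil⟩
    · obtain ⟨C, hC, heC, hCX⟩ := cyc_through G X hX hev e he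
      have hlt : (X \ C).card < n := by
        rw [← hn]
        exact Finset.card_lt_card ⟨Finset.sdiff_subset, fun h => (Finset.mem_sdiff.1 (h he)).2 heC⟩
      obtain ⟨L, hL⟩ := ih _ hlt (X \ C) (fun e he => hX e (Finset.mem_sdiff.1 he).1) (hev.sdiff hC.ev hCX) rfl
      refine ⟨[C] ++ L, ?_⟩
      have := (Dec.single hC).append hL Finset.disjoint_sdiff
      rwa [Finset.union_sdiff_of_subset hCX] at this

lemma pos_split {C1 C2 : Finset (Sym2 V)} (h1 : IsCyc G C1) (h2 : IsCyc G C2) (hd : Disjoint C1 C2)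
    (s1 : sg σ C1 = 1) (s2 : sg σ C2 = 1) {x y : V} (hxy : x ≠ y) (hx1 : x ∈ vs C1) (hx2 : x ∈ vs C2)
    (hy1 : y ∈ vs C1) (hy2 : y ∈ vs C2) :
    ∃ Z1 Z2 : Finset (Sym2 V), Disjoint Z1 Z2 ∧ Z1 ∪ Z2 = C1 ∪ C2 ∧ Ev Z1 ∧ Ev Z2 ∧ Z1.Nonempty ∧ Z2.Nonempty ∧
      sg σ Z1 = 0 ∧ sg σ Z2 = 0 := by
  obtain ⟨p1, hp1, hs1⟩ := h1.walk hx1 hy1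
  obtain ⟨p2, hp2, hs2⟩ := h2.walk hx2 hy2
  have key : ∀ J1 J2 : Finset (Sym2 V), J1 ⊆ C1 → J2 ⊆ C2 → (∀ v, bd J1 v = pt x v + pt y v) →
      (∀ v, bd J2 v = pt x v + pt y v) → sg σ J1 = sg σ J2 → 
      ∃ Z1 Z2 : Finset (Sym2 V), Disjoint Z1 Z2 ∧ Z1 ∪ Z2 = C1 ∪ C2 ∧ Ev Z1 ∧ Ev Z2 ∧ Z1.Nonempty ∧ Z2.Nonempty ∧
      sg σ Z1 = 0 ∧ sg σ Z2 = 0 := by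
    intro J1 J2 hJ1 hJ2 hb1 hb2 hs
    have d1 : Disjoint J1 J2 := Disjoint.mono hJ1 hJ2 hd
    have d2 : Disjoint (C1 \ J1) (C2 \ J2) := Disjoint.mono Finset.sdiff_subset Finset.sdiff_subset hd
    have hb1' : ∀ v, bd (C1 \ J1) v = pt x v + pt y v := fun v => by
      rw [bd_sdiff hJ1, h1.ev, zero_add, hb1]
    have hb2' : ∀ v, bd (C2 \ J2) v = pt x v + pt y v := fun v => by
      rw [bd_sdiff hJ2, h2.ev, zero_add, hb2]
    have ne : ∀ J : Finset (Sym2 V), (∀ v, bd J v = pt x v + pt y v) → J.Nonempty := by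
      intro J hJ
      rw [Finset.nonempty_iff_ne_empty]
      rintro rfl
      have := hJ x
      simp [pt, hxy] at this
    refine ⟨J1 ∪ J2, (C1 \ J1) ∪ (C2 \ J2), ?_, ?_, ?_, ?_, ?_, ?_, ?_, ?_⟩
    · rw [Finset.disjoint_left] at hd ⊢
      intro e he he'
      simp only [Finset.mem_union, Finset.mem_sdiff] at he he'
      rcases he with he | he <;> rcases he' with he' | he'
      · exact he'.2 he
      · exact hd (hJ1 he) he'.1
      · exact hd he'.1 (hJ2 he)
      · exact he'.2 he
    · ext e
      simp only [Finset.mem_union, Finset.mem_sdiff]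
      have a1 := @hJ1 e
      have a2 := @hJ2 e
      tauto
    · intro v; rw [bd_union d1, hb1, hb2, z2_self]
    · intro v; rw [bd_union d2, hb1', hb2', z2_self]
    · exact (ne J1 hb1).mono Finset.subset_union_left
    · exact (ne _ hb1').mono Finset.subset_union_left
    · rw [sg_union _ d1, hs, z2_self]
    · rw [sg_union _ d2, sg_sdiff _ hJ1, sg_sdiff _ hJ2, s1, s2, hs, z2_self]
  by_cases hs : sg σ (we p1) = sg σ (we p2)
  · exact key _ _ hs1 hs2 (bd_path p1 hp1) (bd_path p2 hp2) hs
  · refine key (C1 \ we p1) (we p2) Finset.sdiff_subset hs2 ?_ (bd_path p2 hp2) ?_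
    · intro v; rw [bd_sdiff hs1, h1.ev, zero_add, bd_path p1 hp1]
    · rw [sg_sdiff _ hs1, s1]
      rcases z2_cases (sg σ (we p1)) with h | h <;> rcases z2_cases (sg σ (we p2)) with h' | h' <;>
        rw [h, h'] at hs ⊢ <;> first | exact absurd rfl hs | decide

/-- two cycles share at most one vertex -/
def Sh (C1 C2 : Finset (Sym2 V)) : Prop := (vs C1 ∩ vs C2).card ≤ 1

lemma Sh.symm {C1 C2 : Finset (Sym2 V)} (h : Sh C1 C2) : Sh C2 C1 := by
  unfold Sh at *; rwa [Finset.inter_comm]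

/-- good decomposition -/
lemma exists_good (X : Finset (Sym2 V)) (hX : ∀ e ∈ X, e ∈ G.edgeSet) (hev : Ev X) :
    ∃ L, Dec G X L ∧ ∀ C1 ∈ L, ∀ C2 ∈ L, C1 ≠ C2 → sg σ C1 = 1 → sg σ C2 = 1 → Sh C1 C2 := by
  let f : List (Finset (Sym2 V)) → ℕ := fun L => L.length * (X.card + 1) + L.countP (fun C => sg σ C = 0)
  have hbound : ∀ n, (∃ L, Dec G X L ∧ f L = n) → n ≤ X.card * (X.card + 1) + X.card := by
    rintro n ⟨L, hL, rfl⟩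
    have h1 := hL.length
    have h2 := List.countP_le_length (p := fun C => decide (sg σ C = 0)) (l := L)
    have h3 := Nat.mul_le_mul_right (X.card + 1) h1
    simp only [f]
    omega
  obtain ⟨L0, hL0⟩ := exists_dec X hX hev
  have hex : ∃ n, ∃ L, Dec G X L ∧ f L = n := ⟨_, L0, hL0, rfl⟩
  obtain ⟨L, hL, hmax⟩ : ∃ L, Dec G X L ∧ ∀ L', Dec G X L' → f L' ≤ f L := by
    have hs := Nat.findGreatest_spec (P := fun n => ∃ L, Dec G X L ∧ f L = n)
      (hbound _ ⟨L0, hL0, rfl⟩) ⟨L0, hL0, rfl⟩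
    obtain ⟨L, hL, hf⟩ := hs
    refine ⟨L, hL, fun L' hL' => ?_⟩
    rw [hf]
    exact Nat.le_findGreatest (hbound _ ⟨L', hL', rfl⟩) ⟨L', hL', rfl⟩
  refine ⟨L, hL, fun C1 h1 C2 h2 hne s1 s2 => ?_⟩
  by_contra hsh
  unfold Sh at hsh
  push Not at hsh
  obtain ⟨x, hx, y, hy, hxy⟩ := Finset.one_lt_card.1 hsh
  rw [Finset.mem_inter] at hx hy
  have hp : L.Perm (C1 :: C2 :: (L.erase C1).erase C2) := by
    refine (List.perm_cons_erase h1).trans (List.Perm.cons _ ?_)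
    exact List.perm_cons_erase ((List.mem_erase_of_ne hne.symm).2 h2)
  generalize (L.erase C1).erase C2 = L' at hp
  have hD := hL.perm hp
  obtain ⟨hs1, hD1⟩ := hD.of_cons
  obtain ⟨hs2, hD2⟩ := hD1.of_cons
  have hd : Disjoint C1 C2 := (List.pairwise_cons.1 hD.2.1).1 C2 (by simp)
  obtain ⟨Z1, Z2, dZ, uZ, e1, e2, n1, n2, g1, g2⟩ :=
    pos_split σ (hL.1 _ h1) (hL.1 _ h2) hd s1 s2 hxy hx.1 hx.2 hy.1 hy.2
  have hZX : Z1 ∪ Z2 ⊆ X := by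
    rw [uZ]; exact Finset.union_subset hs1 (hs2.trans Finset.sdiff_subset)
  obtain ⟨L1, hL1⟩ := exists_dec (G := G) Z1 (fun e he => hX e (hZX (Finset.mem_union_left _ he))) e1
  obtain ⟨L2, hL2⟩ := exists_dec (G := G) Z2 (fun e he => hX e (hZX (Finset.mem_union_right _ he))) e2
  have hnew : Dec G X (L1 ++ L2 ++ L') := by
    have := (hL1.append hL2 dZ).append hD2 (by
      rw [uZ, Finset.disjoint_left]
      intro e he he'
      simp only [Finset.mem_union, Finset.mem_sdiff] at he he'
      tauto)
    convert this using 1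
    rw [uZ]
    ext e
    simp only [Finset.mem_union, Finset.mem_sdiff]
    have a1 := @hs1 e
    have a2 := @hs2 e
    rw [Finset.mem_sdiff] at a2
    tauto
  have hlenL : L.length = L'.length + 2 := by rw [hp.length_eq]; simp
  have hcntL : L.countP (fun C => sg σ C = 0) = L'.countP (fun C => sg σ C = 0) := by
    rw [hp.countP_eq]; simp [List.countP_cons, s1, s2]
  have l1 : 1 ≤ L1.length := by
    obtain ⟨e, he⟩ := n1
    obtain ⟨C, hC, -⟩ := (hL1.2.2 e).1 he
    exact List.length_pos_of_mem hC
  have l2 : 1 ≤ L2.length := by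
    obtain ⟨e, he⟩ := n2
    obtain ⟨C, hC, -⟩ := (hL2.2.2 e).1 he
    exact List.length_pos_of_mem hC
  have hm := hmax _ hnew
  have hc1 := List.countP_le_length (p := fun C => decide (sg σ C = 0)) (l := L)
  have hc2 := hL.length
  simp only [f, List.length_append, List.countP_append] at hm
  by_cases hl : L1.length + L2.length = 2
  · have q1 : L1.length = 1 := by omega
    have q2 : L2.length = 1 := by omega
    obtain ⟨D1, rfl⟩ := List.length_eq_one_iff.1 q1
    obtain ⟨D2, rfl⟩ := List.length_eq_one_iff.1 q2
    have r1 : sg σ D1 = 0 := by have := hL1.sg σ; simpa [g1] using this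
    have r2 : sg σ D2 = 0 := by have := hL2.sg σ; simpa [g2] using this
    rw [hcntL, hlenL] at hm
    simp [r1, r2] at hm
    nlinarith [hm]
  · have : L.length + 1 ≤ L1.length + L2.length + L'.length := by omega
    have := Nat.mul_le_mul_right (X.card + 1) this
    have e : (L.length + 1) * (X.card + 1) = L.length * (X.card + 1) + (X.card + 1) := by ring
    omega

end Decomp
end SCC

open SimpleGraph Set
namespace SCC
open scoped Classical
set_option linter.all false

section Barbells
variable {V : Type*} [Fintype V] (G : SimpleGraph V) (σ : Sym2 V → Bool)

def NC (C : Finset (Sym2 V)) : Prop := IsCyc G C ∧ sg σ C = 1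
def SC (B : Finset (Sym2 V)) : Prop := IsSignedCircuit G σ (B : Set (Sym2 V))
def Sep (C1 C2 : Finset (Sym2 V)) (e : Sym2 V) : Prop := ∀ a ∈ vs C1, ∀ b ∈ vs C2, ∀ w : G.Walk a b, e ∈ we w
def Lol (y : V) (c : ℕ) (C : Finset (Sym2 V)) : Prop :=
  NC G σ C ∧ ∃ b ∈ vs C, ∃ w : G.Walk y b, C.card + (we w \ C).card ≤ c
def Cov (y : V) (C : Finset (Sym2 V)) (e : Sym2 V) : Prop := ∀ b ∈ vs C, ∀ w : G.Walk y b, e ∈ we w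

variable {G σ}

lemma sg_card (C : Finset (Sym2 V)) : sg σ C = (({e ∈ (C : Set (Sym2 V)) | σ e = true}.ncard : ℕ) : ZMod 2) := by
  have : {e ∈ (C : Set (Sym2 V)) | σ e = true} = ((C.filter fun e => σ e = true : Finset (Sym2 V)) : Set (Sym2 V)) := by
    ext e; simp
  rw [this, Set.ncard_coe_finset]
  unfold sg
  rw [Finset.sum_boole]

lemma NC.negCycle {C : Finset (Sym2 V)} (h : NC G σ C) : IsNegCycle G σ (C : Set (Sym2 V)) (vs C : Set V) := by
  refine ⟨h.1.cycleSet, ?_⟩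
  have := h.2
  rw [sg_card] at this
  exact (ZMod.natCast_eq_one_iff_odd).1 this

lemma sc_pos {C : Finset (Sym2 V)} (h : IsCyc G C) (hs : sg σ C = 0) : SC G σ C := by
  refine Or.inl ⟨⟨_, h.cycleSet⟩, ?_⟩
  rw [sg_card] at hs
  exact (ZMod.natCast_eq_zero_iff_even).1 hs

lemma Sep.symm {C1 C2 : Finset (Sym2 V)} {e : Sym2 V} (h : Sep G C1 C2 e) : Sep G C2 C1 e := by
  intro a ha b hb w
  have := h b hb a ha w.reverse
  rwa [we_reverse] at this

lemma barbell {C1 C2 : Finset (Sym2 V)} (h1 : NC G σ C1) (h2 : NC G σ C2) (hsh : Sh C1 C2)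
    {a b : V} (ha : a ∈ vs C1) (hb : b ∈ vs C2) (w : G.Walk a b) :
    ∃ B, SC G σ B ∧ C1 ⊆ B ∧ C2 ⊆ B ∧ B.card ≤ C1.card + C2.card + (we w \ (C1 ∪ C2)).card ∧
      ∀ e, Sep G C1 C2 e → e ∈ B := by
  by_cases hne : (vs C1 ∩ vs C2).Nonempty
  · have hc : (vs C1 ∩ vs C2).card = 1 := le_antisymm hsh hne.card_pos
    obtain ⟨v, hv⟩ := Finset.card_eq_one.1 hc
    refine ⟨C1 ∪ C2, Or.inr ⟨C1, C2, Or.inl ⟨vs C1, vs C2, h1.negCycle, h2.negCycle, ⟨v, ?_⟩, ?_⟩⟩,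
      Finset.subset_union_left, Finset.subset_union_right, ?_, ?_⟩
    · rw [← Finset.coe_inter, hv]; simp
    · simp
    · exact (Finset.card_union_le _ _).trans (Nat.le_add_right _ _)
    · intro e he
      have hv' : v ∈ vs C1 ∩ vs C2 := by rw [hv]; simp
      rw [Finset.mem_inter] at hv'
      have := he v hv'.1 v hv'.2 Walk.nil
      simp at this
  · have hdis : Disjoint (vs C1) (vs C2) := by
      rw [Finset.disjoint_iff_inter_eq_empty]; exact Finset.not_nonempty_iff_eq_empty.1 hne
    have hex : ∃ n, ∃ u ∈ vs C1, ∃ v ∈ vs C2, ∃ p : G.Walk u v, we p ⊆ we w ∧ p.length = n :=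
      ⟨_, a, ha, b, hb, w, subset_rfl, rfl⟩
    obtain ⟨u, hu, v, hv, p0, hp0, hl0⟩ := Nat.find_spec hex
    have hmin : ∀ u ∈ vs C1, ∀ v ∈ vs C2, ∀ p : G.Walk u v, we p ⊆ we w → p0.length ≤ p.length := by
      intro u hu v hv p hp
      rw [hl0]
      exact Nat.find_min' hex ⟨u, hu, v, hv, p, hp, rfl⟩
    have hbs : we p0.bypass ⊆ we p0 := by
      intro e he; rw [mem_we] at *; exact p0.edges_bypass_subset_edges he
    obtain ⟨p, hpath, hpw, hpm⟩ : ∃ p : G.Walk u v, p.IsPath ∧ we p ⊆ we w ∧ 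
        ∀ u ∈ vs C1, ∀ v ∈ vs C2, ∀ q : G.Walk u v, we q ⊆ we w → p.length ≤ q.length :=
      ⟨p0.bypass, p0.bypass_isPath, hbs.trans hp0, fun u hu v hv q hq =>
        p0.length_bypass_le.trans (hmin u hu v hv q hq)⟩
    have hsu : ∀ x ∈ p.support, x ∈ vs C1 → x = u := by
      intro x hx hx1
      have h := hpm x hx1 v hv (p.dropUntil x hx) (by
        refine subset_trans ?_ hpw
        intro e he; rw [mem_we] at *; exact p.edges_dropUntil_subset_edges hx he)
      have hl := congrArg Walk.length (p.take_spec hx)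
      rw [Walk.length_append] at hl
      exact (Walk.eq_of_length_eq_zero (by omega : (p.takeUntil x hx).length = 0)).symm
    have hsv : ∀ x ∈ p.support, x ∈ vs C2 → x = v := by
      intro x hx hx2
      have h := hpm u hu x hx2 (p.takeUntil x hx) (by
        refine subset_trans ?_ hpw
        intro e he; rw [mem_we] at *; exact p.edges_takeUntil_subset_edges hx he)
      have hl := congrArg Walk.length (p.take_spec hx)
      rw [Walk.length_append] at hl
      exact (Walk.eq_of_length_eq_zero (by omega : (p.dropUntil x hx).length = 0))
    have hgen : ∀ (C : Finset (Sym2 V)) (z : V), (∀ x ∈ p.support, x ∈ vs C → x = z) → ∀ e ∈ we p, e ∉ C := by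
      intro C z hz e he heC
      induction e using Sym2.ind with
      | _ x y =>
        have hadj : G.Adj x y := we_sub p _ he
        rw [mem_we] at he
        have e1 := hz x (p.fst_mem_support_of_mem_edges he) (mem_vs.2 ⟨_, heC, by simp⟩)
        have e2 := hz y (p.snd_mem_support_of_mem_edges he) (mem_vs.2 ⟨_, heC, by simp⟩)
        exact hadj.ne (e1.trans e2.symm)
    refine ⟨C1 ∪ C2 ∪ we p, Or.inr ⟨C1, C2, Or.inr ⟨vs C1, vs C2, u, v, p, h1.negCycle, h2.negCycle, ?_, hpath,
      hu, hv, ?_, ?_, ?_⟩⟩, ?_, ?_, ?_, ?_⟩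
    · exact_mod_cast hdis
    · ext x; simp only [Set.mem_inter_iff, Set.mem_setOf_eq, Finset.mem_coe, Set.mem_singleton_iff]
      constructor
      · rintro ⟨h, h'⟩; exact hsu x h h'
      · rintro rfl; exact ⟨p.start_mem_support, hu⟩
    · ext x; simp only [Set.mem_inter_iff, Set.mem_setOf_eq, Finset.mem_coe, Set.mem_singleton_iff]
      constructor
      · rintro ⟨h, h'⟩; exact hsv x h h'
      · rintro rfl; exact ⟨p.end_mem_support, hv⟩
    · ext e; simp [mem_we, or_assoc]
    · exact Finset.subset_union_left.trans Finset.subset_union_left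
    · exact Finset.subset_union_right.trans Finset.subset_union_left
    · refine (Finset.card_union_le _ _).trans (Nat.add_le_add (Finset.card_union_le _ _) (Finset.card_le_card ?_))
      intro e he
      rw [Finset.mem_sdiff, Finset.mem_union]
      exact ⟨hpw he, fun h => h.elim (hgen C1 u hsu e he) (hgen C2 v hsv e he)⟩
    · intro e he
      exact Finset.mem_union_right _ (he u hu v hv p)

lemma Lol.mono {y : V} {c c' : ℕ} {C : Finset (Sym2 V)} (h : Lol G σ y c C) (hc : c ≤ c') : Lol G σ y c' C := by
  obtain ⟨h1, b, hb, w, hw⟩ := h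
  exact ⟨h1, b, hb, w, hw.trans hc⟩

/-- move the root of a lollipop along a walk -/
lemma Lol.ext {x y : V} {c : ℕ} {C : Finset (Sym2 V)} (h : Lol G σ x c C) (q : G.Walk y x) :
    Lol G σ y (c + (we q).card) C := by
  obtain ⟨h1, b, hb, w, hw⟩ := h
  refine ⟨h1, b, hb, q.append w, ?_⟩
  rw [we_append, Finset.union_sdiff_distrib]
  have := Finset.card_union_le (we q \ C) (we w \ C)
  have := Finset.card_le_card (Finset.sdiff_subset : we q \ C ⊆ we q)
  omega

lemma Lol.self {y : V} {C : Finset (Sym2 V)} (h : NC G σ C) (hy : y ∈ vs C) : Lol G σ y C.card C :=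
  ⟨h, y, hy, Walk.nil, by simp⟩

lemma Lol.comb {y : V} {c1 c2 : ℕ} {C1 C2 : Finset (Sym2 V)} (h1 : Lol G σ y c1 C1) (h2 : Lol G σ y c2 C2)
    (hsh : Sh C1 C2) : ∃ B, SC G σ B ∧ C1 ⊆ B ∧ C2 ⊆ B ∧ B.card ≤ c1 + c2 ∧ ∀ e, Sep G C1 C2 e → e ∈ B := by
  obtain ⟨n1, b1, hb1, w1, hw1⟩ := h1
  obtain ⟨n2, b2, hb2, w2, hw2⟩ := h2
  obtain ⟨B, hB, s1, s2, hc, hs⟩ := barbell n1 n2 hsh hb1 hb2 (w1.reverse.append w2)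
  refine ⟨B, hB, s1, s2, hc.trans ?_, hs⟩
  have : (we (w1.reverse.append w2) \ (C1 ∪ C2)).card ≤ (we w1 \ C1).card + (we w2 \ C2).card := by
    refine le_trans (Finset.card_le_card ?_) (Finset.card_union_le _ _)
    rw [we_append, we_reverse]
    intro e
    simp only [Finset.mem_sdiff, Finset.mem_union]
    tauto
  omega

end Barbells

section Link
variable {V : Type*} [Fintype V] (G : SimpleGraph V) (σ : Sym2 V → Bool)

/-- a source: a lollipop with attached edge set -/
structure Src (V : Type*) where
  x : V
  c : ℕ
  C : Finset (Sym2 V)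
  K : Finset (Sym2 V)

def Src.Ok (s : Src V) : Prop := Lol G σ s.x s.c s.C

def Src.Rel (s t : Src V) : Prop := Sh s.C t.C ∧ (∀ e ∈ s.K, e ∈ s.C ∨ Sep G s.C t.C e) ∧
  (∀ e ∈ t.K, e ∈ t.C ∨ Sep G s.C t.C e)

def tl (F : List (Finset (Sym2 V))) : ℕ := (F.map Finset.card).sum
@[simp] lemma tl_nil : tl ([] : List (Finset (Sym2 V))) = 0 := rfl
@[simp] lemma tl_cons (B : Finset (Sym2 V)) (F : List (Finset (Sym2 V))) : tl (B :: F) = B.card + tl F := by simp [tl]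
@[simp] lemma tl_append (F F' : List (Finset (Sym2 V))) : tl (F ++ F') = tl F + tl F' := by simp [tl]

def Src.cost (L : List (Src V)) : ℕ := (L.map Src.c).sum

variable {G σ}

lemma Src.Rel.symm {s t : Src V} (h : Src.Rel G s t) : Src.Rel G t s :=
  ⟨h.1.symm, fun e he => (h.2.2 e he).imp id Sep.symm, fun e he => (h.2.1 e he).imp id Sep.symm⟩

lemma link_aux (n : ℕ) : ∀ (L : List (Src V)) (J : Finset (Sym2 V)), L.length = n → (∀ e ∈ J, e ∈ G.edgeSet) →
    (∀ s ∈ L, s.Ok G σ) → L.Pairwise (Src.Rel G) →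
    ((∀ v, bd J v = (L.map fun s => pt s.x v).sum) → Even n →
      ∃ F, (∀ B ∈ F, SC G σ B) ∧ tl F ≤ Src.cost L + J.card ∧ ∀ s ∈ L, ∀ e ∈ s.K ∪ s.C, ∃ B ∈ F, e ∈ B) ∧
    (∀ y, (∀ v, bd J v = pt y v + (L.map fun s => pt s.x v).sum) → Odd n →
      ∃ F c, ∃ s ∈ L, (∀ B ∈ F, SC G σ B) ∧ Lol G σ y c s.C ∧ tl F + c ≤ Src.cost L + J.card ∧
        ∀ t ∈ L, t ≠ s → ∀ e ∈ t.K ∪ t.C, ∃ B ∈ F, e ∈ B) := by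
  induction n with
  | zero =>
    intro L J hL hJ hok hpw
    refine ⟨fun hb _ => ⟨[], by simp, by simp, ?_⟩, fun y hb h => by simp at h⟩
    rw [List.length_eq_zero_iff] at hL
    subst hL; simp
  | succ n ih =>
    intro L J hL hJ hok hpw
    constructor
    · intro hb hev
      cases L with
      | nil => simp at hL
      | cons s L =>
        have hL' : L.length = n := by simpa using hL
        have hodd : Odd n := by
          rcases Nat.even_or_odd n with h | h
          · exact absurd hev (by rw [Nat.not_even_iff_odd]; exact h.add_one)
          · exact h
        rw [List.pairwise_cons] at hpw
        obtain ⟨F, c, t, htL, hF, hlol, hc, hcov⟩ := (ih L J hL' hJ (fun t ht => hok t (by simp [ht])) hpw.2).2 s.x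
          (fun v => by rw [hb]; simp) hodd
        have hrel := hpw.1 t htL
        obtain ⟨B, hB, s1, s2, hcB, hsep⟩ := (hok s (by simp)).comb hlol hrel.1
        refine ⟨B :: F, ?_, ?_, ?_⟩
        · intro D hD
          rcases List.mem_cons.1 hD with rfl | hD
          · exact hB
          · exact hF D hD
        · simp only [tl_cons, Src.cost, List.map_cons, List.sum_cons] at hc ⊢
          omega
        · intro r hr e he
          by_cases hrs : r = s
          · subst hrs
            refine ⟨B, by simp, ?_⟩
            rcases Finset.mem_union.1 he with he | he
            · rcases hrel.2.1 e he with h | h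
              · exact s1 h
              · exact hsep e h
            · exact s1 he
          · by_cases hrt : r = t
            · subst hrt
              refine ⟨B, by simp, ?_⟩
              rcases Finset.mem_union.1 he with he | he
              · rcases hrel.2.2 e he with h | h
                · exact s2 h
                · exact hsep e h
              · exact s2 he
            · obtain ⟨D, hD, heD⟩ := hcov r ((List.mem_cons.1 hr).resolve_left hrs) hrt e he
              exact ⟨D, by simp [hD], heD⟩
    · intro y hb hodd
      have hev : Even n := by
        rcases Nat.even_or_odd n with h | h
        · exact h
        · exact absurd hodd (by rw [Nat.not_odd_iff_even]; exact h.add_one)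
      have key : ∀ s ∈ L, ∀ J' : Finset (Sym2 V), J' ⊆ J → ∀ q : G.Walk y s.x, (we q).card + J'.card ≤ J.card →
          (∀ v, bd J' v = bd J v + pt y v + pt s.x v) →
          ∃ F c, ∃ s ∈ L, (∀ B ∈ F, SC G σ B) ∧ Lol G σ y c s.C ∧ tl F + c ≤ Src.cost L + J.card ∧
            ∀ t ∈ L, t ≠ s → ∀ e ∈ t.K ∪ t.C, ∃ B ∈ F, e ∈ B := by
        intro s hs J' hJ' q hq hbJ'
        have hp := List.perm_cons_erase hs
        generalize hL' : L.erase s = L' at hp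
        have hpw' := (hp.pairwise_iff (fun h => Src.Rel.symm h)).1 hpw
        rw [List.pairwise_cons] at hpw'
        have hlen : L'.length = n := by have := hp.length_eq; simp at this; omega
        obtain ⟨F, hF, hc, hcov⟩ := (ih L' J' hlen (fun e he => hJ e (hJ' he))
          (fun t ht => hok t (hp.mem_iff.2 (by simp [ht]))) hpw'.2).1 (fun v => by
            rw [hbJ', hb, (hp.map (fun s => pt s.x v)).sum_eq]
            simp only [List.map_cons, List.sum_cons]
            linear_combination z2_self (pt y v) + z2_self (pt s.x v)) hev
        refine ⟨F, s.c + (we q).card, s, hs, hF, (hok s hs).ext q, ?_, ?_⟩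
        · have : Src.cost L = s.c + Src.cost L' := by
            unfold Src.cost; rw [(hp.map Src.c).sum_eq]; simp
          omega
        · intro t ht hts e he
          exact hcov t ((List.mem_cons.1 (hp.mem_iff.1 ht)).resolve_left hts) e he
      by_cases hy : ∃ s ∈ L, s.x = y
      · obtain ⟨s, hs, rfl⟩ := hy
        refine key s hs J subset_rfl Walk.nil (by simp) (fun v => by
          linear_combination - z2_self (pt s.x v))
      · push Not at hy
        have hz : ∀ v, (∀ s ∈ L, s.x ≠ v) → (L.map fun s => pt s.x v).sum = 0 := by
          intro v hv
          apply List.sum_eq_zero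
          intro a ha
          obtain ⟨s, hs, rfl⟩ := List.mem_map.1 ha
          simp [pt, (hv s hs).symm]
        obtain ⟨v, hv, hv1, p, hp, hpJ⟩ := odd_path G J hJ y (by rw [hb, hz y hy]; simp [pt])
        have : ∃ s ∈ L, s.x = v := by
          by_contra hno
          push Not at hno
          rw [hb, hz v hno] at hv1
          simp [pt, hv] at hv1
        obtain ⟨s, hs, rfl⟩ := this
        refine key s hs (J \ we p) Finset.sdiff_subset p ?_ (fun v => by rw [bd_sdiff hpJ, bd_path p hp]; ring)
        rw [Finset.card_sdiff_of_subset hpJ]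
        have := Finset.card_le_card hpJ
        omega

lemma link_even (L : List (Src V)) (J : Finset (Sym2 V)) (hJ : ∀ e ∈ J, e ∈ G.edgeSet)
    (hok : ∀ s ∈ L, s.Ok G σ) (hpw : L.Pairwise (Src.Rel G))
    (hb : ∀ v, bd J v = (L.map fun s => pt s.x v).sum) (hev : Even L.length) :
      ∃ F, (∀ B ∈ F, SC G σ B) ∧ tl F ≤ Src.cost L + J.card ∧ ∀ s ∈ L, ∀ e ∈ s.K ∪ s.C, ∃ B ∈ F, e ∈ B :=
  (link_aux _ L J rfl hJ hok hpw).1 hb hev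

lemma link_root (L : List (Src V)) (J : Finset (Sym2 V)) (hJ : ∀ e ∈ J, e ∈ G.edgeSet)
    (hok : ∀ s ∈ L, s.Ok G σ) (hpw : L.Pairwise (Src.Rel G)) (y : V)
    (hb : ∀ v, bd J v = pt y v + (L.map fun s => pt s.x v).sum) (hodd : Odd L.length)
    (hy : ∀ s ∈ L, ∀ e ∈ s.K, e ∈ s.C ∨ Cov G y s.C e) :
      ∃ F c, ∃ s ∈ L, (∀ B ∈ F, SC G σ B) ∧ Lol G σ y c s.C ∧ tl F + c ≤ Src.cost L + J.card ∧
        ∀ t ∈ L, ∀ e ∈ t.K ∪ t.C, (∃ B ∈ F, e ∈ B) ∨ e ∈ s.C ∨ Cov G y s.C e := by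
  obtain ⟨F, c, s, hs, h1, h2, h3, h4⟩ := (link_aux _ L J rfl hJ hok hpw).2 y hb hodd
  refine ⟨F, c, s, hs, h1, h2, h3, fun t ht e he => ?_⟩
  by_cases hts : t = s
  · subst hts
    right
    rcases Finset.mem_union.1 he with he | he
    · exact hy t ht e he
    · exact Or.inl he
  · exact Or.inl (h4 t ht hts e he)

end Link
end SCC

open SimpleGraph Set
namespace SCC
open scoped Classical
set_option linter.all false

section Region
variable {V : Type*} [Fintype V] (G : SimpleGraph V) (σ : Sym2 V → Bool)

noncomputable def EU (U : Finset V) : Finset (Sym2 V) := Finset.univ.filter fun e => e ∈ G.edgeSet ∧ ∀ x ∈ e, x ∈ U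
noncomputable def PU (U : Finset V) : Finset (Sym2 V) := (EU G U).filter fun e => σ e = false
noncomputable def NU (U : Finset V) : Finset (Sym2 V) := (EU G U).filter fun e => σ e = true
noncomputable def wt (e : Sym2 V) : ℕ := if ∃ Z : Finset (Sym2 V), (∀ e ∈ Z, e ∈ G.edgeSet ∧ σ e = false) ∧ Ev Z ∧ e ∈ Z then 1 else 2
noncomputable def mm (X : Finset (Sym2 V)) : ℕ := ∑ e ∈ X, wt G σ e

structure Reg (U : Finset V) : Prop where
  conn : ∀ u ∈ U, ∀ v ∈ U, ∃ X ⊆ PU G σ U, ∀ x, bd X x = pt u x + pt v x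
  hN : ∀ e ∈ PU G σ U, wt G σ e = 1 → ∃ Z ⊆ PU G σ U, Ev Z ∧ e ∈ Z
  bal : ∀ A : Finset V, ((NU G σ U).filter fun e => Crosses (A : Set V) e).card ≤
    ((PU G σ U).filter fun e => Crosses (A : Set V) e).card

def Bl (U : Finset V) : Prop := ∀ A : Finset V, ((EU G U).filter fun e => Crosses (A : Set V) e).card ≠ 1

def Jn (U : Finset V) (t : V → ZMod 2) : Prop := ∃ X ⊆ PU G σ U, ∀ v, bd X v = t v

variable {G σ} {U : Finset V}

lemma mem_EU {e : Sym2 V} : e ∈ EU G U ↔ e ∈ G.edgeSet ∧ ∀ x ∈ e, x ∈ U := by simp [EU]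
lemma mem_EU' {x y : V} : s(x, y) ∈ EU G U ↔ G.Adj x y ∧ x ∈ U ∧ y ∈ U := by simp [EU]
lemma mem_PU {e : Sym2 V} : e ∈ PU G σ U ↔ e ∈ EU G U ∧ σ e = false := by simp [PU]
lemma mem_NU {e : Sym2 V} : e ∈ NU G σ U ↔ e ∈ EU G U ∧ σ e = true := by simp [NU]
lemma PU_sub : PU G σ U ⊆ EU G U := Finset.filter_subset _ _
lemma NU_sub : NU G σ U ⊆ EU G U := Finset.filter_subset _ _
lemma EU_edge {e : Sym2 V} (h : e ∈ EU G U) : e ∈ G.edgeSet := (mem_EU.1 h).1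
lemma PU_edge {e : Sym2 V} (h : e ∈ PU G σ U) : e ∈ G.edgeSet := EU_edge (PU_sub h)

lemma wt_cases (e : Sym2 V) : wt G σ e = 1 ∨ wt G σ e = 2 := by
  unfold wt; split_ifs <;> simp
lemma wt_pos (e : Sym2 V) : 1 ≤ wt G σ e := by rcases wt_cases (G := G) (σ := σ) e with h | h <;> omega
lemma wt_le (e : Sym2 V) : wt G σ e ≤ 2 := by rcases wt_cases (G := G) (σ := σ) e with h | h <;> omega

lemma wt_neg {e : Sym2 V} (h : σ e = true) : wt G σ e = 2 := by
  unfold wt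
  rw [if_neg]
  rintro ⟨Z, hZ, -, he⟩
  have := (hZ e he).2
  rw [h] at this; simp at this

lemma mm_union {X Y : Finset (Sym2 V)} (h : Disjoint X Y) : mm G σ (X ∪ Y) = mm G σ X + mm G σ Y := Finset.sum_union h
lemma mm_mono {X Y : Finset (Sym2 V)} (h : X ⊆ Y) : mm G σ X ≤ mm G σ Y :=
  Finset.sum_le_sum_of_subset h
lemma card_le_mm (X : Finset (Sym2 V)) : X.card ≤ mm G σ X := by
  unfold mm
  calc X.card = ∑ e ∈ X, 1 := by simp
    _ ≤ _ := Finset.sum_le_sum fun e _ => wt_pos e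
lemma mm_sdiff {X Y : Finset (Sym2 V)} (h : Y ⊆ X) : mm G σ (X \ Y) + mm G σ Y = mm G σ X :=
  Finset.sum_sdiff h
lemma mm_neg {X : Finset (Sym2 V)} (h : ∀ e ∈ X, σ e = true) : mm G σ X = 2 * X.card := by
  unfold mm
  rw [Finset.sum_congr rfl fun e he => wt_neg (G := G) (h e he)]
  simp [mul_comm]

lemma EU_eq (U : Finset V) : EU G U = PU G σ U ∪ NU G σ U := by
  ext e
  rw [Finset.mem_union, mem_PU, mem_NU]
  cases σ e <;> simp
lemma PN_disj (U : Finset V) : Disjoint (PU G σ U) (NU G σ U) := by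
  rw [Finset.disjoint_left]; intro e h1 h2
  have := (mem_PU.1 h1).2; rw [(mem_NU.1 h2).2] at this; simp at this
lemma mm_EU (U : Finset V) : mm G σ (EU G U) = mm G σ (PU G σ U) + 2 * (NU G σ U).card := by
  rw [EU_eq (σ := σ) U, mm_union (PN_disj U), mm_neg (X := NU G σ U) (fun e he => (mem_NU.1 he).2)]

lemma Jn.zero : Jn G σ U (fun _ => 0) := ⟨∅, by simp, by simp⟩
lemma Jn.add {t t' : V → ZMod 2} (h : Jn G σ U t) (h' : Jn G σ U t') : Jn G σ U (fun v => t v + t' v) := by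
  obtain ⟨X, hX, hb⟩ := h
  obtain ⟨Y, hY, hb'⟩ := h'
  refine ⟨symmDiff X Y, ?_, fun v => by rw [bd_sd, hb, hb']⟩
  intro e he
  rcases Finset.mem_symmDiff.1 he with h | h
  · exact hX h.1
  · exact hY h.1
lemma Jn.congr {t t' : V → ZMod 2} (h : Jn G σ U t) (hc : ∀ v, t v = t' v) : Jn G σ U t' := by
  obtain ⟨X, hX, hb⟩ := h
  exact ⟨X, hX, fun v => (hb v).trans (hc v)⟩

lemma jn_pts (hR : Reg G σ U) : ∀ (n : ℕ) (L : List V), L.length = 2 * n → (∀ x ∈ L, x ∈ U) →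
    Jn G σ U (fun v => (L.map fun x => pt x v).sum) := by
  intro n
  induction n with
  | zero =>
    intro L hL _
    have : L = [] := List.length_eq_zero_iff.1 (by omega)
    subst this
    simpa using Jn.zero
  | succ n ih =>
    intro L hL hU
    match L, hL, hU with
    | a :: b :: L, hL, hU =>
      have h1 : Jn G σ U (fun v => pt a v + pt b v) := hR.conn a (hU a (by simp)) b (hU b (by simp))
      have h2 := ih L (by simp at hL; omega) (fun x hx => hU x (by simp [hx]))
      exact (h1.add h2).congr (fun v => by simp; ring)

lemma jn_edges (hR : Reg G σ U) (Y : Finset (Sym2 V)) (hY : Y ⊆ EU G U) : Jn G σ U (bd Y) := by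
  induction Y using Finset.induction_on with
  | empty => exact Jn.zero.congr (fun v => by simp)
  | insert e Y he ih =>
    have h1 := ih ((Finset.subset_insert _ _).trans hY)
    have h2 := hY (Finset.mem_insert_self e Y)
    induction e using Sym2.ind with
    | _ x y =>
      obtain ⟨hadj, hx, hy⟩ := mem_EU'.1 h2
      have h3 : Jn G σ U (fun v => pt x v + pt y v) := hR.conn x hx y hy
      refine (h3.add h1).congr (fun v => ?_)
      rw [← Finset.singleton_union, bd_union (by simpa using he), bd_single x y hadj.ne]

/-- averaging lemma -/
lemma avg (hR : Reg G σ U) {t : V → ZMod 2} (ht : Jn G σ U t) (S : Finset (Sym2 V)) (hS : S ⊆ PU G σ U) :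
    ∃ X ⊆ PU G σ U, (∀ v, bd X v = t v) ∧ 2 * (X ∩ S).card ≤ mm G σ S := by
  obtain ⟨X0, hX0, hb0⟩ := ht
  let 𝒵 := (PU G σ U).powerset.filter fun Z => Ev Z
  have hne : 𝒵.Nonempty := ⟨∅, Finset.mem_filter.2 ⟨Finset.empty_mem_powerset _, fun v => bd_empty v⟩⟩
  have hhalf : ∀ e ∈ S, 2 * (𝒵.filter fun Z => e ∈ symmDiff X0 Z).card ≤ wt G σ e * 𝒵.card := by
    intro e he
    rcases wt_cases (G := G) (σ := σ) e with h | h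
    · obtain ⟨Z0, hZ0, hev, heZ⟩ := hR.hN e (hS he) h
      have hbij : (𝒵.filter fun Z => e ∈ symmDiff X0 Z).card = (𝒵.filter fun Z => ¬ e ∈ symmDiff X0 Z).card := by
        have hmem : ∀ Z ∈ 𝒵, symmDiff Z Z0 ∈ 𝒵 := by
          intro Z hZ
          simp only [𝒵, Finset.mem_filter, Finset.mem_powerset] at hZ ⊢
          refine ⟨?_, hZ.2.sd hev⟩
          intro f hf
          rcases Finset.mem_symmDiff.1 hf with h | h
          · exact hZ.1 h.1
          · exact hZ0 h.1
        refine Finset.card_nbij' (fun Z => symmDiff Z Z0) (fun Z => symmDiff Z Z0) ?_ ?_ ?_ ?_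
        · intro Z hZ
          simp only [Finset.coe_filter, Set.mem_setOf_eq] at hZ ⊢
          refine ⟨hmem Z hZ.1, ?_⟩
          have := hZ.2
          simp only [Finset.mem_symmDiff] at this ⊢
          tauto
        · intro Z hZ
          simp only [Finset.coe_filter, Set.mem_setOf_eq] at hZ ⊢
          refine ⟨hmem Z hZ.1, ?_⟩
          have := hZ.2
          simp only [Finset.mem_symmDiff] at this ⊢
          tauto
        · intro Z _; exact symmDiff_symmDiff_cancel_right Z0 Z
        · intro Z _; exact symmDiff_symmDiff_cancel_right Z0 Z
      have := Finset.card_filter_add_card_filter_not (s := 𝒵) (fun Z => e ∈ symmDiff X0 Z)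
      rw [h]; omega
    · rw [h]
      exact Nat.mul_le_mul_left _ (Finset.card_filter_le _ _)
  have hsum : ∑ Z ∈ 𝒵, 2 * (symmDiff X0 Z ∩ S).card ≤ ∑ Z ∈ 𝒵, mm G σ S := by
    rw [Finset.sum_const, smul_eq_mul]
    calc ∑ Z ∈ 𝒵, 2 * (symmDiff X0 Z ∩ S).card = ∑ Z ∈ 𝒵, ∑ e ∈ S, 2 * (if e ∈ symmDiff X0 Z then 1 else 0) := by
          refine Finset.sum_congr rfl fun Z _ => ?_
          rw [← Finset.mul_sum, Finset.sum_boole]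
          congr 1
          simp only [Nat.cast_id]
          congr 1
          ext e
          simp only [Finset.mem_inter, Finset.mem_filter]; tauto
      _ = ∑ e ∈ S, 2 * (𝒵.filter fun Z => e ∈ symmDiff X0 Z).card := by
          rw [Finset.sum_comm]
          refine Finset.sum_congr rfl fun e _ => ?_
          rw [← Finset.mul_sum, Finset.sum_boole]; simp
      _ ≤ ∑ e ∈ S, wt G σ e * 𝒵.card := Finset.sum_le_sum hhalf
      _ = 𝒵.card * mm G σ S := by rw [← Finset.sum_mul, mul_comm]; rfl
  obtain ⟨Z, hZ, hle⟩ := Finset.exists_le_of_sum_le hne hsum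
  simp only [𝒵, Finset.mem_filter, Finset.mem_powerset] at hZ
  refine ⟨symmDiff X0 Z, ?_, fun v => by rw [bd_sd, hb0, hZ.2, add_zero], hle⟩
  intro f hf
  rcases Finset.mem_symmDiff.1 hf with h | h
  · exact hX0 h.1
  · exact hZ.1 h.1

lemma avg_all (hR : Reg G σ U) {t : V → ZMod 2} (ht : Jn G σ U t) :
    ∃ X ⊆ PU G σ U, (∀ v, bd X v = t v) ∧ 2 * X.card ≤ mm G σ (PU G σ U) := by
  obtain ⟨X, h1, h2, h3⟩ := avg hR ht _ subset_rfl
  refine ⟨X, h1, h2, ?_⟩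
  rwa [Finset.inter_eq_left.2 h1] at h3

lemma avg_path (hR : Reg G σ U) {u v : V} (hu : u ∈ U) (hv : v ∈ U) (S : Finset (Sym2 V)) (hS : S ⊆ PU G σ U) :
    ∃ w : G.Walk u v, w.IsPath ∧ we w ⊆ PU G σ U ∧ 2 * (we w ∩ S).card ≤ mm G σ S := by
  by_cases huv : u = v
  · subst huv
    exact ⟨Walk.nil, by simp, by simp, by simp⟩
  obtain ⟨X, hX, hb, hc⟩ := avg hR (hR.conn u hu v hv) S hS
  obtain ⟨z, hz, hz1, p, hp, hpX⟩ := odd_path G X (fun e he => PU_edge (hX he)) u (by rw [hb]; simp [pt, huv])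
  have : z = v := by
    rw [hb] at hz1
    by_contra hne
    simp [pt, hz, hne] at hz1
  subst this
  refine ⟨p, hp, hpX.trans hX, le_trans ?_ hc⟩
  exact Nat.mul_le_mul_left _ (Finset.card_le_card (Finset.inter_subset_inter_right hpX))

/-- an even subgraph with prescribed negative edges -/
lemma exH (hR : Reg G σ U) (T : Finset (Sym2 V)) (hT : T ⊆ NU G σ U) :
    ∃ H ⊆ EU G U, Ev H ∧ (∀ e ∈ NU G σ U, e ∈ H ↔ e ∈ T) ∧ 2 * H.card ≤ 2 * T.card + mm G σ (PU G σ U) ∧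
      sg σ H = (T.card : ZMod 2) := by
  obtain ⟨X, hX, hb, hc⟩ := avg_all hR (jn_edges hR T (hT.trans NU_sub))
  have hd : Disjoint X T := Disjoint.mono hX hT (PN_disj U)
  refine ⟨X ∪ T, Finset.union_subset (hX.trans PU_sub) (hT.trans NU_sub), ?_, ?_, ?_, ?_⟩
  · intro v; rw [bd_union hd, hb, z2_self]
  · intro e he
    rw [Finset.mem_union]
    constructor
    · rintro (h | h)
      · exact absurd he (Finset.disjoint_left.1 (PN_disj U) (hX h))
      · exact h
    · exact Or.inr
  · rw [Finset.card_union_of_disjoint hd]; omega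
  · rw [sg_union _ hd]
    have h1 : sg σ X = 0 := Finset.sum_eq_zero fun e he => by simp [(mem_PU.1 (hX he)).2]
    have h2 : sg σ T = T.card := by
      unfold sg
      rw [Finset.sum_congr rfl fun e he => if_pos (mem_NU.1 (hT he)).2]
      simp
    rw [h1, h2, zero_add]

lemma even_cut {Z : Finset (Sym2 V)} (hZ : ∀ e ∈ Z, e ∈ G.edgeSet) (hev : Ev Z) (A : Finset V) :
    ((Z.filter fun e => Crosses (A : Set V) e).card : ZMod 2) = 0 := by
  have := sum_bd G Z hZ A
  rw [Finset.sum_eq_zero (fun v _ => hev v), Finset.sum_boole] at this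
  exact this.symm

/-- mates -/
lemma mate (hR : Reg G σ U) (hB : Bl G U) (b : Sym2 V) (hb : b ∈ PU G σ U) (hw : wt G σ b = 2) :
    ∃ f ∈ NU G σ U, ∀ Z ⊆ EU G U, Ev Z → (b ∈ Z ↔ f ∈ Z) := by
  induction b using Sym2.ind with
  | _ x y =>
  have hadj : G.Adj x y := PU_edge hb
  let P' := PU G σ U \ {s(x, y)}
  have hP' : ∀ e ∈ P', e ∈ G.edgeSet := fun e he => PU_edge (Finset.mem_sdiff.1 he).1
  let A : Finset V := Finset.univ.filter fun v => ∃ p : G.Walk x v, we p ⊆ P'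
  have hcr : ∀ e ∈ P', ¬ Crosses (A : Set V) e := by
    rintro e he ⟨u, v, rfl, hx, hy⟩
    simp only [A, Finset.coe_filter, Finset.mem_univ, true_and, Set.mem_setOf_eq] at hx hy
    obtain ⟨p, hp⟩ := hx
    have hadj : G.Adj u v := hP' _ he
    refine hy ⟨p.append (Walk.cons hadj Walk.nil), ?_⟩
    rw [we_append, we_cons]
    intro e' he'
    simp at he'
    rcases he' with h | h
    · rw [h]; exact he
    · exact hp h
  have hxA : x ∈ A := by
    simp only [A, Finset.mem_filter, Finset.mem_univ, true_and]
    exact ⟨Walk.nil, by simp⟩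
  have hyA : y ∉ A := by
    simp only [A, Finset.mem_filter, Finset.mem_univ, true_and]
    rintro ⟨p, hp⟩
    have hsub : we p.bypass ⊆ P' := by
      intro e he; apply hp; rw [mem_we] at *; exact p.edges_bypass_subset_edges he
    have hnm : s(x, y) ∉ we p.bypass := fun h => by have := hsub h; simp [P'] at this
    have : wt G σ s(x, y) = 1 := by
      unfold wt
      rw [if_pos]
      refine ⟨we p.bypass ∪ {s(x, y)}, ?_, ?_, by simp⟩
      · intro e he
        have : e ∈ PU G σ U := by
          rcases Finset.mem_union.1 he with h | h
          · exact (Finset.mem_sdiff.1 (hsub h)).1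
          · rw [Finset.mem_singleton.1 h]; exact hb
        exact ⟨PU_edge this, (mem_PU.1 this).2⟩
      · intro v
        rw [bd_union (by simpa using hnm), bd_path _ p.bypass_isPath, bd_single x y hadj.ne, z2_self]
    omega
  have hcb : Crosses (A : Set V) s(x, y) := ⟨x, y, rfl, by exact_mod_cast hxA, by exact_mod_cast hyA⟩
  have hPf : (PU G σ U).filter (fun e => Crosses (A : Set V) e) = {s(x, y)} := by
    ext e
    simp only [Finset.mem_filter, Finset.mem_singleton]
    constructor
    · rintro ⟨he, hc⟩
      by_contra hne
      exact hcr e (by simp [P', he, hne]) hc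
    · rintro rfl; exact ⟨hb, hcb⟩
  have hbal := hR.bal A
  rw [hPf, Finset.card_singleton] at hbal
  have hEf : (EU G U).filter (fun e => Crosses (A : Set V) e) =
      {s(x, y)} ∪ (NU G σ U).filter (fun e => Crosses (A : Set V) e) := by
    rw [EU_eq (σ := σ) U, Finset.filter_union, hPf]
  have hN1 : ((NU G σ U).filter (fun e => Crosses (A : Set V) e)).card = 1 := by
    by_contra hne
    have h0 : ((NU G σ U).filter (fun e => Crosses (A : Set V) e)) = ∅ := Finset.card_eq_zero.1 (by omega)
    apply hB A
    rw [hEf, h0]; simp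
  obtain ⟨f, hf⟩ := Finset.card_eq_one.1 hN1
  have hfm : f ∈ (NU G σ U).filter (fun e => Crosses (A : Set V) e) := by rw [hf]; simp
  rw [Finset.mem_filter] at hfm
  refine ⟨f, hfm.1, fun Z hZ hev => ?_⟩
  have hbf : s(x, y) ≠ f := by
    rintro rfl; exact Finset.disjoint_left.1 (PN_disj U) hb hfm.1
  have hcut := even_cut (G := G) (fun e he => EU_edge (hZ he)) hev A
  have hZf : Z.filter (fun e => Crosses (A : Set V) e) = Z ∩ {s(x, y), f} := by
    ext e
    rw [Finset.mem_filter, Finset.mem_inter]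
    have hiff : e ∈ Z → (Crosses (A : Set V) e ↔ e ∈ ({s(x, y), f} : Finset (Sym2 V))) := by
      intro he
      have := Finset.ext_iff.1 hEf e
      rw [hf, Finset.mem_filter] at this
      simp only [hZ he, true_and] at this
      rw [this]; simp
    constructor
    · rintro ⟨h1, h2⟩; exact ⟨h1, (hiff h1).1 h2⟩
    · rintro ⟨h1, h2⟩; exact ⟨h1, (hiff h1).2 h2⟩
  rw [hZf] at hcut
  by_cases h1 : s(x, y) ∈ Z <;> by_cases h2 : f ∈ Z <;> simp only [h1, h2, iff_true, iff_false, not_true_eq_false, not_false_eq_true]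
  · have : Z ∩ {s(x, y), f} = {s(x, y)} := by
      ext e; simp only [Finset.mem_inter, Finset.mem_insert, Finset.mem_singleton]
      constructor
      · rintro ⟨a, b | b⟩
        · exact b
        · rw [b] at a; exact absurd a h2
      · rintro rfl; exact ⟨h1, Or.inl rfl⟩
    rw [this] at hcut; simp at hcut
  · have : Z ∩ {s(x, y), f} = {f} := by
      ext e; simp only [Finset.mem_inter, Finset.mem_insert, Finset.mem_singleton]
      constructor
      · rintro ⟨a, b | b⟩
        · rw [b] at a; exact absurd a h1
        · exact b
      · rintro rfl; exact ⟨h2, Or.inr rfl⟩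
    rw [this] at hcut; simp at hcut

/-- the edges to be covered in the region -/
noncomputable def RU (G : SimpleGraph V) (σ : Sym2 V → Bool) (U : Finset V) : Finset (Sym2 V) := (EU G U).filter fun e => wt G σ e = 2

lemma RU_sub_H (hR : Reg G σ U) (hB : Bl G U) {H : Finset (Sym2 V)} (hH : H ⊆ EU G U) (hev : Ev H)
    (hN : NU G σ U ⊆ H) : RU G σ U ⊆ H := by
  intro e he
  obtain ⟨h1, h2⟩ := Finset.mem_filter.1 he
  by_cases hs : σ e = true
  · exact hN (mem_NU.2 ⟨h1, hs⟩)
  · obtain ⟨f, hf, hm⟩ := mate hR hB e (mem_PU.2 ⟨h1, by simpa using hs⟩) h2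
    exact (hm H hH hev).2 (hN hf)

end Region
end SCC

open SimpleGraph Set
namespace SCC
open scoped Classical
set_option linter.all false

section PieceTools
variable {V : Type*} [Fintype V] (G : SimpleGraph V) (σ : Sym2 V → Bool)

def Pack1 (S : Finset V) (y : V) (c : ℕ) (K : Finset (Sym2 V)) : Prop :=
  ∃ F a C, (∀ B ∈ F, SC G σ B) ∧ Lol G σ y a C ∧ vs C ⊆ S ∧ tl F + a ≤ c ∧
    ∀ e ∈ K, (∃ B ∈ F, e ∈ B) ∨ e ∈ C ∨ Cov G y C e

def Pack2 (S : Finset V) (y : V) (c : ℕ) (K : Finset (Sym2 V)) : Prop :=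
  ∃ F a C a' C', (∀ B ∈ F, SC G σ B) ∧ Lol G σ y a C ∧ vs C ⊆ S ∧ Lol G σ y a' C' ∧ vs C' ⊆ S ∧ tl F + a + a' ≤ c ∧
    ∀ e ∈ K, (∃ B ∈ F, e ∈ B) ∨ (e ∈ C ∨ Cov G y C e) ∨ (e ∈ C' ∨ Cov G y C' e)

structure Term (V : Type*) where
  x : V
  S : Finset V
  M : ℕ
  K : Finset (Sym2 V)
  c1 : ℕ
  c2 : ℕ

def Gate (S : Finset V) (x : V) : Prop := ∀ a b (w : G.Walk a b), a ∉ S → b ∈ S → x ∈ w.support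

structure Term.Ok (U : Finset V) (τ : Term V) : Prop where
  hx : τ.x ∈ U
  hd : Disjoint τ.S U
  gate : Gate G τ.S τ.x
  p1 : Pack1 G σ τ.S τ.x τ.c1 τ.K
  p2 : Pack2 G σ τ.S τ.x τ.c2 τ.K
  b1 : 2 * τ.c1 ≤ 3 * τ.M
  b2 : τ.c1 + τ.c2 ≤ 3 * τ.M

def TSrc (τ : Term V) (s : Src V) : Prop := s.x = τ.x ∧ s.Ok G σ ∧ vs s.C ⊆ τ.S ∧
  ∀ e ∈ s.K, e ∈ s.C ∨ ∀ a, a ∉ τ.S → Cov G a s.C e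

def Fam (U S : Finset V) (y : V) (L : List (Src V)) : Prop :=
  (∀ s ∈ L, s.Ok G σ ∧ s.x ∈ U ∧ vs s.C ⊆ S ∧ ∀ e ∈ s.K, e ∈ s.C ∨ Cov G y s.C e) ∧ L.Pairwise (Src.Rel G)

variable {G σ} {U S : Finset V}

lemma vs_EU {C : Finset (Sym2 V)} (h : C ⊆ EU G U) : vs C ⊆ U := by
  intro v hv
  obtain ⟨e, he, hve⟩ := mem_vs.1 hv
  exact (mem_EU.1 (h he)).2 v hve

lemma Gate.cov {S : Finset V} {x : V} (h : Gate G S x) {C : Finset (Sym2 V)} (hC : vs C ⊆ S) {e : Sym2 V}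
    (hc : Cov G x C e) (a : V) (ha : a ∉ S) : Cov G a C e := by
  intro b hb w
  have hx := h a b w ha (hC hb)
  have := hc b hb (w.dropUntil x hx)
  rw [mem_we] at *
  exact w.edges_dropUntil_subset_edges hx this

lemma expand1 {τ : Term V} (h : τ.Ok G σ U) : ∃ F s, (∀ B ∈ F, SC G σ B) ∧ TSrc G σ τ s ∧ tl F + s.c ≤ τ.c1 ∧
    ∀ e ∈ τ.K, (∃ B ∈ F, e ∈ B) ∨ e ∈ s.K ∪ s.C := by
  obtain ⟨F, a, C, hF, hl, hC, hc, hK⟩ := h.p1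
  refine ⟨F, ⟨τ.x, a, C, τ.K.filter fun e => e ∈ C ∨ Cov G τ.x C e⟩, hF, ⟨rfl, hl, hC, ?_⟩, hc, ?_⟩
  · intro e he
    exact (Finset.mem_filter.1 he).2.imp id fun h' a ha => h.gate.cov hC h' a ha
  · intro e he
    rcases hK e he with h | h
    · exact Or.inl h
    · exact Or.inr (Finset.mem_union_left _ (Finset.mem_filter.2 ⟨he, h⟩))

lemma expand2 {τ : Term V} (h : τ.Ok G σ U) : ∃ F s s', (∀ B ∈ F, SC G σ B) ∧ TSrc G σ τ s ∧ TSrc G σ τ s' ∧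
    tl F + s.c + s'.c ≤ τ.c2 ∧
    ∀ e ∈ τ.K, (∃ B ∈ F, e ∈ B) ∨ e ∈ s.K ∪ s.C ∨ e ∈ s'.K ∪ s'.C := by
  obtain ⟨F, a, C, a', C', hF, hl, hC, hl', hC', hc, hK⟩ := h.p2
  refine ⟨F, ⟨τ.x, a, C, τ.K.filter fun e => e ∈ C ∨ Cov G τ.x C e⟩,
    ⟨τ.x, a', C', τ.K.filter fun e => e ∈ C' ∨ Cov G τ.x C' e⟩, hF, ⟨rfl, hl, hC, ?_⟩, ⟨rfl, hl', hC', ?_⟩, hc, ?_⟩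
  · intro e he
    exact (Finset.mem_filter.1 he).2.imp id fun h' a ha => h.gate.cov hC h' a ha
  · intro e he
    exact (Finset.mem_filter.1 he).2.imp id fun h' a ha => h.gate.cov hC' h' a ha
  · intro e he
    rcases hK e he with h | h | h
    · exact Or.inl h
    · exact Or.inr (Or.inl (Finset.mem_union_left _ (Finset.mem_filter.2 ⟨he, h⟩)))
    · exact Or.inr (Or.inr (Finset.mem_union_left _ (Finset.mem_filter.2 ⟨he, h⟩)))

lemma expandL (T : List (Term V)) (h : ∀ τ ∈ T, τ.Ok G σ U) : ∃ F L, (∀ B ∈ F, SC G σ B) ∧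
    List.Forall₂ (TSrc G σ) T L ∧ tl F + Src.cost L ≤ (T.map Term.c1).sum ∧
    ∀ τ ∈ T, ∀ e ∈ τ.K, (∃ B ∈ F, e ∈ B) ∨ ∃ s ∈ L, e ∈ s.K ∪ s.C := by
  induction T with
  | nil => exact ⟨[], [], by simp, by simp, by simp [Src.cost], by simp⟩
  | cons τ T ih =>
    obtain ⟨F, L, h1, h2, h3, h4⟩ := ih fun t ht => h t (by simp [ht])
    obtain ⟨F', s, k1, k2, k3, k4⟩ := expand1 (h τ (by simp))
    refine ⟨F' ++ F, s :: L, ?_, List.Forall₂.cons k2 h2, ?_, ?_⟩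
    · intro B hB
      rcases List.mem_append.1 hB with hB | hB
      · exact k1 B hB
      · exact h1 B hB
    · simp only [tl_append, Src.cost, List.map_cons, List.sum_cons] at *
      omega
    · intro t ht e he
      rcases List.mem_cons.1 ht with rfl | ht
      · rcases k4 e he with ⟨B, hB, h⟩ | h
        · exact Or.inl ⟨B, by simp [hB], h⟩
        · exact Or.inr ⟨s, by simp, h⟩
      · rcases h4 t ht e he with ⟨B, hB, h⟩ | ⟨r, hr, h⟩
        · exact Or.inl ⟨B, by simp [hB], h⟩
        · exact Or.inr ⟨r, by simp [hr], h⟩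

noncomputable def dsrc (y : V) (D : Finset (Sym2 V)) : Src V :=
  ⟨if h : (vs D).Nonempty then h.choose else y, D.card, D, ∅⟩

lemma NC.vne {D : Finset (Sym2 V)} (h : NC G σ D) : (vs D).Nonempty := by
  obtain ⟨e, he⟩ := h.1.nonempty
  induction e using Sym2.ind with
  | _ x y => exact ⟨x, mem_vs.2 ⟨_, he, by simp⟩⟩

lemma dsrc_ok (y : V) {D : Finset (Sym2 V)} (h : NC G σ D) : (dsrc y D).Ok G σ ∧ (dsrc y D).x ∈ vs D := by
  have hx : (dsrc y D).x ∈ vs D := by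
    simp only [dsrc, dif_pos h.vne]; exact h.vne.choose_spec
  exact ⟨Lol.self h hx, hx⟩

lemma fam_nil (y : V) : Fam G σ U S y [] := ⟨by simp, by simp⟩

lemma sh_disj {C D : Finset (Sym2 V)} (h : Disjoint (vs C) (vs D)) : Sh C D := by
  unfold Sh; rw [Finset.disjoint_iff_inter_eq_empty.1 h]; simp

lemma Cov.sep {C D : Finset (Sym2 V)} {e : Sym2 V} (h : ∀ a ∈ vs C, Cov G a D e) : Sep G C D e :=
  fun a ha b hb w => h a ha b hb w

/-- build a family -/
lemma fam_D (hUS : U ⊆ S) (y : V) (𝒟 : List (Finset (Sym2 V))) (h1 : ∀ D ∈ 𝒟, NC G σ D ∧ D ⊆ EU G U)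
    (h2 : 𝒟.Pairwise Sh) : Fam G σ U S y (𝒟.map (dsrc y)) := by
  refine ⟨?_, ?_⟩
  · intro s hs
    obtain ⟨D, hD, rfl⟩ := List.mem_map.1 hs
    obtain ⟨hn, hE⟩ := h1 D hD
    refine ⟨(dsrc_ok y hn).1, vs_EU hE (dsrc_ok y hn).2, (vs_EU hE).trans hUS, by simp [dsrc]⟩
  · rw [List.pairwise_map]
    exact h2.imp fun h => ⟨h, by simp [dsrc], by simp [dsrc]⟩

lemma fam_cons {y : V} {L : List (Src V)} {s : Src V} {τ : Term V} (hL : Fam G σ U S y L) (hτ : τ.Ok G σ U)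
    (hs : TSrc G σ τ s) (hS : τ.S ⊆ S) (hy : y ∈ U) (hdis : ∀ t ∈ L, Disjoint (vs t.C) τ.S)
    (hsep : ∀ t ∈ L, ∀ e ∈ t.K, e ∈ t.C ∨ ∀ a ∈ τ.S, Cov G a t.C e) :
    Fam G σ U S y (s :: L) := by
  have hyS : y ∉ τ.S := fun h => Finset.disjoint_left.1 hτ.hd h hy
  refine ⟨?_, ?_⟩
  · intro t ht
    rcases List.mem_cons.1 ht with rfl | ht
    · exact ⟨hs.2.1, hs.1 ▸ hτ.hx, hs.2.2.1.trans hS, fun e he => (hs.2.2.2 e he).imp id fun h => h y hyS⟩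
    · exact hL.1 t ht
  · rw [List.pairwise_cons]
    refine ⟨fun t ht => ⟨?_, ?_, ?_⟩, hL.2⟩
    · exact (sh_disj ((hdis t ht).mono_right hs.2.2.1)).symm
    · intro e he
      refine (hs.2.2.2 e he).imp id fun h => Sep.symm (Cov.sep fun a ha => h a ?_)
      exact Finset.disjoint_left.1 (hdis t ht) ha
    · intro e he
      exact (hsep t ht e he).imp id fun h => Cov.sep fun a ha => h a (hs.2.2.1 ha)

lemma fam_T (hUS : U ⊆ S) (y : V) (hy : y ∈ U) (T : List (Term V)) (hT : ∀ τ ∈ T, τ.Ok G σ U) (hTS : ∀ τ ∈ T, τ.S ⊆ S)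
    (hTd : T.Pairwise fun a b => Disjoint a.S b.S) (L : List (Src V)) (hL : List.Forall₂ (TSrc G σ) T L)
    (𝒟 : List (Finset (Sym2 V))) (h1 : ∀ D ∈ 𝒟, NC G σ D ∧ D ⊆ EU G U)
    (h2 : 𝒟.Pairwise Sh) : Fam G σ U S y (L ++ 𝒟.map (dsrc y)) := by
  have main : ∀ (T : List (Term V)) (L : List (Src V)), List.Forall₂ (TSrc G σ) T L → (∀ τ ∈ T, τ.Ok G σ U) →
      (∀ τ ∈ T, τ.S ⊆ S) → (T.Pairwise fun a b => Disjoint a.S b.S) →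
      Fam G σ U S y (L ++ 𝒟.map (dsrc y)) ∧ ∀ s ∈ L ++ 𝒟.map (dsrc y), (∃ τ ∈ T, TSrc G σ τ s) ∨ (vs s.C ⊆ U ∧ s.K = ∅) := by
    intro T L hL
    induction hL with
    | nil =>
      intro _ _ _
      refine ⟨fam_D hUS y 𝒟 h1 h2, ?_⟩
      intro s hs
      right
      obtain ⟨D, hD, rfl⟩ := List.mem_map.1 (by simpa using hs)
      exact ⟨vs_EU (h1 D hD).2, rfl⟩
    | @cons τ s T L hs hL ih =>
      intro hT hTS hTd
      rw [List.pairwise_cons] at hTd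
      obtain ⟨i1, i2⟩ := ih (fun t ht => hT t (by simp [ht])) (fun t ht => hTS t (by simp [ht])) hTd.2
      have hok := hT τ (by simp)
      refine ⟨fam_cons i1 hok hs (hTS τ (by simp)) hy ?_ ?_, ?_⟩
      · intro t ht
        rcases i2 t ht with ⟨τ', hτ', h⟩ | h
        · exact ((hTd.1 τ' hτ').mono_right h.2.2.1).symm
        · exact (hok.hd.mono_right h.1).symm
      · intro t ht e he
        rcases i2 t ht with ⟨τ', hτ', h⟩ | h
        · exact (h.2.2.2 e he).imp id fun h' a ha => h' a (Finset.disjoint_left.1 (hTd.1 τ' hτ') ha)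
        · rw [h.2] at he; simp at he
      · intro t ht
        rcases List.mem_cons.1 (by simpa using ht : t ∈ s :: (L ++ 𝒟.map (dsrc y))) with rfl | ht
        · exact Or.inl ⟨τ, by simp, hs⟩
        · rcases i2 t ht with ⟨τ', hτ', h⟩ | h
          · exact Or.inl ⟨τ', by simp [hτ'], h⟩
          · exact Or.inr h
  exact (main T L hL hT hTS hTd).1

lemma fam_root (hR : Reg G σ U) {y : V} (hy : y ∈ U) {L : List (Src V)} (hL : Fam G σ U S y L) (hodd : Odd L.length) :
    ∃ F a C, (∀ B ∈ F, SC G σ B) ∧ Lol G σ y a C ∧ vs C ⊆ S ∧ 2 * (tl F + a) ≤ 2 * Src.cost L + mm G σ (PU G σ U) ∧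
      ∀ s ∈ L, ∀ e ∈ s.K ∪ s.C, (∃ B ∈ F, e ∈ B) ∨ e ∈ C ∨ Cov G y C e := by
  obtain ⟨n, hn⟩ := hodd
  have hj := jn_pts hR (n + 1) (y :: L.map Src.x) (by simp; omega) (by
    intro x hx
    rcases List.mem_cons.1 hx with rfl | hx
    · exact hy
    · obtain ⟨s, hs, rfl⟩ := List.mem_map.1 hx
      exact (hL.1 s hs).2.1)
  obtain ⟨J, hJ, hb, hc⟩ := avg_all hR hj
  obtain ⟨F, c, s, hs, k1, k2, k3, k4⟩ := link_root L J (fun e he => PU_edge (hJ he)) (fun s hs => (hL.1 s hs).1) hL.2 y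
    (fun v => by rw [hb]; simp [Function.comp_def]) ⟨n, hn⟩ (fun s hs => (hL.1 s hs).2.2.2)
  exact ⟨F, c, s.C, k1, k2, (hL.1 s hs).2.2.1, by omega, k4⟩

lemma fam_even (hR : Reg G σ U) {y : V} {L : List (Src V)} (hL : Fam G σ U S y L) (hev : Even L.length) :
    ∃ F, (∀ B ∈ F, SC G σ B) ∧ 2 * tl F ≤ 2 * Src.cost L + mm G σ (PU G σ U) ∧
      ∀ s ∈ L, ∀ e ∈ s.K ∪ s.C, ∃ B ∈ F, e ∈ B := by
  obtain ⟨n, hn⟩ := hev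
  have hj := jn_pts hR n (L.map Src.x) (by simp; omega) (by
    intro x hx
    obtain ⟨s, hs, rfl⟩ := List.mem_map.1 hx
    exact (hL.1 s hs).2.1)
  obtain ⟨J, hJ, hb, hc⟩ := avg_all hR hj
  obtain ⟨F, k1, k2, k3⟩ := link_even L J (fun e he => PU_edge (hJ he)) (fun s hs => (hL.1 s hs).1) hL.2
    (fun v => by rw [hb]; simp [Function.comp_def]) ⟨n, hn⟩
  exact ⟨F, k1, by omega, k3⟩

/-- splitting an even subgraph into positive and negative cycles -/
lemma split' (H : Finset (Sym2 V)) (hH : H ⊆ EU G U) (hev : Ev H) :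
    ∃ P 𝒟 : List (Finset (Sym2 V)), (∀ C ∈ P, IsCyc G C ∧ sg σ C = 0) ∧ (∀ D ∈ 𝒟, NC G σ D ∧ D ⊆ EU G U) ∧
      𝒟.Pairwise Sh ∧ 𝒟.Pairwise Disjoint ∧ tl P + tl 𝒟 = H.card ∧ (∀ e ∈ H, (∃ B ∈ P, e ∈ B) ∨ ∃ D ∈ 𝒟, e ∈ D) ∧
      (𝒟.length : ZMod 2) = sg σ H ∧ (∀ C ∈ P, C ⊆ H) ∧ ∀ D ∈ 𝒟, D ⊆ H := by
  obtain ⟨L, hL, hg⟩ := exists_good (G := G) σ H (fun e he => EU_edge (hH he)) hev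
  have hsub : ∀ C ∈ L, C ⊆ H := fun C hC e he => (hL.2.2 e).2 ⟨C, hC, he⟩
  refine ⟨L.filter fun C => sg σ C = 0, L.filter fun C => ¬ sg σ C = 0, ?_, ?_, ?_, ?_, ?_, ?_, ?_, ?_, ?_⟩
  · intro C hC
    simp only [List.mem_filter, decide_eq_true_eq] at hC
    exact ⟨hL.1 C hC.1, hC.2⟩
  · intro C hC
    simp only [List.mem_filter, decide_eq_true_eq] at hC
    exact ⟨⟨hL.1 C hC.1, z2_ne _ hC.2⟩, (hsub C hC.1).trans hH⟩
  · have hn : (L.filter fun C => ¬ sg σ C = 0).Nodup := hL.nodup.filter _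
    refine List.Pairwise.imp_of_mem ?_ hn
    intro a b ha hb hab
    simp only [List.mem_filter, decide_eq_true_eq] at ha hb
    exact hg a ha.1 b hb.1 hab (z2_ne _ ha.2) (z2_ne _ hb.2)
  · exact hL.2.1.filter _
  · rw [← hL.card]
    clear hL hg hsub
    unfold tl
    induction L with
    | nil => simp
    | cons C L ih =>
      by_cases h : sg σ C = 0 <;> simp [h] at ih ⊢ <;> omega
  · intro e he
    obtain ⟨C, hC, heC⟩ := (hL.2.2 e).1 he
    by_cases h : sg σ C = 0
    · exact Or.inl ⟨C, by simp [hC, h], heC⟩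
    · exact Or.inr ⟨C, by simp [hC, h], heC⟩
  · rw [← hL.sg σ]
    clear hL hg hsub
    induction L with
    | nil => simp
    | cons C L ih =>
      rcases z2_cases (sg σ C) with h | h
      · simp [h] at ih ⊢; exact ih
      · simp [h] at ih ⊢; rw [ih]; ring
  · intro C hC; exact hsub C (List.mem_of_mem_filter hC)
  · intro C hC; exact hsub C (List.mem_of_mem_filter hC)

lemma split (H : Finset (Sym2 V)) (hH : H ⊆ EU G U) (hev : Ev H) :
    ∃ P 𝒟 : List (Finset (Sym2 V)), (∀ C ∈ P, SC G σ C) ∧ (∀ D ∈ 𝒟, NC G σ D ∧ D ⊆ EU G U) ∧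
      𝒟.Pairwise Sh ∧ 𝒟.Pairwise Disjoint ∧ tl P + tl 𝒟 = H.card ∧ (∀ e ∈ H, (∃ B ∈ P, e ∈ B) ∨ ∃ D ∈ 𝒟, e ∈ D) ∧
      (𝒟.length : ZMod 2) = sg σ H ∧ (∀ C ∈ P, C ⊆ H) ∧ ∀ D ∈ 𝒟, D ⊆ H := by
  obtain ⟨P, 𝒟, h1, h⟩ := split' (σ := σ) H hH hev
  exact ⟨P, 𝒟, fun C hC => sc_pos (h1 C hC).1 (h1 C hC).2, h⟩

lemma gamma (hR : Reg G σ U) {A B : Finset (Sym2 V)} (hA : NC G σ A ∧ A ⊆ EU G U) (hB : NC G σ B ∧ B ⊆ EU G U)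
    (hsh : Sh A B) (hd : Disjoint A B) (hAB : A.card ≤ B.card) :
    ∃ C, SC G σ C ∧ A ⊆ C ∧ B ⊆ C ∧ 2 * C.card ≤ 2 * B.card + mm G σ (EU G U) := by
  obtain ⟨a, ha⟩ := hA.1.vne
  obtain ⟨b, hb⟩ := hB.1.vne
  obtain ⟨w, -, hw, hwc⟩ := avg_path hR (vs_EU hA.2 ha) (vs_EU hB.2 hb) (PU G σ U \ (A ∪ B)) Finset.sdiff_subset
  obtain ⟨C, h1, h2, h3, h4, -⟩ := barbell hA.1 hB.1 hsh ha hb w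
  refine ⟨C, h1, h2, h3, ?_⟩
  have e1 : we w ∩ (PU G σ U \ (A ∪ B)) = we w \ (A ∪ B) := by
    ext e; simp only [Finset.mem_inter, Finset.mem_sdiff]
    constructor
    · tauto
    · intro h; exact ⟨h.1, hw h.1, h.2⟩
  rw [e1] at hwc
  have e2 : mm G σ ((PU G σ U \ (A ∪ B)) ∪ (A ∪ B)) ≤ mm G σ (EU G U) :=
    mm_mono (Finset.union_subset (Finset.sdiff_subset.trans PU_sub) (Finset.union_subset hA.2 hB.2))
  rw [mm_union Finset.sdiff_disjoint] at e2
  have e3 := card_le_mm (G := G) (σ := σ) (A ∪ B)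
  rw [Finset.card_union_of_disjoint hd] at e3
  omega

lemma lol_avg (hR : Reg G σ U) {y : V} (hy : y ∈ U) {D : Finset (Sym2 V)} (hD : NC G σ D ∧ D ⊆ EU G U) :
    ∃ a, Lol G σ y a D ∧ 2 * a ≤ 2 * D.card + mm G σ (PU G σ U \ D) ∧ a ≤ (EU G U).card := by
  obtain ⟨b, hb⟩ := hD.1.vne
  obtain ⟨w, -, hw, hwc⟩ := avg_path hR hy (vs_EU hD.2 hb) (PU G σ U \ D) Finset.sdiff_subset
  have e1 : we w ∩ (PU G σ U \ D) = we w \ D := by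
    ext e; simp only [Finset.mem_inter, Finset.mem_sdiff]
    constructor
    · tauto
    · intro h; exact ⟨h.1, hw h.1, h.2⟩
  rw [e1] at hwc
  refine ⟨D.card + (we w \ D).card, ⟨hD.1, b, hb, w, le_rfl⟩, by omega, ?_⟩
  rw [← Finset.card_union_of_disjoint Finset.disjoint_sdiff]
  exact Finset.card_le_card (Finset.union_subset hD.2 (Finset.sdiff_subset.trans (hw.trans PU_sub)))

lemma lol_walk (hR : Reg G σ U) {y : V} (hy : y ∈ U) {s : Src V} (hs : s.Ok G σ) (hx : s.x ∈ U) :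
    ∃ a, Lol G σ y a s.C ∧ 2 * a ≤ 2 * s.c + mm G σ (PU G σ U) := by
  obtain ⟨w, -, hw, hwc⟩ := avg_path hR hy hx (PU G σ U) subset_rfl
  refine ⟨_, hs.ext w, ?_⟩
  rw [Finset.inter_eq_left.2 hw] at hwc
  omega

lemma lambda (hR : Reg G σ U) {y : V} (hy : y ∈ U) {f : Sym2 V} (hf : f ∈ NU G σ U) :
    ∃ a C, Lol G σ y a C ∧ C ⊆ EU G U ∧ f ∈ C ∧ 4 * a ≤ 3 * mm G σ (EU G U) := by
  have hE := NU_sub hf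
  obtain ⟨Q, hQ, hb, hc⟩ := avg_all hR (jn_edges hR {f} (by simpa using hE))
  have hfQ : f ∉ Q := fun h => Finset.disjoint_left.1 (PN_disj U) (hQ h) hf
  have hdis : Disjoint Q {f} := by simpa using hfQ
  have hsub : Q ∪ {f} ⊆ EU G U := Finset.union_subset (hQ.trans PU_sub) (by simpa using hE)
  obtain ⟨C, hC, hfC, hCX⟩ := cyc_through G (Q ∪ {f}) (fun e he => EU_edge (hsub he))
    (fun v => by rw [bd_union hdis, hb, z2_self]) f (by simp)
  have hsg : sg σ C = 1 := by
    unfold sg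
    rw [Finset.sum_eq_single_of_mem f hfC]
    · simp [(mem_NU.1 hf).2]
    · intro e he hne
      have : e ∈ Q := by
        rcases Finset.mem_union.1 (hCX he) with h | h
        · exact h
        · exact absurd (Finset.mem_singleton.1 h) hne
      simp [(mem_PU.1 (hQ this)).2]
  have hN : NC G σ C := ⟨hC, hsg⟩
  obtain ⟨b, hb⟩ := hN.vne
  obtain ⟨w, -, hw, hwc⟩ := avg_path hR hy (vs_EU (hCX.trans hsub) hb) (PU G σ U \ Q) Finset.sdiff_subset
  refine ⟨C.card + (we w \ C).card, C, ⟨hN, b, hb, w, le_rfl⟩, hCX.trans hsub, hfC, ?_⟩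
  have h1 : C.card + (we w \ C).card ≤ (Q ∪ {f}).card + (we w ∩ (PU G σ U \ Q)).card := by
    rw [← Finset.card_union_of_disjoint Finset.disjoint_sdiff]
    refine le_trans (Finset.card_le_card ?_) (Finset.card_union_le _ _)
    intro e he
    rcases Finset.mem_union.1 he with h | h
    · exact Finset.mem_union_left _ (hCX h)
    · by_cases hq : e ∈ Q
      · simp [hq]
      · have := (Finset.mem_sdiff.1 h).1
        simp [hq, this, hw this]
  rw [Finset.card_union_of_disjoint hdis, Finset.card_singleton] at h1
  have h2 := mm_sdiff (G := G) (σ := σ) hQ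
  have h3 := card_le_mm (G := G) (σ := σ) Q
  have h4 := mm_EU (G := G) (σ := σ) U
  have h5 : 1 ≤ (NU G σ U).card := Finset.card_pos.2 ⟨f, hf⟩
  omega

end PieceTools
end SCC

open SimpleGraph Set
namespace SCC
open scoped Classical
set_option linter.all false

section Piece
variable {V : Type*} [Fintype V] {G : SimpleGraph V} {σ : Sym2 V → Bool} {U S : Finset V}

lemma cost_app (L : List (Src V)) (y : V) (𝒟 : List (Finset (Sym2 V))) :
    Src.cost (L ++ 𝒟.map (dsrc y)) = Src.cost L + tl 𝒟 := by
  unfold Src.cost tl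
  rw [List.map_append, List.sum_append, List.map_map]
  rfl

def Cv (G : SimpleGraph V) (y : V) (C : Finset (Sym2 V)) (e : Sym2 V) : Prop := e ∈ C ∨ Cov G y C e

/-- terminal list hypotheses -/
structure TL (G : SimpleGraph V) (σ : Sym2 V → Bool) (U S : Finset V) (T : List (Term V)) : Prop where
  ok : ∀ τ ∈ T, τ.Ok G σ U
  sub : ∀ τ ∈ T, τ.S ⊆ S
  dj : T.Pairwise fun a b => Disjoint a.S b.S

structure DL (G : SimpleGraph V) (σ : Sym2 V → Bool) (U : Finset V) (𝒟 : List (Finset (Sym2 V))) : Prop where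
  nc : ∀ D ∈ 𝒟, NC G σ D ∧ D ⊆ EU G U
  sh : 𝒟.Pairwise Sh
  dj : 𝒟.Pairwise Disjoint

lemma TL.nil : TL G σ U S [] := ⟨by simp, by simp, by simp⟩
lemma DL.nil : DL G σ U [] := ⟨by simp, by simp, by simp⟩
lemma TL.tail {τ : Term V} {T : List (Term V)} (h : TL G σ U S (τ :: T)) : TL G σ U S T :=
  ⟨fun t ht => h.ok t (by simp [ht]), fun t ht => h.sub t (by simp [ht]), (List.pairwise_cons.1 h.dj).2⟩
lemma DL.tail {τ : Finset (Sym2 V)} {T : List (Finset (Sym2 V))} (h : DL G σ U (τ :: T)) : DL G σ U T :=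
  ⟨fun t ht => h.nc t (by simp [ht]), (List.pairwise_cons.1 h.sh).2, (List.pairwise_cons.1 h.dj).2⟩
lemma TL.head {τ : Term V} {T : List (Term V)} (h : TL G σ U S (τ :: T)) : TL G σ U S [τ] :=
  ⟨fun t ht => h.ok t (by simp at ht; simp [ht]), fun t ht => h.sub t (by simp at ht; simp [ht]), by simp⟩
lemma DL.head {τ : Finset (Sym2 V)} {T : List (Finset (Sym2 V))} (h : DL G σ U (τ :: T)) : DL G σ U [τ] :=
  ⟨fun t ht => h.nc t (by simp at ht; simp [ht]), by simp, by simp⟩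
lemma TL.perm {T T' : List (Term V)} (h : TL G σ U S T) (hp : T.Perm T') : TL G σ U S T' :=
  ⟨fun t ht => h.ok t (hp.mem_iff.2 ht), fun t ht => h.sub t (hp.mem_iff.2 ht), (hp.pairwise_iff (fun h => h.symm)).1 h.dj⟩
lemma DL.perm {T T' : List (Finset (Sym2 V))} (h : DL G σ U T) (hp : T.Perm T') : DL G σ U T' :=
  ⟨fun t ht => h.nc t (hp.mem_iff.2 ht), (hp.pairwise_iff (fun h => h.symm)).1 h.sh, (hp.pairwise_iff (fun h => h.symm)).1 h.dj⟩

lemma sc_app {F F' : List (Finset (Sym2 V))} (h : ∀ B ∈ F, SC G σ B) (h' : ∀ B ∈ F', SC G σ B) :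
    ∀ B ∈ F ++ F', SC G σ B := by
  intro B hB
  rcases List.mem_append.1 hB with hB | hB
  · exact h B hB
  · exact h' B hB

lemma root_all (hR : Reg G σ U) (hUS : U ⊆ S) {y : V} (hy : y ∈ U) {T : List (Term V)} (hT : TL G σ U S T)
    {𝒟 : List (Finset (Sym2 V))} (hD : DL G σ U 𝒟) (hodd : Odd (T.length + 𝒟.length)) :
    ∃ F a C, (∀ B ∈ F, SC G σ B) ∧ Lol G σ y a C ∧ vs C ⊆ S ∧
      2 * (tl F + a) ≤ 2 * (T.map Term.c1).sum + 2 * tl 𝒟 + mm G σ (PU G σ U) ∧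
      ∀ e, ((∃ τ ∈ T, e ∈ τ.K) ∨ ∃ D ∈ 𝒟, e ∈ D) → (∃ B ∈ F, e ∈ B) ∨ Cv G y C e := by
  obtain ⟨F0, L, h1, h2, h3, h4⟩ := expandL T hT.ok
  have hfam := fam_T hUS y hy T hT.ok hT.sub hT.dj L h2 𝒟 hD.nc hD.sh
  obtain ⟨F, a, C, k1, k2, k3, k4, k5⟩ := fam_root hR hy hfam (by
    rw [List.length_append, List.length_map, ← h2.length_eq]; exact hodd)
  rw [cost_app] at k4
  refine ⟨F0 ++ F, a, C, sc_app h1 k1, k2, k3, by rw [tl_append]; omega, ?_⟩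
  rintro e (⟨τ, hτ, he⟩ | ⟨D, hD, he⟩)
  · rcases h4 τ hτ e he with ⟨B, hB, h⟩ | ⟨s, hs, h⟩
    · exact Or.inl ⟨B, by simp [hB], h⟩
    · rcases k5 s (by simp [hs]) e h with ⟨B, hB, h⟩ | h
      · exact Or.inl ⟨B, by simp [hB], h⟩
      · exact Or.inr h
  · rcases k5 (dsrc y D) (by simp; exact Or.inr ⟨D, hD, rfl⟩) e (by simp [dsrc, he]) with ⟨B, hB, h⟩ | h
    · exact Or.inl ⟨B, by simp [hB], h⟩
    · exact Or.inr h

/-- bump: pack-2 of the first terminal, one lollipop goes to the root -/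
lemma bump (hR : Reg G σ U) (hUS : U ⊆ S) {y : V} (hy : y ∈ U) {τ : Term V} {T : List (Term V)} (hT : TL G σ U S (τ :: T))
    {𝒟 : List (Finset (Sym2 V))} (hD : DL G σ U 𝒟) :
    ∃ F0 L a' C', (∀ B ∈ F0, SC G σ B) ∧ Fam G σ U S y L ∧ L.length = T.length + 1 + 𝒟.length ∧
      Lol G σ y a' C' ∧ vs C' ⊆ S ∧
      2 * (tl F0 + Src.cost L + a') ≤ 2 * (τ.c2 + (T.map Term.c1).sum) + 2 * tl 𝒟 + mm G σ (PU G σ U) ∧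
      ∀ e, ((∃ t ∈ τ :: T, e ∈ t.K) ∨ ∃ D ∈ 𝒟, e ∈ D) → (∃ B ∈ F0, e ∈ B) ∨ (∃ s ∈ L, e ∈ s.K ∪ s.C) ∨ Cv G y C' e := by
  obtain ⟨F0, L, h1, h2, h3, h4⟩ := expandL T hT.tail.ok
  have hok := hT.ok τ (by simp)
  obtain ⟨F1, s, s', k1, k2, k3, k4, k5⟩ := expand2 hok
  have hfam := fam_T hUS y hy (τ :: T) hT.ok hT.sub hT.dj (s :: L) (List.Forall₂.cons k2 h2) 𝒟 hD.nc hD.sh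
  obtain ⟨a, ha, hac⟩ := lol_walk hR hy k3.2.1 (k3.1 ▸ hok.hx)
  refine ⟨F0 ++ F1, _, a, s'.C, sc_app h1 k1, hfam, ?_, ha, k3.2.2.1.trans (hT.sub τ (by simp)), ?_, ?_⟩
  · simp; rw [h2.length_eq]; omega
  · rw [cost_app, tl_append]
    have : Src.cost (s :: L) = s.c + Src.cost L := by simp [Src.cost]
    omega
  · have hyS : y ∉ τ.S := fun h => Finset.disjoint_left.1 hok.hd h hy
    rintro e (⟨t, ht, he⟩ | ⟨D, hD, he⟩)
    · rcases List.mem_cons.1 ht with rfl | ht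
      · rcases k5 e he with ⟨B, hB, h⟩ | h | h
        · exact Or.inl ⟨B, by simp [hB], h⟩
        · exact Or.inr (Or.inl ⟨s, by simp, h⟩)
        · right; right
          rcases Finset.mem_union.1 h with h | h
          · exact (k3.2.2.2 e h).imp id fun h' => h' y hyS
          · exact Or.inl h
      · rcases h4 t ht e he with ⟨B, hB, h⟩ | ⟨r, hr, h⟩
        · exact Or.inl ⟨B, by simp [hB], h⟩
        · exact Or.inr (Or.inl ⟨r, by simp [hr], h⟩)
    · exact Or.inr (Or.inl ⟨dsrc y D, by simp; exact Or.inr (Or.inr ⟨D, hD, rfl⟩), by simp [dsrc, he]⟩)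

lemma root_bump (hR : Reg G σ U) (hUS : U ⊆ S) {y : V} (hy : y ∈ U) {τ : Term V} {T : List (Term V)} (hT : TL G σ U S (τ :: T))
    {𝒟 : List (Finset (Sym2 V))} (hD : DL G σ U 𝒟) (hodd : Odd ((τ :: T).length + 𝒟.length)) :
    ∃ F a C a' C', (∀ B ∈ F, SC G σ B) ∧ Lol G σ y a C ∧ vs C ⊆ S ∧ Lol G σ y a' C' ∧ vs C' ⊆ S ∧
      2 * (tl F + a + a') ≤ 2 * (τ.c2 + (T.map Term.c1).sum) + 2 * tl 𝒟 + 2 * mm G σ (PU G σ U) ∧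
      ∀ e, ((∃ t ∈ τ :: T, e ∈ t.K) ∨ ∃ D ∈ 𝒟, e ∈ D) → (∃ B ∈ F, e ∈ B) ∨ Cv G y C e ∨ Cv G y C' e := by
  obtain ⟨F0, L, a', C', h1, h2, h3, h4, h5, h6, h7⟩ := bump hR hUS hy hT hD
  obtain ⟨F, a, C, k1, k2, k3, k4, k5⟩ := fam_root hR hy h2 (by rw [h3]; simpa using hodd)
  refine ⟨F0 ++ F, a, C, a', C', sc_app h1 k1, k2, k3, h4, h5, by rw [tl_append]; omega, ?_⟩
  intro e he
  rcases h7 e he with ⟨B, hB, h⟩ | ⟨s, hs, h⟩ | h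
  · exact Or.inl ⟨B, by simp [hB], h⟩
  · rcases k5 s hs e h with ⟨B, hB, h⟩ | h
    · exact Or.inl ⟨B, by simp [hB], h⟩
    · exact Or.inr (Or.inl h)
  · exact Or.inr (Or.inr h)

lemma even_bump (hR : Reg G σ U) (hUS : U ⊆ S) {y : V} (hy : y ∈ U) {τ : Term V} {T : List (Term V)} (hT : TL G σ U S (τ :: T))
    {𝒟 : List (Finset (Sym2 V))} (hD : DL G σ U 𝒟) (hev : Even ((τ :: T).length + 𝒟.length)) :
    ∃ F a' C', (∀ B ∈ F, SC G σ B) ∧ Lol G σ y a' C' ∧ vs C' ⊆ S ∧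
      2 * (tl F + a') ≤ 2 * (τ.c2 + (T.map Term.c1).sum) + 2 * tl 𝒟 + 2 * mm G σ (PU G σ U) ∧
      ∀ e, ((∃ t ∈ τ :: T, e ∈ t.K) ∨ ∃ D ∈ 𝒟, e ∈ D) → (∃ B ∈ F, e ∈ B) ∨ Cv G y C' e := by
  obtain ⟨F0, L, a', C', h1, h2, h3, h4, h5, h6, h7⟩ := bump hR hUS hy hT hD
  obtain ⟨F, k1, k4, k5⟩ := fam_even hR h2 (by rw [h3]; simpa using hev)
  refine ⟨F0 ++ F, a', C', sc_app h1 k1, h4, h5, by rw [tl_append]; omega, ?_⟩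
  intro e he
  rcases h7 e he with ⟨B, hB, h⟩ | ⟨s, hs, h⟩ | h
  · exact Or.inl ⟨B, by simp [hB], h⟩
  · obtain ⟨B, hB, h⟩ := k5 s hs e h
    exact Or.inl ⟨B, by simp [hB], h⟩
  · exact Or.inr h

def PP (G : SimpleGraph V) (σ : Sym2 V → Bool) (S : Finset V) (y : V) (M : ℕ) (K : Finset (Sym2 V)) : Prop :=
  ∃ c1 c2, Pack1 G σ S y c1 K ∧ Pack2 G σ S y c2 K ∧ 2 * c1 ≤ 3 * M ∧ c1 + c2 ≤ 3 * M

lemma mk1 {S : Finset V} {y : V} {c : ℕ} {K : Finset (Sym2 V)} {F : List (Finset (Sym2 V))} {a C}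
    (h1 : ∀ B ∈ F, SC G σ B) (h2 : Lol G σ y a C) (h3 : vs C ⊆ S) (h4 : tl F + a ≤ c)
    (h5 : ∀ e ∈ K, (∃ B ∈ F, e ∈ B) ∨ Cv G y C e) : Pack1 G σ S y c K := ⟨F, a, C, h1, h2, h3, h4, h5⟩

lemma mk2 {S : Finset V} {y : V} {c : ℕ} {K : Finset (Sym2 V)} {F : List (Finset (Sym2 V))} {a C a' C'}
    (h1 : ∀ B ∈ F, SC G σ B) (h2 : Lol G σ y a C) (h3 : vs C ⊆ S) (h2' : Lol G σ y a' C') (h3' : vs C' ⊆ S)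
    (h4 : tl F + a + a' ≤ c)
    (h5 : ∀ e ∈ K, (∃ B ∈ F, e ∈ B) ∨ Cv G y C e ∨ Cv G y C' e) : Pack2 G σ S y c K :=
  ⟨F, a, C, a', C', h1, h2, h3, h2', h3', h4, h5⟩

lemma in_app {F F' : List (Finset (Sym2 V))} {e : Sym2 V} :
    (∃ B ∈ F ++ F', e ∈ B) ↔ (∃ B ∈ F, e ∈ B) ∨ ∃ B ∈ F', e ∈ B := by
  simp only [List.mem_append]
  constructor
  · rintro ⟨B, h | h, he⟩
    · exact Or.inl ⟨B, h, he⟩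
    · exact Or.inr ⟨B, h, he⟩
  · rintro (⟨B, h, he⟩ | ⟨B, h, he⟩)
    · exact ⟨B, Or.inl h, he⟩
    · exact ⟨B, Or.inr h, he⟩

lemma pr1 {q r P A A' c c' : Prop} (k : q → A ∨ c) (l : r → A' ∨ c') (h : q ∨ r) : (P ∨ A ∨ A') ∨ c ∨ c' := by tauto
lemma pr2 {q r P A A' c : Prop} (k : q → A ∨ c) (l : r → A') (h : q ∨ r) : (P ∨ A ∨ A') ∨ c := by tauto

/-- context: terminals plus decomposition -/
structure Ctx (G : SimpleGraph V) (σ : Sym2 V → Bool) (U S : Finset V) (y : V) (K : Finset (Sym2 V))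
    (T : List (Term V)) (P 𝒟 : List (Finset (Sym2 V))) : Prop where
  hR : Reg G σ U
  hUS : U ⊆ S
  hy : y ∈ U
  hT : TL G σ U S T
  hD : DL G σ U 𝒟
  hP : ∀ B ∈ P, SC G σ B
  hc : 2 * (tl P + tl 𝒟) ≤ mm G σ (EU G U)
  hK : ∀ e ∈ K, (∃ B ∈ P, e ∈ B) ∨ ((∃ τ ∈ T, e ∈ τ.K) ∨ ∃ D ∈ 𝒟, e ∈ D)

lemma pu_le : mm G σ (PU G σ U) ≤ mm G σ (EU G U) := mm_mono PU_sub

variable {y : V} {K : Finset (Sym2 V)} {P 𝒟 : List (Finset (Sym2 V))}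

lemma T_sum {T : List (Term V)} (hT : TL G σ U S T) : 2 * (T.map Term.c1).sum ≤ 3 * (T.map Term.M).sum := by
  induction T with
  | nil => simp
  | cons τ T ih =>
    have := ih hT.tail
    have := (hT.ok τ (by simp)).b1
    simp only [List.map_cons, List.sum_cons]
    omega

lemma caseA {τ : Term V} {T : List (Term V)} (h : Ctx G σ U S y K (τ :: T) P 𝒟) (hodd : Odd ((τ :: T).length + 𝒟.length)) :
    PP G σ S y (mm G σ (EU G U) + ((τ :: T).map Term.M).sum) K := by
  obtain ⟨F, a, C, h1, h2, h3, h4, h5⟩ := root_all h.hR h.hUS h.hy h.hT h.hD hodd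
  obtain ⟨F', b, D, b', D', k1, k2, k3, k4, k5, k6, k7⟩ := root_bump h.hR h.hUS h.hy h.hT h.hD hodd
  refine ⟨_, _, mk1 (sc_app h.hP h1) h2 h3 le_rfl ?_, mk2 (sc_app h.hP k1) k2 k3 k4 k5 le_rfl ?_, ?_, ?_⟩
  · intro e he
    rw [in_app]
    rcases h.hK e he with h' | h'
    · exact Or.inl (Or.inl h')
    · exact (h5 e h').imp Or.inr id
  · intro e he
    rw [in_app]
    rcases h.hK e he with h' | h'
    · exact Or.inl (Or.inl h')
    · exact (k7 e h').imp Or.inr id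
  all_goals
    have := T_sum h.hT.tail
    have := (h.hT.ok τ (by simp)).b1
    have := (h.hT.ok τ (by simp)).b2
    have := pu_le (G := G) (σ := σ) (U := U)
    have := h.hc
    simp only [List.map_cons, List.sum_cons, tl_append] at *
    omega

lemma caseB' {τ τ' : Term V} {T : List (Term V)} (h : Ctx G σ U S y K (τ :: τ' :: T) P 𝒟)
    (hev : Even ((τ :: τ' :: T).length + 𝒟.length)) (hle : τ'.c1 + τ.c2 ≤ τ.c1 + τ'.c2) :
    PP G σ S y (mm G σ (EU G U) + ((τ :: τ' :: T).map Term.M).sum) K := by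
  obtain ⟨F, a, C, h1, h2, h3, h4, h5⟩ := even_bump h.hR h.hUS h.hy h.hT h.hD hev
  obtain ⟨F', b, D, k1, k2, k3, k4, k5⟩ := root_all h.hR h.hUS h.hy h.hT.tail h.hD (by
    simp only [List.length_cons] at *
    obtain ⟨r, hr⟩ := hev
    exact ⟨r - 1, by omega⟩)
  obtain ⟨F'', b', D', l1, l2, l3, l4, l5⟩ := root_all h.hR h.hUS h.hy h.hT.head DL.nil (by simp)
  refine ⟨_, _, mk1 (sc_app h.hP h1) h2 h3 le_rfl ?_, mk2 (sc_app h.hP (sc_app k1 l1)) k2 k3 l2 l3 le_rfl ?_, ?_, ?_⟩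
  · intro e he
    rw [in_app]
    rcases h.hK e he with h' | h'
    · exact Or.inl (Or.inl h')
    · exact (h5 e h').imp Or.inr id
  · intro e he
    rw [in_app, in_app]
    rcases h.hK e he with h' | h'
    · exact Or.inl (Or.inl h')
    · refine pr1 (k5 e) (l5 e) ?_
      rcases h' with ⟨t, ht, h'⟩ | h'
      · rcases List.mem_cons.1 ht with rfl | ht
        · exact Or.inr (Or.inl ⟨t, by simp, h'⟩)
        · exact Or.inl (Or.inl ⟨t, ht, h'⟩)
      · exact Or.inl (Or.inr h')
  all_goals
    have := T_sum h.hT.tail.tail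
    have := (h.hT.ok τ (by simp)).b1
    have := (h.hT.ok τ (by simp)).b2
    have := (h.hT.ok τ' (by simp)).b1
    have := (h.hT.ok τ' (by simp)).b2
    have := pu_le (G := G) (σ := σ) (U := U)
    have := h.hc
    simp only [List.map_cons, List.map_nil, List.sum_nil, List.sum_cons, tl_append, tl_nil] at *
    omega

lemma Ctx.permT {T T' : List (Term V)} (h : Ctx G σ U S y K T P 𝒟) (hp : T.Perm T') : Ctx G σ U S y K T' P 𝒟 :=
  ⟨h.hR, h.hUS, h.hy, h.hT.perm hp, h.hD, h.hP, h.hc, by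
    have := h.hK
    simp only [hp.mem_iff] at this
    exact this⟩

lemma tl_perm {F F' : List (Finset (Sym2 V))} (h : F.Perm F') : tl F = tl F' := (h.map _).sum_eq

lemma Ctx.permD {T : List (Term V)} {𝒟' : List (Finset (Sym2 V))} (h : Ctx G σ U S y K T P 𝒟) (hp : 𝒟.Perm 𝒟') : Ctx G σ U S y K T P 𝒟' :=
  ⟨h.hR, h.hUS, h.hy, h.hT, h.hD.perm hp, h.hP, by rw [← tl_perm hp]; exact h.hc, by
    have := h.hK
    simp only [hp.mem_iff] at this
    exact this⟩

lemma caseB {τ τ' : Term V} {T : List (Term V)} (h : Ctx G σ U S y K (τ :: τ' :: T) P 𝒟)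
    (hev : Even ((τ :: τ' :: T).length + 𝒟.length)) :
    PP G σ S y (mm G σ (EU G U) + ((τ :: τ' :: T).map Term.M).sum) K := by
  rcases le_total (τ'.c1 + τ.c2) (τ.c1 + τ'.c2) with hle | hle
  · exact caseB' h hev hle
  · have := caseB' (h.permT (List.Perm.swap _ _ _)) (by simpa using hev) (by omega)
    convert this using 1
    simp only [List.map_cons, List.sum_cons]
    omega

/-- one terminal, one negative cycle -/
lemma caseC1 {τ : Term V} {D : Finset (Sym2 V)} (h : Ctx G σ U S y K [τ] P [D]) :
    PP G σ S y (mm G σ (EU G U) + ([τ].map Term.M).sum) K := by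
  have hok := h.hT.ok τ (by simp)
  have hD := h.hD.nc D (by simp)
  obtain ⟨F', b, D', k1, k2, k3, k4, k5⟩ := root_all (T := []) h.hR h.hUS h.hy TL.nil h.hD (by simp)
  obtain ⟨F'', b', D'', l1, l2, l3, l4, l5⟩ := root_all h.hR h.hUS h.hy h.hT DL.nil (by simp)
  obtain ⟨a, ha, ha1, -⟩ := lol_avg h.hR h.hy hD
  obtain ⟨a', ha', ha1', -⟩ := lol_avg h.hR hok.hx hD
  obtain ⟨F0, s, m1, m2, m3, m4⟩ := expand1 hok
  have hdis : Disjoint (vs s.C) (vs D) := (hok.hd.mono_left m2.2.2.1).mono_right (vs_EU hD.2)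
  have hsok : Lol G σ τ.x s.c s.C := m2.1 ▸ m2.2.1
  obtain ⟨B, n1, n2, n3, n4, n5⟩ := hsok.comb ha' (sh_disj hdis)
  have hsep : ∀ e ∈ s.K ∪ s.C, e ∈ B := by
    intro e he
    rcases Finset.mem_union.1 he with he | he
    · rcases m2.2.2.2 e he with h' | h'
      · exact n2 h'
      · refine n5 e (Sep.symm (Cov.sep fun a ha => h' a fun haS => ?_))
        exact Finset.disjoint_left.1 hok.hd haS (vs_EU hD.2 ha)
    · exact n2 he
  refine ⟨_, _, mk1 (sc_app h.hP (sc_app m1 (F' := [B]) (by simpa using n1))) ha ((vs_EU hD.2).trans h.hUS) le_rfl ?_,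
    mk2 (sc_app h.hP (sc_app k1 l1)) k2 k3 l2 l3 le_rfl ?_, ?_, ?_⟩
  · intro e he
    rw [in_app, in_app]
    rcases h.hK e he with h' | h' | h'
    · exact Or.inl (Or.inl h')
    · obtain ⟨t, ht, h'⟩ := h'
      rw [List.mem_singleton] at ht
      subst ht
      rcases m4 e h' with h' | h'
      · exact Or.inl (Or.inr (Or.inl h'))
      · exact Or.inl (Or.inr (Or.inr ⟨B, by simp, hsep e h'⟩))
    · obtain ⟨t, ht, h'⟩ := h'
      rw [List.mem_singleton] at ht
      subst ht
      exact Or.inr (Or.inl h')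
  · intro e he
    rw [in_app, in_app]
    rcases h.hK e he with h' | h'
    · exact Or.inl (Or.inl h')
    · refine pr1 (k5 e) (l5 e) ?_
      rcases h' with h' | h'
      · exact Or.inr (Or.inl h')
      · exact Or.inl (Or.inr h')
  all_goals
    have := hok.b1
    have := hok.b2
    have := pu_le (G := G) (σ := σ) (U := U)
    have := h.hc
    have q1 : mm G σ (PU G σ U \ D ∪ D) ≤ mm G σ (EU G U) :=
      mm_mono (Finset.union_subset (Finset.sdiff_subset.trans PU_sub) hD.2)
    rw [mm_union Finset.sdiff_disjoint] at q1
    have := card_le_mm (G := G) (σ := σ) D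
    simp only [List.map_cons, List.map_nil, List.sum_nil, List.sum_cons, tl_append, tl_nil, tl_cons] at *
    omega

/-- two ordered negative cycles: gamma -/
lemma two_ord (hR : Reg G σ U) {A B : Finset (Sym2 V)} {L : List (Finset (Sym2 V))} (hD : DL G σ U (A :: B :: L)) :
    ∃ A' B', (A :: B :: L).Perm (A' :: B' :: L) ∧
    ∃ C, SC G σ C ∧ A' ⊆ C ∧ 2 * C.card ≤ 2 * A'.card + mm G σ (EU G U) := by
  have key : ∀ A' B', (A :: B :: L).Perm (A' :: B' :: L) → B'.card ≤ A'.card → 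
    ∃ C, SC G σ C ∧ A' ⊆ C ∧ 2 * C.card ≤ 2 * A'.card + mm G σ (EU G U) := by
    intro A' B' hp hle
    have hd := hD.perm hp
    obtain ⟨C, h1, h2, h3, h4⟩ := gamma hR (hd.nc B' (by simp)) (hd.nc A' (by simp))
      ((List.pairwise_cons.1 hd.sh).1 B' (by simp)).symm ((List.pairwise_cons.1 hd.dj).1 B' (by simp)).symm hle
    exact ⟨C, h1, h3, h4⟩
  rcases le_total B.card A.card with h | h
  · exact ⟨A, B, List.Perm.refl _, key A B (List.Perm.refl _) h⟩
  · exact ⟨B, A, List.Perm.swap _ _ _, key B A (List.Perm.swap _ _ _) h⟩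

/-- one terminal, three or more negative cycles -/
lemma caseC3 {τ : Term V} {A B : Finset (Sym2 V)} {L : List (Finset (Sym2 V))} (h : Ctx G σ U S y K [τ] P (A :: B :: L))
    (hodd : Odd (A :: B :: L).length) :
    PP G σ S y (mm G σ (EU G U) + ([τ].map Term.M).sum) K := by
  obtain ⟨A', B', hp, C, g1, g2, g3⟩ := two_ord h.hR h.hD
  replace h := h.permD hp
  have hok := h.hT.ok τ (by simp)
  obtain ⟨F', b, D', k1, k2, k3, k4, k5⟩ := root_all (T := []) h.hR h.hUS h.hy TL.nil h.hD (by simpa using hodd)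
  obtain ⟨F'', b', D'', l1, l2, l3, l4, l5⟩ := root_all h.hR h.hUS h.hy h.hT DL.nil (by simp)
  obtain ⟨F, a, Ca, m1, m2, m3, m4, m5⟩ := root_all h.hR h.hUS h.hy h.hT h.hD.tail (by
    simp only [List.length_cons, List.length_nil] at *
    obtain ⟨r, hr⟩ := hodd
    exact ⟨r, by omega⟩)
  refine ⟨_, _, mk1 (sc_app h.hP (sc_app m1 (F' := [C]) (by simpa using g1))) m2 m3 le_rfl ?_,
    mk2 (sc_app h.hP (sc_app k1 l1)) k2 k3 l2 l3 le_rfl ?_, ?_, ?_⟩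
  · intro e he
    rw [in_app, in_app]
    rcases h.hK e he with h' | h'
    · exact Or.inl (Or.inl h')
    · refine pr2 (m5 e) (r := e ∈ A') (fun h => ⟨C, by simp, g2 h⟩) ?_
      rcases h' with h' | ⟨t, ht, h'⟩
      · exact Or.inl (Or.inl h')
      · rcases List.mem_cons.1 ht with rfl | ht
        · exact Or.inr h'
        · exact Or.inl (Or.inr ⟨t, ht, h'⟩)
  · intro e he
    rw [in_app, in_app]
    rcases h.hK e he with h' | h'
    · exact Or.inl (Or.inl h')
    · refine pr1 (k5 e) (l5 e) ?_
      rcases h' with h' | h'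
      · exact Or.inr (Or.inl h')
      · exact Or.inl (Or.inr h')
  all_goals
    have := hok.b1
    have := hok.b2
    have := pu_le (G := G) (σ := σ) (U := U)
    have := h.hc
    simp only [List.map_cons, List.map_nil, List.sum_nil, List.sum_cons, tl_append, tl_nil, tl_cons] at *
    omega

/-- no terminal, odd number of negative cycles -/
lemma caseD1 (h : Ctx G σ U S y K [] P 𝒟) (hodd : Odd 𝒟.length) :
    PP G σ S y (mm G σ (EU G U) + (([] : List (Term V)).map Term.M).sum) K := by
  obtain ⟨F, b, C, k1, k2, k3, k4, k5⟩ := root_all (T := []) h.hR h.hUS h.hy TL.nil h.hD (by simpa using hodd)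
  obtain ⟨D, hD⟩ : ∃ D, D ∈ 𝒟 := by
    cases 𝒟 with
    | nil => simp at hodd
    | cons a l => exact ⟨a, by simp⟩
  have hDn := h.hD.nc D hD
  obtain ⟨a, ha, -, ha1⟩ := lol_avg h.hR h.hy hDn
  have hcov : ∀ e ∈ K, (∃ B ∈ P ++ F, e ∈ B) ∨ Cv G y C e := by
    intro e he
    rw [in_app]
    rcases h.hK e he with h' | h'
    · exact Or.inl (Or.inl h')
    · exact (k5 e h').imp Or.inr id
  refine ⟨_, _, mk1 (sc_app h.hP k1) k2 k3 le_rfl hcov,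
    mk2 (sc_app h.hP k1) k2 k3 ha ((vs_EU hDn.2).trans h.hUS) le_rfl ?_, ?_, ?_⟩
  · intro e he
    exact (hcov e he).imp id Or.inl
  all_goals
    have := pu_le (G := G) (σ := σ) (U := U)
    have := card_le_mm (G := G) (σ := σ) (EU G U)
    have := h.hc
    simp only [List.map_cons, List.map_nil, List.sum_nil, List.sum_cons, tl_append, tl_nil, tl_cons] at *
    omega

lemma caseD2 {A B : Finset (Sym2 V)} {L : List (Finset (Sym2 V))} (h : Ctx G σ U S y K [] P (A :: B :: L))
    (hev : Even (A :: B :: L).length) :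
    PP G σ S y (mm G σ (EU G U) + (([] : List (Term V)).map Term.M).sum) K := by
  obtain ⟨A', B', hp, C, g1, g2, g3⟩ := two_ord h.hR h.hD
  replace h := h.permD hp
  obtain ⟨F', b, D', k1, k2, k3, k4, k5⟩ := root_all (T := []) h.hR h.hUS h.hy TL.nil h.hD.tail (by
    simp only [List.length_cons, List.length_nil] at *
    obtain ⟨r, hr⟩ := hev
    exact ⟨r - 1, by omega⟩)
  obtain ⟨F'', b', D'', l1, l2, l3, l4, l5⟩ := root_all (T := []) h.hR h.hUS h.hy TL.nil h.hD.head (by simp)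
  refine ⟨_, _, mk1 (sc_app h.hP (sc_app k1 (F' := [C]) (by simpa using g1))) k2 k3 le_rfl ?_,
    mk2 (sc_app h.hP (sc_app k1 l1)) k2 k3 l2 l3 le_rfl ?_, ?_, ?_⟩
  · intro e he
    rw [in_app, in_app]
    rcases h.hK e he with h' | h'
    · exact Or.inl (Or.inl h')
    · refine pr2 (k5 e) (r := e ∈ A') (fun h => ⟨C, by simp, g2 h⟩) ?_
      rcases h' with h' | ⟨t, ht, h'⟩
      · exact Or.inl (Or.inl h')
      · rcases List.mem_cons.1 ht with rfl | ht
        · exact Or.inr h'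
        · exact Or.inl (Or.inr ⟨t, ht, h'⟩)
  · intro e he
    rw [in_app, in_app]
    rcases h.hK e he with h' | h'
    · exact Or.inl (Or.inl h')
    · refine pr1 (k5 e) (l5 e) ?_
      rcases h' with h' | ⟨t, ht, h'⟩
      · simp at h'
      · rcases List.mem_cons.1 ht with rfl | ht
        · exact Or.inr (Or.inr ⟨t, by simp, h'⟩)
        · exact Or.inl (Or.inr ⟨t, ht, h'⟩)
  all_goals
    have := pu_le (G := G) (σ := σ) (U := U)
    have := h.hc
    simp only [List.map_cons, List.map_nil, List.sum_nil, List.sum_cons, tl_append, tl_nil, tl_cons] at *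
    omega

lemma caseD0 (hB : Bl G U) (h : Ctx G σ U S y K [] P []) (hK : K ⊆ RU G σ U) (hne : (NU G σ U).Nonempty)
    (heven : (((NU G σ U).card : ℕ) : ZMod 2) = 0) :
    PP G σ S y (mm G σ (EU G U) + (([] : List (Term V)).map Term.M).sum) K := by
  obtain ⟨f, hf⟩ := hne
  obtain ⟨a, C, h1, h2, h3, h4⟩ := lambda h.hR h.hy hf
  obtain ⟨H, e1, e2, e3, e4, e5⟩ := exH h.hR ((NU G σ U).erase f) (Finset.erase_subset _ _)
  obtain ⟨P', 𝒟', p1, p2, p3, p4, p5, p6, p7, -, -⟩ := split (σ := σ) H e1 e2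
  have hpos : 1 ≤ (NU G σ U).card := Finset.card_pos.2 ⟨f, hf⟩
  have hcard := Finset.card_erase_of_mem hf
  have hodd : Odd 𝒟'.length := by
    rw [← ZMod.natCast_eq_one_iff_odd, p7, e5, hcard, Nat.cast_sub hpos, heven]; decide
  obtain ⟨F, b, C', k1, k2, k3, k4, k5⟩ := root_all (T := []) h.hR h.hUS h.hy TL.nil (⟨p2, p3, p4⟩ : DL G σ U 𝒟') (by simpa using hodd)
  refine ⟨_, _, mk1 h.hP h1 ((vs_EU h2).trans h.hUS) le_rfl ?_,
    mk2 (sc_app p1 k1) h1 ((vs_EU h2).trans h.hUS) k2 k3 le_rfl ?_, ?_, ?_⟩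
  · intro e he
    rcases h.hK e he with h' | h'
    · exact Or.inl h'
    · simp at h'
  · intro e he
    rw [in_app]
    have hor : e ∈ H ∨ e ∈ C := by
      obtain ⟨r1, r2⟩ := Finset.mem_filter.1 (hK he)
      by_cases hs : σ e = true
      · by_cases hef : e = f
        · subst hef; exact Or.inr h3
        · exact Or.inl ((e3 e (mem_NU.2 ⟨r1, hs⟩)).2 (Finset.mem_erase.2 ⟨hef, mem_NU.2 ⟨r1, hs⟩⟩))
      · obtain ⟨g, hg, hm⟩ := mate h.hR hB e (mem_PU.2 ⟨r1, by simpa using hs⟩) r2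
        by_cases hef : g = f
        · subst hef; exact Or.inr ((hm C h2 h1.1.1.ev).2 h3)
        · exact Or.inl ((hm H e1 e2).2 ((e3 g hg).2 (Finset.mem_erase.2 ⟨hef, hg⟩)))
    rcases hor with hH | hC
    · rcases p6 e hH with h' | h'
      · exact Or.inl (Or.inl h')
      · rcases k5 e (Or.inr h') with h'' | h''
        · exact Or.inl (Or.inr h'')
        · exact Or.inr (Or.inr h'')
    · exact Or.inr (Or.inl (Or.inl hC))
  all_goals
    have := mm_EU (G := G) (σ := σ) U
    have := h.hc
    simp only [List.map_cons, List.map_nil, List.sum_nil, List.sum_cons, tl_append, tl_nil, tl_cons] at *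
    omega

/-- the piece lemma -/
theorem piece (hR : Reg G σ U) (hB : Bl G U) (hUS : U ⊆ S) (hy : y ∈ U) (T : List (Term V)) (hT : TL G σ U S T)
    (hne : T = [] → (NU G σ U).Nonempty) (hK : ∀ e ∈ K, e ∈ RU G σ U ∨ ∃ τ ∈ T, e ∈ τ.K) :
    PP G σ S y (mm G σ (EU G U) + (T.map Term.M).sum) K := by
  obtain ⟨H, e1, e2, e3, e4, e5⟩ := exH hR (NU G σ U) subset_rfl
  obtain ⟨P, 𝒟, p1, p2, p3, p4, p5, p6, p7, -, -⟩ := split (σ := σ) H e1 e2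
  have hRH := RU_sub_H hR hB e1 e2 (fun e he => (e3 e he).2 he)
  have hctx : Ctx G σ U S y K T P 𝒟 := by
    refine ⟨hR, hUS, hy, hT, ⟨p2, p3, p4⟩, p1, ?_, ?_⟩
    · have := mm_EU (G := G) (σ := σ) U
      omega
    · intro e he
      rcases hK e he with h | h
      · rcases p6 e (hRH h) with h | h
        · exact Or.inl h
        · exact Or.inr (Or.inr h)
      · exact Or.inr (Or.inl h)
  rcases Nat.even_or_odd (T.length + 𝒟.length) with hpar | hpar
  · match T, 𝒟, hctx, hpar, hne, hK, p7 with
    | [], [], hctx, hpar, hne, hK, p7 =>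
      exact caseD0 hB hctx (fun e he => (hK e he).resolve_right (by simp)) (hne rfl) (by rw [← e5, ← p7]; simp)
    | [], [A], hctx, hpar, hne, hK, p7 => simp at hpar
    | [], A :: B :: L, hctx, hpar, hne, hK, p7 => exact caseD2 hctx (by simpa using hpar)
    | [τ], [], hctx, hpar, hne, hK, p7 => simp at hpar
    | [τ], [D], hctx, hpar, hne, hK, p7 => exact caseC1 hctx
    | [τ], A :: B :: L, hctx, hpar, hne, hK, p7 =>
      refine caseC3 hctx ?_
      simp only [List.length_cons, List.length_nil] at *
      obtain ⟨r, hr⟩ := hpar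
      exact ⟨r - 1, by omega⟩
    | τ :: τ' :: T, 𝒟, hctx, hpar, hne, hK, p7 => exact caseB hctx hpar
  · match T, hctx, hpar with
    | [], hctx, hpar => exact caseD1 hctx (by simpa using hpar)
    | τ :: T, hctx, hpar => exact caseA hctx hpar

end Piece
end SCC

open SimpleGraph Set
namespace SCC
open scoped Classical
set_option linter.all false

section Ears
variable {V : Type*} [Fintype V] {G : SimpleGraph V} {σ : Sym2 V → Bool} {U : Finset V}

lemma even_sub_path {u v : V} (p : G.Walk u v) (hp : p.IsPath) : ∀ (Z : Finset (Sym2 V)), Z ⊆ we p → Ev Z → Z = ∅ := by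
  induction p with
  | nil => intro Z hZ _; rw [we_nil] at hZ; exact Finset.subset_empty.1 hZ
  | @cons a b c h p ih =>
    intro Z hZ hev
    rw [Walk.cons_isPath_iff] at hp
    rw [we_cons] at hZ
    refine ih hp.1 Z ?_ hev
    have hnot : s(a, b) ∉ Z := by
      intro hin
      have := hev a
      unfold bd at this
      rw [Finset.sum_eq_single_of_mem _ hin] at this
      · simp at this
      · intro e he hne
        rw [if_neg]
        intro hae
        have := (Finset.mem_insert.1 (hZ he)).resolve_left hne
        rw [mem_we] at this
        exact hp.2 (p.mem_support_of_mem_edges this hae)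
    intro e he
    rcases Finset.mem_insert.1 (hZ he) with rfl | h'
    · exact absurd he hnot
    · exact h'

lemma even_sub_cyc {D Z : Finset (Sym2 V)} (hD : IsCyc G D) (hZ : Z ⊆ D) (hev : Ev Z) (hne : Z.Nonempty) : Z = D := by
  have hevD := hD.ev
  obtain ⟨v, w, hw, rfl⟩ := hD
  cases w with
  | nil => simp at hw
  | @cons _ x _ h p =>
    rw [Walk.cons_isCycle_iff] at hw
    rw [we_cons] at *
    by_cases hin : s(v, x) ∈ Z
    · have := even_sub_path p hw.1 (insert s(v, x) (we p) \ Z) (by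
        intro e he
        rw [Finset.mem_sdiff, Finset.mem_insert] at he
        rcases he.1 with rfl | h'
        · exact absurd hin he.2
        · exact h') (hevD.sdiff hev hZ)
      exact Finset.Subset.antisymm hZ (Finset.sdiff_eq_empty_iff_subset.1 this)
    · have := even_sub_path p hw.1 Z (by
        intro e he
        rcases Finset.mem_insert.1 (hZ he) with rfl | h'
        · exact absurd he hin
        · exact h') hev
      rw [this] at hne; simp at hne

lemma pt_two {u v x : V} (h : pt u x + pt v x = 1) : x = u ∨ x = v := by
  unfold pt at h
  by_contra hc
  push Not at hc
  rw [if_neg hc.1, if_neg hc.2] at h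
  simp at h

lemma path_between {X : Finset (Sym2 V)} (hX : ∀ e ∈ X, e ∈ G.edgeSet) {u v : V} (huv : u ≠ v)
    (hb : ∀ x, bd X x = pt u x + pt v x) : ∃ p : G.Walk u v, p.IsPath ∧ we p ⊆ X := by
  obtain ⟨y, hy, hy1, p, hp, hpX⟩ := odd_path G X hX u (by rw [hb]; simp [pt, huv])
  rw [hb] at hy1
  obtain rfl := (pt_two hy1).resolve_left hy
  exact ⟨p, hp, hpX⟩

lemma ev_union_bd {X Y : Finset (Sym2 V)} (h : Disjoint X Y) (hb : ∀ v, bd X v = bd Y v) : Ev (X ∪ Y) := fun v => by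
  rw [bd_union h, hb, z2_self]

lemma cyc_minus {D : Finset (Sym2 V)} (hD : IsCyc G D) {e : Sym2 V} (he : e ∈ D) :
    ∃ (x y : V) (q : G.Walk x y), q.IsPath ∧ D \ {e} = we q := by
  induction e using Sym2.ind with
  | _ x y =>
    have hadj : G.Adj x y := hD.sub _ he
    have hb : ∀ v, bd (D \ {s(x, y)}) v = pt x v + pt y v := fun v => by
      rw [bd_sdiff (by simpa using he), hD.ev v, zero_add, bd_single x y hadj.ne]
    obtain ⟨q, hq, hqs⟩ := path_between (fun e he => hD.sub e (Finset.mem_sdiff.1 he).1) hadj.ne hb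
    refine ⟨x, y, q, hq, ?_⟩
    have hdis : Disjoint {s(x, y)} (we q) := by
      rw [Finset.disjoint_singleton_left]
      intro h; simpa using hqs h
    have := even_sub_cyc hD (Z := {s(x, y)} ∪ we q) (Finset.union_subset (by simpa using he) (hqs.trans Finset.sdiff_subset))
      (ev_union_bd hdis fun v => by rw [bd_single x y hadj.ne, bd_path q hq]) ⟨s(x, y), by simp⟩
    rw [← this, Finset.union_sdiff_left, Finset.sdiff_eq_self_of_disjoint hdis.symm]

/-- two complementary arcs; one is positive -/
lemma pos_arc {D : Finset (Sym2 V)} (hD : NC G σ D) {a b : V} (hab : a ≠ b) (ha : a ∈ vs D) (hb : b ∈ vs D) :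
    ∃ q : G.Walk b a, q.IsPath ∧ we q ⊆ D ∧ sg σ (we q) = 0 := by
  obtain ⟨q, hq, hqD⟩ := hD.1.walk hb ha
  rcases z2_cases (sg σ (we q)) with h0 | h1
  · exact ⟨q, hq, hqD, h0⟩
  have hb' : ∀ v, bd (D \ we q) v = pt b v + pt a v := fun v => by
    rw [bd_sdiff hqD, hD.1.ev v, zero_add, bd_path q hq]
  obtain ⟨r, hr, hrD⟩ := path_between (fun e he => hD.1.sub e (Finset.mem_sdiff.1 he).1) hab.symm hb'
  have hdis : Disjoint (we q) (we r) := Finset.disjoint_left.2 fun e h1 h2 => (Finset.mem_sdiff.1 (hrD h2)).2 h1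
  have hne : (we q).Nonempty := by
    rw [Finset.nonempty_iff_ne_empty]; rintro h
    rw [h] at h1; simp at h1
  have := even_sub_cyc hD.1 (Z := we q ∪ we r) (Finset.union_subset hqD (hrD.trans Finset.sdiff_subset))
      (ev_union_bd hdis fun v => by rw [bd_path q hq, bd_path r hr]) (hne.mono Finset.subset_union_left)
  refine ⟨r, hr, hrD.trans Finset.sdiff_subset, ?_⟩
  have h2 := hD.2
  rw [← this, sg_union σ hdis, h1] at h2
  simpa using h2

lemma path_len_we {u v : V} (p : G.Walk u v) (hp : p.IsPath) : (we p).card = p.length := by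
  unfold we
  rw [List.toFinset_card_of_nodup hp.isTrail.edges_nodup, p.length_edges]

/-- the positive cycle of an ear -/
lemma ear_cycle {D : Finset (Sym2 V)} (hD : NC G σ D) {a b : V} (hab : a ≠ b) (ha : a ∈ vs D) (hb : b ∈ vs D)
    (p : G.Walk a b) (hp : p.IsPath) (hpD : Disjoint (we p) D) (hinner : ∀ x ∈ p.support, x ∈ vs D → x = a ∨ x = b)
    (hpos : sg σ (we p) = 0) :
    ∃ X, IsCyc G X ∧ sg σ X = 0 ∧ X \ D = we p ∧ X ⊆ we p ∪ D ∧ (∀ v, bd (X ∩ D) v = pt a v + pt b v) ∧ sg σ (X ∩ D) = 0 := by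
  obtain ⟨q, hq, hqD, hq0⟩ := pos_arc hD hab ha hb
  have hqs : ∀ x ∈ q.support, x ∈ vs D := by
    intro x hx
    rw [← mem_vs_we q (by
      intro hn; exact hab hn.eq.symm)] at hx
    exact vs_mono hqD hx
  have hdis : Disjoint (we p) (we q) := Finset.disjoint_of_subset_right hqD hpD
  have hcyc : (p.append q).IsCycle := by
    refine hp.isCycle_append hq ?_ ?_
    · rw [List.disjoint_left]
      intro x hx hx'
      have h1 := List.mem_of_mem_tail hx
      have h2 := List.mem_of_mem_tail hx'
      rcases hinner x h1 (hqs x h2) with rfl | rfl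
      · have := hp.support_nodup
        rw [← p.cons_tail_support] at this
        exact (List.nodup_cons.1 this).1 hx
      · have := hq.support_nodup
        rw [← q.cons_tail_support] at this
        exact (List.nodup_cons.1 this).1 hx'
    · by_contra hc
      push Not at hc
      have l1 : p.length ≠ 0 := fun h => hab (Walk.eq_of_length_eq_zero h)
      have l2 : q.length ≠ 0 := fun h => hab (Walk.eq_of_length_eq_zero h).symm
      have key : ∀ {a b : V} (p : G.Walk a b), p.length = 1 → s(a, b) ∈ we p := by
        intro a b p h
        rw [mem_we]
        cases p with
        | nil => simp at h
        | cons h' p =>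
          cases p with
          | nil => simp
          | cons h'' p => simp at h
      have m1 := key p (by omega)
      have m2 := key q (by omega)
      rw [Sym2.eq_swap] at m2
      exact Finset.disjoint_left.1 hdis m1 m2
  have hXD : (we p ∪ we q) ∩ D = we q := by
    rw [Finset.union_inter_distrib_right, Finset.disjoint_iff_inter_eq_empty.1 hpD, Finset.empty_union,
      Finset.inter_eq_left.2 hqD]
  refine ⟨we p ∪ we q, ⟨a, _, hcyc, (we_append p q).symm⟩, ?_, ?_, Finset.union_subset_union_right hqD, ?_, ?_⟩
  · rw [sg_union σ hdis, hpos, hq0, add_zero]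
  · rw [Finset.union_sdiff_distrib, Finset.sdiff_eq_self_of_disjoint hpD, Finset.sdiff_eq_empty_iff_subset.2 hqD, Finset.union_empty]
  · intro v; rw [hXD, bd_path q hq, add_comm]
  · rw [hXD, hq0]

/-- decomposition into ears -/
lemma ears {D : Finset (Sym2 V)} (hD : NC G σ D) : ∀ (n : ℕ) (Y : Finset (Sym2 V)), Y.card ≤ n → (∀ e ∈ Y, e ∈ G.edgeSet) →
    (∀ e ∈ Y, σ e = false) → Disjoint Y D → (∀ v, bd Y v ≠ 0 → v ∈ vs D) →
    ∃ (L : List (Finset (Sym2 V))) (S : Finset (Sym2 V)),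
      (∀ X ∈ L, IsCyc G X ∧ sg σ X = 0 ∧ X ⊆ Y ∪ D ∧ ∃ a b, ∀ v, bd (X ∩ D) v = pt a v + pt b v) ∧
      (L.map fun X => (X \ D).card).sum ≤ Y.card ∧ S ⊆ D ∧ (∀ v, bd Y v = bd S v) ∧ sg σ S = 0 ∧
      ∀ e ∈ S, ∃ X ∈ L, e ∈ X := by
  intro n
  induction n with
  | zero =>
    intro Y hY _ _ _ _
    have : Y = ∅ := by simpa using hY
    exact ⟨[], ∅, by simp, by simp, by simp, by simp [this], by simp, by simp⟩
  | succ n ih =>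
    intro Y hY hYE hYp hYD hYs
    by_cases hz : ∀ v, bd Y v = 0
    · exact ⟨[], ∅, by simp, by simp, by simp, by simp [hz], by simp, by simp⟩
    push Not at hz
    obtain ⟨u, hu⟩ := hz
    obtain ⟨u', hne, hu', p0, hp0, hp0Y⟩ := odd_path G Y hYE u (z2_ne _ hu)
    have hex : ∃ m, ∃ (a b : V) (p : G.Walk a b), a ≠ b ∧ a ∈ vs D ∧ b ∈ vs D ∧ p.IsPath ∧ we p ⊆ Y ∧ p.length = m :=
      ⟨_, u, u', p0, hne.symm, hYs u hu, hYs u' (by rw [hu']; simp), hp0, hp0Y, rfl⟩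
    obtain ⟨a, b, p, hab, ha, hb, hp, hpY, hlen⟩ := Nat.find_spec hex
    have hmin := fun m => Nat.find_min (H := hex) (m := m)
    rw [← hlen] at hmin
    have hinner : ∀ x ∈ p.support, x ∈ vs D → x = a ∨ x = b := by
      intro x hx hxD
      by_contra hc
      push Not at hc
      refine hmin _ (Walk.length_takeUntil_lt hx hc.2) ⟨a, x, p.takeUntil x hx, hc.1.symm, ha, hxD, hp.takeUntil hx, ?_, rfl⟩
      intro e he
      rw [mem_we] at he
      exact hpY ((mem_we _ _).2 (p.edges_takeUntil_subset_edges hx he))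
    have hpos : sg σ (we p) = 0 := by
      unfold sg
      refine Finset.sum_eq_zero fun e he => ?_
      rw [if_neg]; rw [hYp e (hpY he)]; simp
    obtain ⟨X, x1, x2, x3, x4, x5, x6⟩ := ear_cycle hD hab ha hb p hp (Finset.disjoint_of_subset_left hpY hYD) hinner hpos
    have hpc : 0 < (we p).card := by
      rw [path_len_we p hp]
      rcases Nat.eq_zero_or_pos p.length with h | h
      · exact absurd (Walk.eq_of_length_eq_zero h) hab
      · exact h
    have hcard := Finset.card_sdiff_add_card_eq_card hpY
    obtain ⟨L, S, l1, l2, l3, l4, l5, l6⟩ := ih (Y \ we p) (by omega)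
      (fun e he => hYE e (Finset.mem_sdiff.1 he).1) (fun e he => hYp e (Finset.mem_sdiff.1 he).1)
      (Finset.disjoint_of_subset_left Finset.sdiff_subset hYD) (by
        intro v hv
        by_contra hvD
        rw [bd_sdiff hpY, bd_path p hp] at hv
        have h1 : bd Y v = 0 := by
          by_contra h; exact hvD (hYs v h)
        have h2 : v ≠ a := fun h => hvD (h ▸ ha)
        have h3 : v ≠ b := fun h => hvD (h ▸ hb)
        rw [h1] at hv
        simp [pt, h2, h3] at hv)
    refine ⟨X :: L, symmDiff (X ∩ D) S, ?_, ?_, ?_, ?_, ?_, ?_⟩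
    · intro Z hZ
      rcases List.mem_cons.1 hZ with rfl | hZ
      · exact ⟨x1, x2, x4.trans (Finset.union_subset_union_left hpY), a, b, x5⟩
      · obtain ⟨z1, z2, z3, z4⟩ := l1 Z hZ
        exact ⟨z1, z2, z3.trans (Finset.union_subset_union_left Finset.sdiff_subset), z4⟩
    · simp only [List.map_cons, List.sum_cons]
      rw [x3]; omega
    · intro e he
      rcases Finset.mem_symmDiff.1 he with h | h
      · exact (Finset.mem_inter.1 h.1).2
      · exact l3 h.1
    · intro v
      rw [bd_sd, x5, ← l4, bd_sdiff hpY, bd_path p hp, add_comm (bd Y v), ← add_assoc, z2_self, zero_add]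
    · rw [sg_sd, x6, l5, add_zero]
    · intro e he
      rcases Finset.mem_symmDiff.1 he with h | h
      · exact ⟨X, by simp, (Finset.mem_inter.1 h.1).1⟩
      · obtain ⟨Z, hZ, h'⟩ := l6 e h.1
        exact ⟨Z, by simp [hZ], h'⟩

/-- ears for one negative edge -/
lemma ears_edge (hR : Reg G σ U) {D : Finset (Sym2 V)} (hD : NC G σ D) (hDU : D ⊆ EU G U) {f : Sym2 V}
    (hf : f ∈ NU G σ U) (hfD : f ∈ D) :
    ∃ L : List (Finset (Sym2 V)),
      (∀ X ∈ L, IsCyc G X ∧ sg σ X = 0 ∧ X ⊆ EU G U ∧ ∃ a b, ∀ v, bd (X ∩ D) v = pt a v + pt b v) ∧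
      2 * (L.map fun X => (X \ D).card).sum ≤ mm G σ (PU G σ U \ D) ∧
      ∀ g ∈ NU G σ U, g ∈ D → g ≠ f → ∃ X ∈ L, g ∈ X := by
  obtain ⟨Q, hQ, hb, hc⟩ := avg hR (jn_edges hR {f} (by simpa using NU_sub hf)) (PU G σ U \ D) Finset.sdiff_subset
  have hQD : Q ∩ (PU G σ U \ D) = Q \ D := by
    ext e; simp only [Finset.mem_inter, Finset.mem_sdiff]
    exact ⟨fun h => ⟨h.1, h.2.2⟩, fun h => ⟨h.1, hQ h.1, h.2⟩⟩
  rw [hQD] at hc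
  have hbY : ∀ v, bd (Q \ D) v = bd {f} v + bd (Q ∩ D) v := by
    intro v
    have : Q \ D = Q \ (Q ∩ D) := by simp
    rw [this, bd_sdiff Finset.inter_subset_left, hb]
  have hout : ∀ (X : Finset (Sym2 V)) v, X ⊆ D → v ∉ vs D → bd X v = 0 := by
    intro X v hX hv
    unfold bd
    refine Finset.sum_eq_zero fun e he => if_neg fun h => hv (mem_vs.2 ⟨e, hX he, h⟩)
  obtain ⟨L, S, l1, l2, l3, l4, l5, l6⟩ := ears hD _ (Q \ D) le_rfl (fun e he => PU_edge (hQ (Finset.mem_sdiff.1 he).1))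
    (fun e he => (mem_PU.1 (hQ (Finset.mem_sdiff.1 he).1)).2) Finset.sdiff_disjoint (by
      intro v hv
      by_contra hvD
      rw [hbY, hout _ v (by simpa using hfD) hvD, hout _ v Finset.inter_subset_right hvD] at hv
      simp at hv)
  refine ⟨L, ?_, by omega, ?_⟩
  · intro X hX
    obtain ⟨z1, z2, z3, z4⟩ := l1 X hX
    exact ⟨z1, z2, z3.trans (Finset.union_subset (Finset.sdiff_subset.trans (hQ.trans PU_sub)) hDU), z4⟩
  intro g hg hgD hgf
  have hσf := (mem_NU.1 hf).2
  have hsQ : sg σ (Q ∩ D) = 0 := by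
    unfold sg
    refine Finset.sum_eq_zero fun e he => ?_
    rw [if_neg]; rw [(mem_PU.1 (hQ (Finset.mem_inter.1 he).1)).2]; simp
  have hsf : sg σ {f} = 1 := by unfold sg; rw [Finset.sum_singleton, if_pos hσf]
  set W := symmDiff (symmDiff {f} (Q ∩ D)) S with hW
  have hWev : Ev W := by
    intro v
    rw [hW, bd_sd, bd_sd, ← hbY, l4, z2_self]
  have hWs : sg σ W = 1 := by
    rw [hW, sg_sd, sg_sd, hsf, hsQ, l5]; simp
  have hWD : W ⊆ D := by
    intro e he
    rcases Finset.mem_symmDiff.1 he with h | h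
    · rcases Finset.mem_symmDiff.1 h.1 with h | h
      · rw [Finset.mem_singleton.1 h.1]; exact hfD
      · exact (Finset.mem_inter.1 h.1).2
    · exact l3 h.1
  have hWne : W.Nonempty := by
    rw [Finset.nonempty_iff_ne_empty]; intro h; rw [h] at hWs; simp at hWs
  have hWeq := even_sub_cyc hD.1 hWD hWev hWne
  have hgW : g ∈ W := by rw [hWeq]; exact hgD
  have hgQ : g ∉ Q := fun h => Finset.disjoint_left.1 (PN_disj U) (hQ h) hg
  rcases Finset.mem_symmDiff.1 hgW with h | h
  · exfalso
    rcases Finset.mem_symmDiff.1 h.1 with h | h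
    · exact hgf (Finset.mem_singleton.1 h.1)
    · exact hgQ (Finset.mem_inter.1 h.1).1
  · exact l6 g h.1

end Ears
end SCC

open SimpleGraph Set
namespace SCC
open scoped Classical
set_option linter.all false

section Arcs
variable {V : Type*} [Fintype V] {G : SimpleGraph V} {σ : Sym2 V → Bool} {U : Finset V}

lemma pos_ex {u v : V} (q : G.Walk u v) (x : V) :
    ∃ k : ℕ, ∀ i, (∃ j ≤ i, q.getVert j = x) ↔ (k ≤ i ∧ k ≤ q.length) := by
  by_cases h : ∃ j, q.getVert j = x
  · refine ⟨Nat.find h, fun i => ⟨?_, ?_⟩⟩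
    · rintro ⟨j, hj, hx⟩
      refine ⟨(Nat.find_min' h hx).trans hj, ?_⟩
      by_contra hc
      push Not at hc
      refine Nat.find_min h hc ?_
      rw [Walk.getVert_length]
      have := Nat.find_spec h
      rw [Walk.getVert_of_length_le _ hc.le] at this
      exact this
    · rintro ⟨hi, -⟩
      exact ⟨Nat.find h, hi, Nat.find_spec h⟩
  · refine ⟨q.length + 1, fun i => ⟨?_, ?_⟩⟩
    · rintro ⟨j, hj, hx⟩; exact absurd ⟨j, hx⟩ h
    · rintro ⟨-, h⟩; omega

/-- subsets of a path with two odd vertices are intervals -/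
lemma interval {u v : V} (q : G.Walk u v) (hq : q.IsPath) {B : Finset (Sym2 V)} (hB : B ⊆ we q) {a b : V}
    (hb : ∀ x, bd B x = pt a x + pt b x) :
    ∃ s t : ℕ, ∀ i < q.length, s(q.getVert i, q.getVert (i + 1)) ∈ B ↔ s ≤ i ∧ i < t := by
  obtain ⟨k, hk⟩ := pos_ex q a
  obtain ⟨l, hl⟩ := pos_ex q b
  refine ⟨min k l, max k l, fun i hi => ?_⟩
  let A : Finset V := Finset.univ.filter fun x => ∃ j ≤ i, q.getVert j = x
  have hsum := sum_bd G B (fun e he => we_sub q e (hB he)) A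
  have hcr : ∀ e ∈ we q, Crosses (A : Set V) e ↔ e = s(q.getVert i, q.getVert (i + 1)) := by
    intro e he
    induction e using Sym2.ind with
    | _ x y =>
      rw [mem_we, Walk.mk_mem_edges_iff_exists] at he
      obtain ⟨j, hj, he⟩ := he
      rw [← he, cr_mk]
      have hm : ∀ m ≤ q.length, q.getVert m ∈ (A : Set V) ↔ m ≤ i := by
        intro m hm
        simp only [A, Finset.coe_filter, Finset.mem_univ, true_and, Set.mem_setOf_eq]
        constructor
        · rintro ⟨r, hr, h⟩
          have := hq.getVert_injOn (show r ∈ {i | i ≤ q.length} by simp; omega) (show m ∈ {i | i ≤ q.length} from hm) h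
          omega
        · intro h; exact ⟨m, h, rfl⟩
      rw [hm j (by omega), hm (j + 1) (by omega)]
      constructor
      · intro h
        have : j = i := by omega
        rw [this]
      · intro h
        have h1 : q.getVert j ∈ s(q.getVert i, q.getVert (i + 1)) := h ▸ Sym2.mem_mk_left _ _
        have h2 : q.getVert (j + 1) ∈ s(q.getVert i, q.getVert (i + 1)) := h ▸ Sym2.mem_mk_right _ _
        have inj : ∀ m m', m ≤ q.length → m' ≤ q.length → q.getVert m = q.getVert m' → m = m' :=
          fun m m' h h' e => hq.getVert_injOn h h' e
        rw [Sym2.mem_iff] at h1 h2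
        rcases h1 with h1 | h1 <;> rcases h2 with h2 | h2 <;>
          have e1 := inj _ _ (by omega) (by omega) h1 <;> have e2 := inj _ _ (by omega) (by omega) h2 <;> omega
  have hR : (∑ e ∈ B, if Crosses (A : Set V) e then (1 : ZMod 2) else 0) =
      if s(q.getVert i, q.getVert (i + 1)) ∈ B then 1 else 0 := by
    rw [← Finset.sum_ite_eq' B (s(q.getVert i, q.getVert (i + 1))) (fun _ => (1 : ZMod 2))]
    refine Finset.sum_congr rfl fun e he => ?_
    simp only [hcr e (hB he)]
  rw [hR] at hsum
  simp only [hb, Finset.sum_add_distrib, sum_pt] at hsum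
  have hA : ∀ x, x ∈ A ↔ ∃ j ≤ i, q.getVert j = x := fun x => by simp [A]
  simp only [hA, hk, hl] at hsum
  by_cases h1 : k ≤ i ∧ k ≤ q.length <;> by_cases h2 : l ≤ i ∧ l ≤ q.length <;>
    by_cases h3 : s(q.getVert i, q.getVert (i + 1)) ∈ B <;>
    simp only [h1, h2, h3, if_true, if_false, and_self, true_iff, false_iff] at hsum ⊢ <;>
    first | omega | (exfalso; revert hsum; decide)

lemma three_int (s1 t1 s2 t2 s3 t3 : ℕ) :
    (∀ i, s2 ≤ i ∧ i < t2 → s3 ≤ i ∧ i < t3 → s1 ≤ i ∧ i < t1) ∨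
    (∀ i, s1 ≤ i ∧ i < t1 → s3 ≤ i ∧ i < t3 → s2 ≤ i ∧ i < t2) ∨
    (∀ i, s1 ≤ i ∧ i < t1 → s2 ≤ i ∧ i < t2 → s3 ≤ i ∧ i < t3) := by
  rcases le_total s1 s2 with a | a <;> rcases le_total s2 s3 with b | b <;> rcases le_total s1 s3 with c | c <;>
  rcases le_total t1 t2 with a' | a' <;> rcases le_total t2 t3 with b' | b' <;> rcases le_total t1 t3 with c' | c' <;>
  first
  | (left; intro i h1 h2; omega)
  | (right; left; intro i h1 h2; omega)
  | (right; right; intro i h1 h2; omega)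

/-- three arcs with a common edge: one is in the union of the others -/
lemma three_arcs {D : Finset (Sym2 V)} (hD : IsCyc G D) {e : Sym2 V} {A1 A2 A3 : Finset (Sym2 V)}
    (h1 : A1 ⊆ D) (h2 : A2 ⊆ D) (h3 : A3 ⊆ D) (e1 : e ∈ A1) (e2 : e ∈ A2) (e3 : e ∈ A3)
    (b1 : ∃ a b, ∀ v, bd A1 v = pt a v + pt b v) (b2 : ∃ a b, ∀ v, bd A2 v = pt a v + pt b v)
    (b3 : ∃ a b, ∀ v, bd A3 v = pt a v + pt b v) :
    A1 ⊆ A2 ∪ A3 ∨ A2 ⊆ A1 ∪ A3 ∨ A3 ⊆ A1 ∪ A2 := by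
  obtain ⟨x, y, q, hq, hqe⟩ := cyc_minus hD (h1 e1)
  have key : ∀ A ⊆ D, e ∈ A → (∃ a b, ∀ v, bd A v = pt a v + pt b v) →
      ∃ s t : ℕ, ∀ i < q.length, s(q.getVert i, q.getVert (i + 1)) ∈ D \ A ↔ s ≤ i ∧ i < t := by
    rintro A hA he ⟨a, b, hab⟩
    refine interval q hq (a := a) (b := b) ?_ ?_
    · rw [← hqe]; exact Finset.sdiff_subset_sdiff subset_rfl (by simpa using he)
    · intro v; rw [bd_sdiff hA, hD.ev v, zero_add, hab]
  obtain ⟨s1, t1, k1⟩ := key A1 h1 e1 b1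
  obtain ⟨s2, t2, k2⟩ := key A2 h2 e2 b2
  obtain ⟨s3, t3, k3⟩ := key A3 h3 e3 b3
  have idx : ∀ g ∈ D, g ≠ e → ∃ i < q.length, s(q.getVert i, q.getVert (i + 1)) = g := by
    intro g hg hge
    have : g ∈ we q := by rw [← hqe]; simp [hg, hge]
    rw [mem_we] at this
    induction g using Sym2.ind with
    | _ x y => exact (Walk.mk_mem_edges_iff_exists q).1 this
  have fin : ∀ {A B C : Finset (Sym2 V)} {sa ta sb tb sc tc : ℕ}, A ⊆ D → B ⊆ D → C ⊆ D → e ∈ B →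
      (∀ i < q.length, s(q.getVert i, q.getVert (i + 1)) ∈ D \ A ↔ sa ≤ i ∧ i < ta) →
      (∀ i < q.length, s(q.getVert i, q.getVert (i + 1)) ∈ D \ B ↔ sb ≤ i ∧ i < tb) →
      (∀ i < q.length, s(q.getVert i, q.getVert (i + 1)) ∈ D \ C ↔ sc ≤ i ∧ i < tc) →
      (∀ i, sb ≤ i ∧ i < tb → sc ≤ i ∧ i < tc → sa ≤ i ∧ i < ta) → A ⊆ B ∪ C := by
    intro A B C sa ta sb tb sc tc hA hB hC heB ka kb kc h g hg
    by_cases hge : g = e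
    · rw [hge]; exact Finset.mem_union_left _ heB
    by_contra hc
    rw [Finset.mem_union] at hc
    push Not at hc
    obtain ⟨i, hi, rfl⟩ := idx g (hA hg) hge
    have := (ka i hi).2 (h i ((kb i hi).1 (Finset.mem_sdiff.2 ⟨hA hg, hc.1⟩)) ((kc i hi).1 (Finset.mem_sdiff.2 ⟨hA hg, hc.2⟩)))
    exact (Finset.mem_sdiff.1 this).2 hg
  rcases three_int s1 t1 s2 t2 s3 t3 with h | h | h
  · exact Or.inl (fin h1 h2 h3 e2 k1 k2 k3 h)
  · exact Or.inr (Or.inl (fin h2 h1 h3 e1 k2 k1 k3 h))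
  · exact Or.inr (Or.inr (fin h3 h1 h2 e1 k3 k1 k2 h))

lemma select {ι α : Type*} [DecidableEq ι] [DecidableEq α] (A : ι → Finset α)
    (n : ℕ) : ∀ (I : Finset ι), I.card = n → 
    (∀ e, ∀ i ∈ I, ∀ j ∈ I, ∀ k ∈ I, e ∈ A i → e ∈ A j → e ∈ A k →
      A i ⊆ A j ∪ A k ∨ A j ⊆ A i ∪ A k ∨ A k ⊆ A i ∪ A j) →
    ∃ J ⊆ I, (∀ e, (∃ i ∈ I, e ∈ A i) → ∃ i ∈ J, e ∈ A i) ∧ ∀ e, (J.filter fun i => e ∈ A i).card ≤ 2 := by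
  induction n with
  | zero =>
    intro I hI _
    rw [Finset.card_eq_zero] at hI
    exact ⟨I, subset_rfl, fun e h => h, by simp [hI]⟩
  | succ n ih =>
    intro I hI h3
    by_cases hall : ∀ e, (I.filter fun i => e ∈ A i).card ≤ 2
    · exact ⟨I, subset_rfl, fun e h => h, hall⟩
    push Not at hall
    obtain ⟨e, he⟩ := hall
    obtain ⟨i, j, k, hi, hj, hk, hij, hik, hjk⟩ := Finset.two_lt_card_iff.1 he
    rw [Finset.mem_filter] at hi hj hk
    have red : ∀ a ∈ I, ∀ b ∈ I, ∀ c ∈ I, b ≠ a → c ≠ a → A a ⊆ A b ∪ A c →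
        ∃ J ⊆ I, (∀ e, (∃ i ∈ I, e ∈ A i) → ∃ i ∈ J, e ∈ A i) ∧ ∀ e, (J.filter fun i => e ∈ A i).card ≤ 2 := by
      intro a ha b hb c hc hba hca hsub
      obtain ⟨J, j1, j2, j3⟩ := ih (I.erase a) (by rw [Finset.card_erase_of_mem ha, hI]; rfl)
        (fun e i hi j hj k hk => h3 e i (Finset.mem_of_mem_erase hi) j (Finset.mem_of_mem_erase hj) k (Finset.mem_of_mem_erase hk))
      refine ⟨J, j1.trans (Finset.erase_subset _ _), ?_, j3⟩
      rintro e ⟨i, hi, hei⟩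
      apply j2
      by_cases hia : i = a
      · subst hia
        rcases Finset.mem_union.1 (hsub hei) with h | h
        · exact ⟨b, Finset.mem_erase.2 ⟨hba, hb⟩, h⟩
        · exact ⟨c, Finset.mem_erase.2 ⟨hca, hc⟩, h⟩
      · exact ⟨i, Finset.mem_erase.2 ⟨hia, hi⟩, hei⟩
    rcases h3 e i hi.1 j hj.1 k hk.1 hi.2 hj.2 hk.2 with h | h | h
    · exact red i hi.1 j hj.1 k hk.1 hij.symm hik.symm h
    · exact red j hj.1 i hi.1 k hk.1 hij hjk.symm h
    · exact red k hk.1 i hi.1 j hj.1 hik hjk h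

lemma sum_toFinset_le {α : Type*} [DecidableEq α] (f : α → ℕ) (L : List α) : ∑ x ∈ L.toFinset, f x ≤ (L.map f).sum := by
  induction L with
  | nil => simp
  | cons a L ih =>
    rw [List.toFinset_cons, List.map_cons, List.sum_cons]
    by_cases h : a ∈ L.toFinset
    · rw [Finset.insert_eq_of_mem h]; omega
    · rw [Finset.sum_insert h]; omega

lemma coverD2 (hR : Reg G σ U) {D : Finset (Sym2 V)} (hD : NC G σ D) (hDU : D ⊆ EU G U) {f g : Sym2 V} (hfg : f ≠ g)
    (hf : f ∈ NU G σ U) (hfD : f ∈ D) (hg : g ∈ NU G σ U) (hgD : g ∈ D) :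
    ∃ F : List (Finset (Sym2 V)), (∀ B ∈ F, SC G σ B) ∧ tl F ≤ D.card + mm G σ (EU G U) ∧
      ∀ h ∈ NU G σ U, h ∈ D → ∃ B ∈ F, ∃ C ⊆ B, C ⊆ EU G U ∧ Ev C ∧ h ∈ C := by
  obtain ⟨L1, a1, a2, a3⟩ := ears_edge hR hD hDU hf hfD
  obtain ⟨L2, b1, b2, b3⟩ := ears_edge hR hD hDU hg hgD
  have hL : ∀ X ∈ L1 ++ L2, IsCyc G X ∧ sg σ X = 0 ∧ X ⊆ EU G U ∧ ∃ a b, ∀ v, bd (X ∩ D) v = pt a v + pt b v := by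
    intro X hX
    rcases List.mem_append.1 hX with h | h
    · exact a1 X h
    · exact b1 X h
  have hc := sum_toFinset_le (fun X : Finset (Sym2 V) => (X \ D).card) (L1 ++ L2)
  rw [List.map_append, List.sum_append] at hc
  obtain ⟨J, j1, j2, j3⟩ := select (fun X : Finset (Sym2 V) => X ∩ D) _ (L1 ++ L2).toFinset rfl (by
    intro e i hi j hj k hk h1 h2 h3
    rw [List.mem_toFinset] at hi hj hk
    exact three_arcs hD.1 Finset.inter_subset_right Finset.inter_subset_right Finset.inter_subset_right h1 h2 h3
      (hL i hi).2.2.2 (hL j hj).2.2.2 (hL k hk).2.2.2)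
  have hJ : ∀ X ∈ J, X ∈ L1 ++ L2 := fun X hX => List.mem_toFinset.1 (j1 hX)
  refine ⟨J.toList, ?_, ?_, ?_⟩
  · intro B hB
    have := hL B (hJ B (Finset.mem_toList.1 hB))
    exact sc_pos this.1 this.2.1
  · have e1 : tl J.toList = ∑ X ∈ J, X.card := by
      unfold tl; exact Finset.sum_map_toList J Finset.card
    have e2 : ∑ X ∈ J, X.card = ∑ X ∈ J, (X \ D).card + ∑ X ∈ J, (X ∩ D).card := by
      rw [← Finset.sum_add_distrib]
      exact Finset.sum_congr rfl fun X _ => (Finset.card_sdiff_add_card_inter X D).symm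
    have e3 : ∑ X ∈ J, (X \ D).card ≤ ∑ X ∈ (L1 ++ L2).toFinset, (X \ D).card := Finset.sum_le_sum_of_subset j1
    have e4 : ∑ X ∈ J, (X ∩ D).card ≤ 2 * D.card := by
      have : ∀ X ∈ J, (X ∩ D).card = ∑ e ∈ D, if e ∈ X ∩ D then 1 else 0 := by
        intro X _
        rw [Finset.sum_boole, Nat.cast_id]
        congr 1; ext e; simp only [Finset.mem_inter, Finset.mem_filter]; tauto
      rw [Finset.sum_congr rfl this, Finset.sum_comm]
      calc _ ≤ ∑ e ∈ D, 2 := Finset.sum_le_sum fun e _ => by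
            rw [Finset.sum_boole, Nat.cast_id]; convert j3 e
        _ = 2 * D.card := by simp [mul_comm]
    have q1 : mm G σ (PU G σ U \ D ∪ D) ≤ mm G σ (EU G U) :=
      mm_mono (Finset.union_subset (Finset.sdiff_subset.trans PU_sub) hDU)
    rw [mm_union Finset.sdiff_disjoint] at q1
    have := card_le_mm (G := G) (σ := σ) D
    omega
  · intro h hh hhD
    have : ∃ X ∈ L1 ++ L2, h ∈ X := by
      by_cases hhf : h = f
      · obtain ⟨X, hX, h'⟩ := b3 h hh hhD (by rw [hhf]; exact hfg)
        exact ⟨X, by simp [hX], h'⟩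
      · obtain ⟨X, hX, h'⟩ := a3 h hh hhD hhf
        exact ⟨X, by simp [hX], h'⟩
    obtain ⟨X, hX, h'⟩ := this
    obtain ⟨B, hB, hB'⟩ := j2 h ⟨X, by simpa using hX, Finset.mem_inter.2 ⟨h', hhD⟩⟩
    have := hL B (hJ B hB)
    exact ⟨B, Finset.mem_toList.2 hB, B, subset_rfl, this.2.2.1, this.1.ev, (Finset.mem_inter.1 hB').1⟩

end Arcs
end SCC

open SimpleGraph Set
namespace SCC
open scoped Classical
set_option linter.all false

section SelfL
variable {V : Type*} [Fintype V] {G : SimpleGraph V} {σ : Sym2 V → Bool} {U : Finset V}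

lemma tl_mem {B : Finset (Sym2 V)} {F : List (Finset (Sym2 V))} (h : B ∈ F) : B.card ≤ tl F := by
  have hp := List.perm_cons_erase h
  rw [tl_perm hp, tl_cons]; omega

lemma coverD1 (hR : Reg G σ U) {D : Finset (Sym2 V)} (hD : NC G σ D) (hDU : D ⊆ EU G U) {f g : Sym2 V}
    (hf : f ∈ NU G σ U) (hfD : f ∈ D) (hg : g ∈ NU G σ U) (hgD : g ∉ D) :
    ∃ F : List (Finset (Sym2 V)), (∀ B ∈ F, SC G σ B) ∧ tl F ≤ D.card + mm G σ (EU G U) ∧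
      ∃ B ∈ F, ∃ C ⊆ B, C ⊆ EU G U ∧ Ev C ∧ f ∈ C := by
  have hfg : f ≠ g := fun h => hgD (h ▸ hfD)
  obtain ⟨X, x1, x2, x3, x4, x5⟩ := exH hR {g} (by simpa using hg)
  have hZU : symmDiff D X ⊆ EU G U := fun e he => by
    rcases Finset.mem_symmDiff.1 he with h | h
    · exact hDU h.1
    · exact x1 h.1
  have hZ := hD.1.ev.sd x2
  have hsg : sg σ (symmDiff D X) = 0 := by rw [sg_sd, hD.2, x5]; simp; decide
  obtain ⟨P, 𝒟, h1, h2, h3, h4, h5, h6, h7, h8, h9⟩ := split' (σ := σ) _ hZU hZ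
  have hfZ : f ∈ symmDiff D X := Finset.mem_symmDiff.2 (Or.inl ⟨hfD, fun h => hfg (by simpa using (x3 f hf).1 h)⟩)
  have hcard : (symmDiff D X).card ≤ D.card + X.card := by
    refine (Finset.card_le_card (fun e he => ?_)).trans (Finset.card_union_le D X)
    rcases Finset.mem_symmDiff.1 he with h | h <;> simp [h.1]
  have hm := mm_EU (G := G) (σ := σ) U
  have hn : 1 ≤ (NU G σ U).card := Finset.card_pos.2 ⟨f, hf⟩
  simp only [Finset.card_singleton] at x4
  rcases h6 f hfZ with ⟨B, hB, hfB⟩ | ⟨D1, hD1, hfD1⟩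
  · refine ⟨[B], by simpa using sc_pos (h1 B hB).1 (h1 B hB).2, ?_, B, by simp, B, subset_rfl, (h8 B hB).trans hZU, ?_, hfB⟩
    · have := tl_mem hB
      simp only [tl_cons, tl_nil]; omega
    · exact (h1 B hB).1.ev
  · have hp := List.perm_cons_erase hD1
    generalize 𝒟.erase D1 = L at hp
    have hDL : DL G σ U (D1 :: L) := DL.perm ⟨h2, h3, h4⟩ hp
    rw [hsg, hp.length_eq, ZMod.natCast_eq_zero_iff_even] at h7
    rw [tl_perm hp] at h5
    rcases L with _ | ⟨D2, L⟩
    · simp at h7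
    have hD2 := hDL.nc D2 (by simp)
    obtain ⟨a, ha⟩ := (h2 D1 hD1).1.vne
    obtain ⟨b, hb⟩ := hD2.1.vne
    obtain ⟨w, w1, w2, w3⟩ := avg_path hR (vs_EU (h2 D1 hD1).2 ha) (vs_EU hD2.2 hb) _ subset_rfl
    obtain ⟨B, b1, b2, b3, b4, b5⟩ := barbell (h2 D1 hD1).1 hD2.1 (List.pairwise_cons.1 hDL.sh |>.1 D2 (by simp)) ha hb w
    refine ⟨[B], by simpa using b1, ?_, B, by simp, D1, b2, (h2 D1 hD1).2, (h2 D1 hD1).1.1.ev, hfD1⟩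
    rw [Finset.inter_eq_left.2 w2] at w3
    have : (we w \ (D1 ∪ D2)).card ≤ (we w).card := Finset.card_le_card Finset.sdiff_subset
    simp only [tl_cons, tl_nil] at h5 ⊢
    omega

theorem selfLemma (hR : Reg G σ U) (hB : Bl G U) (hN1 : (NU G σ U).card ≠ 1) :
    ∃ F : List (Finset (Sym2 V)), (∀ B ∈ F, SC G σ B) ∧ 2 * tl F ≤ 3 * mm G σ (EU G U) ∧
      ∀ e ∈ RU G σ U, ∃ B ∈ F, e ∈ B := by
  obtain ⟨H, x1, x2, x3, x4, x5⟩ := exH hR (NU G σ U) subset_rfl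
  have hRH := RU_sub_H hR hB x1 x2 (fun e he => (x3 e he).2 he)
  obtain ⟨P, 𝒟, h1, h2, h3, h4, h5, h6, h7, h8, h9⟩ := split (σ := σ) _ x1 x2
  have hDL : DL G σ U 𝒟 := ⟨h2, h3, h4⟩
  have hm := mm_EU (G := G) (σ := σ) U
  rw [x5, ZMod.natCast_eq_natCast_iff'] at h7
  have even : ∀ 𝒟 : List (Finset (Sym2 V)), DL G σ U 𝒟 → Even 𝒟.length →
      ∃ F, (∀ B ∈ F, SC G σ B) ∧ 2 * tl F ≤ 2 * tl 𝒟 + mm G σ (PU G σ U) ∧ ∀ D ∈ 𝒟, ∀ e ∈ D, ∃ B ∈ F, e ∈ B := by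
    intro 𝒟 hD hev
    rcases 𝒟 with _ | ⟨D, 𝒟⟩
    · exact ⟨[], by simp, by simp, by simp⟩
    obtain ⟨y, -⟩ := (hD.nc D (by simp)).1.vne
    have hf := fam_D (subset_refl U) y _ hD.nc hD.sh
    obtain ⟨F, f1, f2, f3⟩ := fam_even hR hf (by simpa using hev)
    have := cost_app [] y (D :: 𝒟)
    rw [List.nil_append] at this
    rw [this] at f2
    refine ⟨F, f1, by simpa [Src.cost] using f2, fun D' hD' e he => f3 (dsrc y D') (List.mem_map_of_mem hD') e ?_⟩
    exact Finset.mem_union_right _ he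
  rcases Nat.even_or_odd 𝒟.length with hev | hodd
  · obtain ⟨F, f1, f2, f3⟩ := even 𝒟 hDL hev
    refine ⟨P ++ F, sc_app h1 f1, by rw [tl_append]; omega, fun e he => ?_⟩
    rw [in_app]
    rcases h6 e (hRH he) with h | ⟨D, hD, h⟩
    · exact Or.inl h
    · exact Or.inr (f3 D hD e h)
  rcases 𝒟 with _ | ⟨A, _ | ⟨B, L⟩⟩
  · simp at hodd
  · have hA := h2 A (by simp)
    have key : ∃ F : List (Finset (Sym2 V)), (∀ B ∈ F, SC G σ B) ∧ tl F ≤ A.card + mm G σ (EU G U) ∧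
      ∀ h ∈ NU G σ U, h ∈ A → ∃ B ∈ F, ∃ C ⊆ B, C ⊆ EU G U ∧ Ev C ∧ h ∈ C := by
      have hne : ∃ f ∈ NU G σ U, f ∈ A := by
        by_contra hc
        push Not at hc
        have : sg σ A = 0 := Finset.sum_eq_zero fun e he => by
          rw [if_neg]; intro hs; exact hc e (mem_NU.2 ⟨hA.2 he, hs⟩) he
        rw [hA.1.2] at this; exact one_ne_zero this
      obtain ⟨f, hf, hfA⟩ := hne
      by_cases h2 : ∃ g ∈ NU G σ U, g ∈ A ∧ f ≠ g
      · obtain ⟨g, hg, hgA, hfg⟩ := h2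
        exact coverD2 hR hA.1 hA.2 hfg hf hfA hg hgA
      · push Not at h2
        have : ∃ g ∈ NU G σ U, g ∉ A := by
          by_contra hc
          push Not at hc
          refine hN1 (Finset.card_eq_one.2 ⟨f, ?_⟩)
          ext e
          rw [Finset.mem_singleton]
          exact ⟨fun he => (h2 e he (hc e he)).symm, fun he => he ▸ hf⟩
        obtain ⟨g, hg, hgA⟩ := this
        obtain ⟨F, f1, f2, f3⟩ := coverD1 hR hA.1 hA.2 hf hfA hg hgA
        exact ⟨F, f1, f2, fun h hh hhA => by rw [← h2 h hh hhA]; exact f3⟩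
    obtain ⟨F, f1, f2, f3⟩ := key
    refine ⟨P ++ F, sc_app h1 f1, by simp only [tl_append, tl_cons, tl_nil] at h5 ⊢; omega, fun e he => ?_⟩
    rw [in_app]
    rcases h6 e (hRH he) with h | ⟨D, hD, h⟩
    · exact Or.inl h
    right
    rw [List.mem_singleton] at hD
    subst hD
    obtain ⟨he1, he2⟩ := Finset.mem_filter.1 he
    by_cases hs : σ e = true
    · obtain ⟨B, hB, C, hC, -, -, hh⟩ := f3 e (mem_NU.2 ⟨he1, hs⟩) h
      exact ⟨B, hB, hC hh⟩
    · obtain ⟨f, hf, hmt⟩ := mate hR hB e (mem_PU.2 ⟨he1, by simpa using hs⟩) he2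
      obtain ⟨B, hB, C, hC, hCU, hCe, hh⟩ := f3 f hf ((hmt D hA.2 hA.1.1.ev).1 h)
      exact ⟨B, hB, hC ((hmt C hCU hCe).2 hh)⟩
  · obtain ⟨A', B', hp, C, c1, c2, c3⟩ := two_ord hR hDL
    have hDL' := hDL.perm hp
    have hev : Even (B' :: L).length := by
      rw [hp.length_eq, List.length_cons, Nat.odd_add_one, Nat.not_odd_iff_even] at hodd; exact hodd
    obtain ⟨F, f1, f2, f3⟩ := even _ hDL'.tail hev
    rw [tl_perm hp, tl_cons] at h5
    refine ⟨P ++ C :: F, sc_app h1 (by simp only [List.mem_cons, forall_eq_or_imp]; exact ⟨c1, f1⟩),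
      by rw [tl_append, tl_cons]; omega, fun e he => ?_⟩
    rw [in_app]
    rcases h6 e (hRH he) with h | ⟨D, hD, h⟩
    · exact Or.inl h
    right
    rcases List.mem_cons.1 (hp.mem_iff.1 hD) with rfl | hD
    · exact ⟨C, by simp, c2 h⟩
    · obtain ⟨B, hB, h⟩ := f3 D hD e h
      exact ⟨B, List.mem_cons_of_mem _ hB, h⟩

end SelfL
end SCC

open SimpleGraph Set
namespace SCC
open scoped Classical
set_option linter.all false

section Region
variable {V : Type*} [Fintype V] {G : SimpleGraph V} {σ : Sym2 V → Bool} {U : Finset V}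

def Con (G : SimpleGraph V) (U : Finset V) : Prop :=
  ∀ A : Finset V, ∀ u ∈ U, u ∈ A → ∀ v ∈ U, v ∉ A → ∃ e ∈ EU G U, Crosses (A : Set V) e
def Lv (G : SimpleGraph V) (U : Finset V) : Prop :=
  ∀ a b, G.Adj a b → a ∈ U → b ∉ U → ∀ Z : Finset (Sym2 V), (∀ e ∈ Z, e ∈ G.edgeSet) → Ev Z → s(a, b) ∉ Z
def Mn (G : SimpleGraph V) (σ : Sym2 V → Bool) : Prop :=
  ∀ A : Finset V, ((NU G σ Finset.univ).filter fun e => Crosses (A : Set V) e).card ≤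
    ((PU G σ Finset.univ).filter fun e => Crosses (A : Set V) e).card

lemma walk_of_cut {X : Finset (Sym2 V)} (hX : ∀ e ∈ X, e ∈ G.edgeSet) {u v : V}
    (h : ∀ A : Finset V, u ∈ A → v ∉ A → ∃ e ∈ X, Crosses (A : Set V) e) :
    ∃ w : G.Walk u v, we w ⊆ X := by
  let A : Finset V := Finset.univ.filter fun x => ∃ w : G.Walk u x, we w ⊆ X
  have hA : ∀ x, x ∈ A ↔ ∃ w : G.Walk u x, we w ⊆ X := fun x => by simp [A]
  by_contra hc
  obtain ⟨e, he, x, y, rfl, hx, hy⟩ := h A ((hA u).2 ⟨Walk.nil, by simp⟩) (fun hv => hc ((hA v).1 hv))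
  obtain ⟨w, hw⟩ := (hA x).1 (by simpa using hx)
  have hadj : G.Adj x y := hX _ he
  refine hy (by
    rw [Finset.mem_coe, hA]
    refine ⟨w.append (Walk.cons hadj Walk.nil), ?_⟩
    rw [we_append, we_cons, we_nil]
    refine Finset.union_subset hw ?_
    simpa using he)

lemma Con.walk (h : Con G U) {u v : V} (hu : u ∈ U) (hv : v ∈ U) : ∃ w : G.Walk u v, we w ⊆ EU G U :=
  walk_of_cut (fun e he => EU_edge he) fun A h1 h2 => h A u hu h1 v hv h2

lemma to_path {X : Finset (Sym2 V)} {u v : V} (w : G.Walk u v) (hw : we w ⊆ X) :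
    ∃ p : G.Walk u v, p.IsPath ∧ we p ⊆ X := by
  refine ⟨w.bypass, w.bypass_isPath, fun e he => hw ?_⟩
  rw [mem_we] at he ⊢
  exact w.edges_bypass_subset he

lemma ev_restrict (hL : Lv G U) {Z : Finset (Sym2 V)} (hZ : ∀ e ∈ Z, e ∈ G.edgeSet) (hev : Ev Z) :
    Ev (Z.filter fun e => e ∈ EU G U) := by
  intro v
  by_cases hv : v ∈ U
  · rw [← hev v]
    unfold bd
    rw [Finset.sum_filter]
    refine Finset.sum_congr rfl fun e he => ?_
    by_cases hve : v ∈ e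
    · rw [if_pos]
      obtain ⟨b, rfl⟩ := hve
      have hadj : G.Adj v b := hZ _ he
      rw [mem_EU']
      refine ⟨hadj, hv, ?_⟩
      by_contra hb
      exact hL v b hadj hv hb Z hZ hev he
    · simp [hve]
  · refine Finset.sum_eq_zero fun e he => ?_
    rw [if_neg]
    intro hve
    exact hv ((mem_EU.1 (Finset.mem_filter.1 he).2).2 v hve)

lemma reg_of (hM : Mn G σ) (hC : Con G U) (hL : Lv G U) : Reg G σ U := by
  have bal : ∀ A : Finset V, ((NU G σ U).filter fun e => Crosses (A : Set V) e).card ≤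
    ((PU G σ U).filter fun e => Crosses (A : Set V) e).card := by
    intro A
    let A' : Finset V := Finset.univ.filter fun x => ∃ a ∈ U, a ∈ A ∧ ∃ w : G.Walk a x, we w ⊆ (EU G U)ᶜ
    have hA' : ∀ x, x ∈ A' ↔ ∃ a ∈ U, a ∈ A ∧ ∃ w : G.Walk a x, we w ⊆ (EU G U)ᶜ := fun x => by simp [A']
    have hAU : ∀ x ∈ U, (x ∈ A' ↔ x ∈ A) := by
      intro x hx
      constructor
      · intro hxA
        obtain ⟨a, haU, haA, w, hw⟩ := (hA' x).1 hxA
        by_contra hxn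
        obtain ⟨p, hp, hpX⟩ := to_path w hw
        obtain ⟨w', hw'⟩ := hC.walk haU hx
        obtain ⟨q, hq, hqX⟩ := to_path w' hw'
        cases p with
        | nil => exact hxn haA
        | @cons _ b _ hab p =>
          have hbU : b ∉ U := by
            intro hb
            have : s(a, b) ∈ (EU G U)ᶜ := hpX (by rw [we_cons]; exact Finset.mem_insert_self _ _)
            rw [Finset.mem_compl, mem_EU'] at this
            exact this ⟨hab, haU, hb⟩
          refine hL a b hab haU hbU (symmDiff (we (Walk.cons hab p)) (we q)) ?_ ?_ ?_
          · intro e he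
            rcases Finset.mem_symmDiff.1 he with h | h
            · exact we_sub _ e h.1
            · exact we_sub _ e h.1
          · intro v; rw [bd_sd, bd_path _ hp, bd_path _ hq, z2_self]
          · refine Finset.mem_symmDiff.2 (Or.inl ⟨by rw [we_cons]; exact Finset.mem_insert_self _ _, fun h => hbU ?_⟩)
            exact (mem_EU'.1 (hqX h)).2.2
      · intro hxA; exact (hA' x).2 ⟨x, hx, hxA, Walk.nil, by simp⟩
    refine (Finset.card_le_card ?_).trans ((hM A').trans (Finset.card_le_card ?_))
    · intro e he
      obtain ⟨he, x, y, rfl, hx, hy⟩ := Finset.mem_filter.1 he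
      obtain ⟨he1, he2⟩ := mem_NU.1 he
      obtain ⟨h1, h2, h3⟩ := mem_EU'.1 he1
      refine Finset.mem_filter.2 ⟨mem_NU.2 ⟨mem_EU'.2 ⟨h1, by simp, by simp⟩, he2⟩, x, y, rfl, ?_, ?_⟩
      · exact (hAU x h2).2 hx
      · exact fun h => hy ((hAU y h3).1 h)
    · intro e he
      obtain ⟨he, x, y, rfl, hx, hy⟩ := Finset.mem_filter.1 he
      obtain ⟨he1, he2⟩ := mem_PU.1 he
      have hadj := (mem_EU'.1 he1).1
      have hEU : s(x, y) ∈ EU G U := by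
        by_contra hn
        obtain ⟨a, haU, haA, w, hw⟩ := (hA' x).1 (by simpa using hx)
        refine hy ?_
        rw [Finset.mem_coe, hA']
        refine ⟨a, haU, haA, w.append (Walk.cons hadj Walk.nil), ?_⟩
        rw [we_append, we_cons, we_nil]
        refine Finset.union_subset hw ?_
        simpa using hn
      obtain ⟨h1, h2, h3⟩ := mem_EU'.1 hEU
      refine Finset.mem_filter.2 ⟨mem_PU.2 ⟨hEU, he2⟩, x, y, rfl, ?_, ?_⟩
      · exact (hAU x h2).1 hx
      · exact fun h => hy ((hAU y h3).2 h)
  refine ⟨?_, ?_, bal⟩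
  · intro u hu v hv
    obtain ⟨w, hw⟩ := walk_of_cut (G := G) (X := PU G σ U) (u := u) (v := v) (fun e he => PU_edge he) (by
      intro A h1 h2
      obtain ⟨e, he, hcr⟩ := hC A u hu h1 v hv h2
      by_contra hc
      push Not at hc
      have hb := bal A
      have : ((PU G σ U).filter fun e => Crosses (A : Set V) e) = ∅ := Finset.filter_eq_empty_iff.2 fun e he => hc e he
      rw [this, Finset.card_empty] at hb
      have h0 := Finset.card_eq_zero.1 (Nat.le_zero.1 hb)
      rw [EU_eq (σ := σ) U] at he
      rcases Finset.mem_union.1 he with h | h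
      · exact hc e h hcr
      · exact Finset.filter_eq_empty_iff.1 h0 h hcr)
    obtain ⟨p, hp, hpX⟩ := to_path w hw
    exact ⟨we p, hpX, fun x => bd_path p hp x⟩
  · intro e he hw
    unfold wt at hw
    split_ifs at hw with h
    · obtain ⟨Z, hZ, hev, heZ⟩ := h
      refine ⟨Z.filter fun e => e ∈ EU G U, ?_, ev_restrict hL (fun e he => (hZ e he).1) hev, ?_⟩
      · intro f hf
        obtain ⟨h1, h2⟩ := Finset.mem_filter.1 hf
        exact mem_PU.2 ⟨h2, (hZ f h1).2⟩
      · exact Finset.mem_filter.2 ⟨heZ, PU_sub he⟩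
    · omega

/-- A one-edge cut inside the region `U` : the part `W`, edge `x z`, `z ∈ W`. -/
structure Cut1 (G : SimpleGraph V) (U W : Finset V) (x z : V) : Prop where
  sub : W ⊆ U
  adj : G.Adj x z
  hx : x ∈ U
  hxW : x ∉ W
  hz : z ∈ W
  uniq : ∀ a b, G.Adj a b → a ∈ U → a ∉ W → b ∈ W → a = x ∧ b = z

lemma exists_cut1 (h : ¬ Bl G U) : ∃ W x z, Cut1 G U W x z := by
  unfold Bl at h
  push Not at h
  obtain ⟨A, hA⟩ := h
  obtain ⟨e, he⟩ := Finset.card_eq_one.1 hA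
  have hm : ∀ f, f ∈ EU G U → Crosses (A : Set V) f → f = e := fun f h1 h2 => by
    have : f ∈ ({e} : Finset (Sym2 V)) := he ▸ Finset.mem_filter.2 ⟨h1, h2⟩
    simpa using this
  have hee : e ∈ (EU G U).filter fun e => Crosses (A : Set V) e := by rw [he]; simp
  obtain ⟨he1, z, x, rfl, hz, hx⟩ := Finset.mem_filter.1 hee
  obtain ⟨h1, h2, h3⟩ := mem_EU'.1 he1
  refine ⟨U ∩ A, x, z, Finset.inter_subset_left, h1.symm, h3, fun h => hx (Finset.mem_inter.1 h).2,
    Finset.mem_inter.2 ⟨h2, hz⟩, ?_⟩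
  intro a b hab ha haW hb
  obtain ⟨hbU, hbA⟩ := Finset.mem_inter.1 hb
  have haA : a ∉ A := fun h => haW (Finset.mem_inter.2 ⟨ha, h⟩)
  have := hm s(b, a) (mem_EU'.2 ⟨hab.symm, hbU, ha⟩) ⟨b, a, rfl, hbA, haA⟩
  rcases Sym2.eq_iff.1 this with ⟨h, h'⟩ | ⟨h, h'⟩
  · exact ⟨h', h⟩
  · exact absurd (h ▸ hbA) hx

variable {W : Finset V} {x z : V}

lemma Cut1.symm (h : Cut1 G U W x z) : Cut1 G U (U \ W) z x where
  sub := Finset.sdiff_subset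
  adj := h.adj.symm
  hx := h.sub h.hz
  hxW := fun hh => (Finset.mem_sdiff.1 hh).2 h.hz
  hz := Finset.mem_sdiff.2 ⟨h.hx, h.hxW⟩
  uniq := by
    intro a b hab ha haW hb
    obtain ⟨h1, h2⟩ := Finset.mem_sdiff.1 hb
    have haW' : a ∈ W := by
      by_contra hn; exact haW (Finset.mem_sdiff.2 ⟨ha, hn⟩)
    exact (h.uniq b a hab.symm h1 h2 haW').symm

lemma Cut1.con (h : Cut1 G U W x z) (hC : Con G U) : Con G W := by
  intro A u hu huA v hv hvA
  by_contra hc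
  push Not at hc
  have hno : ∀ a b, G.Adj a b → a ∈ W → b ∈ W → (a ∈ A ↔ b ∈ A) := by
    intro a b hab ha hb
    have := hc s(a, b) (mem_EU'.2 ⟨hab, ha, hb⟩)
    rw [cr_mk] at this
    push Not at this
    simpa using this
  have key : ∀ B : Finset V, B ⊆ W → B.Nonempty → z ∉ B → (∀ a b, G.Adj a b → a ∈ W → b ∈ W → (a ∈ B ↔ b ∈ B)) → False := by
    rintro B hBW ⟨b, hb⟩ hzB hB
    obtain ⟨e, he, p, q, rfl, hp, hq⟩ := hC B b (h.sub (hBW hb)) hb x h.hx (fun hx => h.hxW (hBW hx))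
    obtain ⟨k1, k2, k3⟩ := mem_EU'.1 he
    by_cases hqW : q ∈ W
    · exact hq ((hB p q k1 (hBW hp) hqW).1 hp)
    · have := (h.uniq q p k1.symm k3 hqW (hBW hp)).2
      exact hzB (this ▸ hp)
  by_cases hzA : z ∈ A
  · exact key (W \ A) Finset.sdiff_subset ⟨v, by simp [hv, hvA]⟩ (by simp [hzA]) (fun a b hab ha hb => by
      simp [ha, hb, hno a b hab ha hb])
  · exact key (W ∩ A) Finset.inter_subset_left ⟨u, by simp [hu, huA]⟩ (by simp [hzA]) (fun a b hab ha hb => by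
      simp [ha, hb, hno a b hab ha hb])

lemma Cut1.noev (h : Cut1 G U W x z) (hL : Lv G U) (Z : Finset (Sym2 V)) (hZ : ∀ e ∈ Z, e ∈ G.edgeSet) (hev : Ev Z) :
    s(x, z) ∉ Z := by
  intro he
  have h1 := even_cut (G := G) (Z := Z.filter fun e => e ∈ EU G U) (fun e he => hZ e (Finset.mem_filter.1 he).1)
    (ev_restrict hL hZ hev) W
  have : ((Z.filter fun e => e ∈ EU G U).filter fun e => Crosses (W : Set V) e) = {s(x, z)} := by
    ext e
    rw [Finset.mem_filter, Finset.mem_filter, Finset.mem_singleton]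
    constructor
    · rintro ⟨⟨h1, h2⟩, p, q, rfl, hp, hq⟩
      obtain ⟨k1, k2, k3⟩ := mem_EU'.1 h2
      obtain ⟨rfl, rfl⟩ := h.uniq q p k1.symm k3 hq hp
      exact Sym2.eq_swap
    · rintro rfl
      exact ⟨⟨he, mem_EU'.2 ⟨h.adj, h.hx, h.sub h.hz⟩⟩, z, x, Sym2.eq_swap, h.hz, h.hxW⟩
  rw [this] at h1
  simp at h1

lemma Cut1.lv (h : Cut1 G U W x z) (hL : Lv G U) : Lv G W := by
  intro a b hab ha hb Z hZ hev
  by_cases hbU : b ∈ U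
  · obtain ⟨rfl, rfl⟩ := h.uniq b a hab.symm hbU hb ha
    rw [Sym2.eq_swap]
    exact h.noev hL Z hZ hev
  · exact hL a b hab (h.sub ha) hbU Z hZ hev

lemma Cut1.wt (h : Cut1 G U W x z) (hL : Lv G U) : wt G σ s(x, z) = 2 := by
  unfold SCC.wt
  rw [if_neg]
  rintro ⟨Z, hZ, hev, he⟩
  exact h.noev hL Z (fun e he => (hZ e he).1) hev he

lemma Cut1.edge (h : Cut1 G U W x z) {e : Sym2 V} (he : e ∈ EU G U) :
    e ∈ EU G W ∨ e ∈ EU G (U \ W) ∨ e = s(x, z) := by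
  induction e using Sym2.ind with
  | _ a b =>
  obtain ⟨k1, k2, k3⟩ := mem_EU'.1 he
  by_cases ha : a ∈ W <;> by_cases hb : b ∈ W
  · exact Or.inl (mem_EU'.2 ⟨k1, ha, hb⟩)
  · obtain ⟨rfl, rfl⟩ := h.uniq b a k1.symm k3 hb ha
    exact Or.inr (Or.inr Sym2.eq_swap)
  · obtain ⟨rfl, rfl⟩ := h.uniq a b k1 k2 ha hb
    exact Or.inr (Or.inr rfl)
  · exact Or.inr (Or.inl (mem_EU'.2 ⟨k1, by simp [k2, ha], by simp [k3, hb]⟩))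

lemma Cut1.ru (h : Cut1 G U W x z) {e : Sym2 V} (he : e ∈ RU G σ U) :
    e ∈ RU G σ W ∨ e ∈ RU G σ (U \ W) ∨ e = s(x, z) := by
  obtain ⟨h1, h2⟩ := Finset.mem_filter.1 he
  rcases h.edge h1 with h | h | h
  · exact Or.inl (Finset.mem_filter.2 ⟨h, h2⟩)
  · exact Or.inr (Or.inl (Finset.mem_filter.2 ⟨h, h2⟩))
  · exact Or.inr (Or.inr h)

lemma Cut1.mm (h : Cut1 G U W x z) (hL : Lv G U) :
    mm G σ (EU G W) + mm G σ (EU G (U \ W)) + 2 ≤ mm G σ (EU G U) := by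
  have d1 : Disjoint (EU G W) (EU G (U \ W)) := by
    rw [Finset.disjoint_left]
    intro e h1 h2
    induction e using Sym2.ind with
    | _ a b => exact (Finset.mem_sdiff.1 (mem_EU'.1 h2).2.1).2 (mem_EU'.1 h1).2.1
  have d2 : Disjoint (EU G W ∪ EU G (U \ W)) {s(x, z)} := by
    rw [Finset.disjoint_singleton_right, Finset.mem_union, mem_EU', mem_EU']
    rintro (⟨-, k, -⟩ | ⟨-, -, k⟩)
    · exact h.hxW k
    · exact (Finset.mem_sdiff.1 k).2 h.hz
  have := mm_mono (G := G) (σ := σ) (X := EU G W ∪ EU G (U \ W) ∪ {s(x, z)}) (Y := EU G U) (by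
    intro e he
    rw [Finset.mem_union, Finset.mem_union, Finset.mem_singleton] at he
    rcases he with (he | he) | rfl
    · exact mem_EU.2 ⟨EU_edge he, fun v hv => h.sub ((mem_EU.1 he).2 v hv)⟩
    · exact mem_EU.2 ⟨EU_edge he, fun v hv => (Finset.mem_sdiff.1 ((mem_EU.1 he).2 v hv)).1⟩
    · exact mem_EU'.2 ⟨h.adj, h.hx, h.sub h.hz⟩)
  rw [mm_union d2, mm_union d1] at this
  have e : SCC.mm G σ {s(x, z)} = 2 := by unfold SCC.mm; rw [Finset.sum_singleton, h.wt hL]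
  omega

/-- `S` is attached to the rest by the single edge `x z`. -/
def ES (G : SimpleGraph V) (S : Finset V) (x z : V) : Prop := ∀ a b, G.Adj a b → a ∉ S → b ∈ S → a = x ∧ b = z

lemma ES.walk {S : Finset V} (h : ES G S x z) {a b : V} (w : G.Walk a b) (ha : a ∉ S) (hb : b ∈ S) :
    s(x, z) ∈ we w ∧ x ∈ w.support ∧ z ∈ w.support := by
  induction w with
  | nil => exact absurd hb ha
  | @cons a c b hac w ih =>
    rw [we_cons, Walk.support_cons]
    by_cases hc : c ∈ S
    · obtain ⟨rfl, rfl⟩ := h a c hac ha hc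
      exact ⟨by simp, by simp, by simp⟩
    · obtain ⟨i1, i2, i3⟩ := ih hc hb
      exact ⟨Finset.mem_insert_of_mem i1, List.mem_cons_of_mem _ i2, List.mem_cons_of_mem _ i3⟩

lemma ES.gate {S : Finset V} (h : ES G S x z) : Gate G S x := fun a b w ha hb => (h.walk w ha hb).2.1

lemma ES.cov {S : Finset V} (h : ES G S x z) {C : Finset (Sym2 V)} (hC : vs C ⊆ S) {e : Sym2 V} (hc : Cov G z C e)
    {a : V} (ha : a ∉ S) : Cov G a C e := by
  intro b hb w
  have hz := (h.walk w ha (hC hb)).2.2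
  have := hc b hb (w.dropUntil z hz)
  rw [mem_we] at this ⊢
  exact w.edges_dropUntil_subset hz this

lemma ES.cov' {S : Finset V} (h : ES G S x z) {C : Finset (Sym2 V)} (hC : vs C ⊆ S)
    {a : V} (ha : a ∉ S) : Cov G a C s(x, z) := fun b hb w => (h.walk w ha (hC hb)).1

end Region
end SCC

open SimpleGraph Set
namespace SCC
open scoped Classical
set_option linter.all false

section Rec
variable {V : Type*} [Fintype V] {G : SimpleGraph V} {σ : Sym2 V → Bool} {U W S : Finset V} {x y z : V}

/-- every one-edge cut has negative edges on each side -/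
def F2 (G : SimpleGraph V) (σ : Sym2 V → Bool) : Prop :=
  ∀ (A : Finset V) x z, G.Adj x z → x ∉ A → z ∈ A → ES G A x z → (NU G σ A).Nonempty

lemma PP.mono {M M' : ℕ} {K : Finset (Sym2 V)} (h : PP G σ S y M K) (hM : M ≤ M') : PP G σ S y M' K := by
  obtain ⟨c1, c2, h1, h2, h3, h4⟩ := h
  exact ⟨c1, c2, h1, h2, by omega, by omega⟩

lemma sum_filter_list {α : Type*} (p : α → Prop) [DecidablePred p] (f : α → ℕ) (T : List α) :
    ((T.filter fun t => p t).map f).sum + ((T.filter fun t => ¬ p t).map f).sum = (T.map f).sum := by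
  induction T with
  | nil => simp
  | cons a T ih =>
    by_cases h : p a <;> simp [h] at ih ⊢ <;> omega

lemma newTerm (hES : ES G S x z) (hadj : G.Adj x z) (hx : x ∈ U) (hxS : x ∉ S) (hd : Disjoint S U) {M : ℕ} {K : Finset (Sym2 V)}
    (h : PP G σ S z M K) : ∃ τ : Term V, τ.x = x ∧ τ.S = S ∧ τ.M = M + 2 ∧ τ.K = insert s(x, z) K ∧ τ.Ok G σ U := by
  obtain ⟨c1, c2, ⟨F, a, C, p1, p2, p3, p4, p5⟩, ⟨F', b, D, b', D', q1, q2, q3, q4, q5, q6, q7⟩, h3, h4⟩ := h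
  have hw : (we (Walk.cons hadj (Walk.nil : G.Walk z z))).card = 1 := by rw [we_cons, we_nil]; simp
  refine ⟨⟨x, S, M + 2, insert s(x, z) K, c1 + 1, c2 + 2⟩, rfl, rfl, rfl, rfl, hx, hd, hES.gate, ?_, ?_, ?_, ?_⟩
  · refine ⟨F, a + 1, C, p1, hw ▸ p2.ext (Walk.cons hadj Walk.nil), p3, ?_, ?_⟩
    · show tl F + (a + 1) ≤ c1 + 1
      omega
    · intro e he
      rcases Finset.mem_insert.1 he with rfl | he
      · exact Or.inr (Or.inr (hES.cov' p3 hxS))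
      · rcases p5 e he with h | h | h
        · exact Or.inl h
        · exact Or.inr (Or.inl h)
        · exact Or.inr (Or.inr (hES.cov p3 h hxS))
  · refine ⟨F', b + 1, D, b' + 1, D', q1, hw ▸ q2.ext (Walk.cons hadj Walk.nil), q3, hw ▸ q4.ext (Walk.cons hadj Walk.nil), q5, ?_, ?_⟩
    · show tl F' + (b + 1) + (b' + 1) ≤ c2 + 2
      omega
    · intro e he
      rcases Finset.mem_insert.1 he with rfl | he
      · exact Or.inr (Or.inl (Or.inr (hES.cov' q3 hxS)))
      · rcases q7 e he with h | (h | h) | (h | h)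
        · exact Or.inl h
        · exact Or.inr (Or.inl (Or.inl h))
        · exact Or.inr (Or.inl (Or.inr (hES.cov q3 h hxS)))
        · exact Or.inr (Or.inr (Or.inl h))
        · exact Or.inr (Or.inr (Or.inr (hES.cov q5 h hxS)))
  · show 2 * (c1 + 1) ≤ 3 * (M + 2)
    omega
  · show c1 + 1 + (c2 + 2) ≤ 3 * (M + 2)
    omega

lemma Term.Ok.only {τ : Term V} (h : τ.Ok G σ U) {a b : V} (hab : G.Adj a b) (ha : a ∉ τ.S) (hb : b ∈ τ.S) : a = τ.x := by
  have := h.gate a b (Walk.cons hab Walk.nil) ha hb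
  rw [Walk.support_cons, Walk.support_nil] at this
  simp only [List.mem_cons, List.not_mem_nil, or_false] at this
  rcases this with h' | h'
  · exact h'.symm
  · exact absurd (h' ▸ h.hx) (Finset.disjoint_left.1 h.hd hb)

lemma Term.Ok.mono {τ : Term V} (h : τ.Ok G σ U) (hW : W ⊆ U) (hx : τ.x ∈ W) : τ.Ok G σ W :=
  ⟨hx, h.hd.mono_right hW, h.gate, h.p1, h.p2, h.b1, h.b2⟩

theorem treeRec (hM : Mn G σ) (hF2 : F2 G σ) (n : ℕ) : ∀ (U : Finset V), U.card ≤ n → ∀ (y : V), y ∈ U → Con G U → Lv G U →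
    ∀ (S : Finset V) (T : List (Term V)), TL G σ U S T → U ⊆ S → (T = [] → (NU G σ U).Nonempty) →
    (∀ a b, G.Adj a b → a ∈ U → b ∉ U → a = y ∨ ∃ τ ∈ T, b ∈ τ.S) →
    ∀ K : Finset (Sym2 V), (∀ e ∈ K, e ∈ RU G σ U ∨ ∃ τ ∈ T, e ∈ τ.K) →
    PP G σ S y (mm G σ (EU G U) + (T.map Term.M).sum) K := by
  induction n with
  | zero =>
    intro U hU y hy
    rw [Finset.card_eq_zero.1 (Nat.le_zero.1 hU)] at hy
    simp at hy
  | succ n ih =>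
    intro U hU y hy hC hL S T hT hUS hne hout K hK
    by_cases hB : Bl G U
    · exact piece (reg_of hM hC hL) hB hUS hy T hT hne hK
    have hcut : ∃ W x z, Cut1 G U W x z ∧ y ∉ W := by
      obtain ⟨W, x, z, h⟩ := exists_cut1 hB
      by_cases hyW : y ∈ W
      · exact ⟨_, _, _, h.symm, fun hh => (Finset.mem_sdiff.1 hh).2 hyW⟩
      · exact ⟨W, x, z, h, hyW⟩
    obtain ⟨W, x, z, hcut, hyW⟩ := hcut
    have cW : W.card < U.card := Finset.card_lt_card ⟨hcut.sub, fun h => hcut.hxW (h hcut.hx)⟩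
    have cW' : (U \ W).card < U.card :=
      Finset.card_lt_card ⟨Finset.sdiff_subset, fun h => (Finset.mem_sdiff.1 (h (hcut.sub hcut.hz))).2 hcut.hz⟩
    -- terminals at `W` and outside
    set T1 := T.filter fun τ => τ.x ∈ W with hT1
    set T2 := T.filter fun τ => ¬ τ.x ∈ W with hT2
    have m1 : ∀ τ, τ ∈ T1 ↔ τ ∈ T ∧ τ.x ∈ W := fun τ => by simp [hT1]
    have m2 : ∀ τ, τ ∈ T2 ↔ τ ∈ T ∧ τ.x ∉ W := fun τ => by simp [hT2]
    let S1 : Finset V := Finset.univ.filter fun v => v ∈ W ∨ ∃ τ ∈ T1, v ∈ τ.S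
    have hS1 : ∀ v, v ∈ S1 ↔ v ∈ W ∨ ∃ τ ∈ T1, v ∈ τ.S := fun v => by simp [S1]
    have hES : ES G S1 x z := by
      intro a b hab ha hb
      have haW : a ∉ W := fun h => ha ((hS1 a).2 (Or.inl h))
      rcases (hS1 b).1 hb with hb | ⟨τ, hτ, hb⟩
      · by_cases haU : a ∈ U
        · exact hcut.uniq a b hab haU haW hb
        · rcases hout b a hab.symm (hcut.sub hb) haU with rfl | ⟨τ, hτ, haτ⟩
          · exact absurd hb hyW
          · have := (hT.ok τ hτ).only hab.symm (fun h => Finset.disjoint_left.1 (hT.ok τ hτ).hd h (hcut.sub hb)) haτ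
            exact absurd ((hS1 a).2 (Or.inr ⟨τ, (m1 τ).2 ⟨hτ, this ▸ hb⟩, haτ⟩)) ha
      · obtain ⟨hτT, hτx⟩ := (m1 τ).1 hτ
        have haτ : a ∉ τ.S := fun h => ha ((hS1 a).2 (Or.inr ⟨τ, hτ, h⟩))
        have := (hT.ok τ hτT).only hab haτ hb
        exact absurd (this ▸ hτx) haW
    have hd1 : Disjoint S1 (U \ W) := by
      rw [Finset.disjoint_left]
      intro v hv hv'
      obtain ⟨k1, k2⟩ := Finset.mem_sdiff.1 hv'
      rcases (hS1 v).1 hv with h | ⟨τ, hτ, h⟩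
      · exact k2 h
      · exact Finset.disjoint_left.1 (hT.ok τ ((m1 τ).1 hτ).1).hd h k1
    have hx' : x ∈ U \ W := Finset.mem_sdiff.2 ⟨hcut.hx, hcut.hxW⟩
    have hxS1 : x ∉ S1 := fun h => Finset.disjoint_left.1 hd1 h hx'
    let K1 : Finset (Sym2 V) := Finset.univ.filter fun e => e ∈ RU G σ W ∨ ∃ τ ∈ T1, e ∈ τ.K
    have hK1 : ∀ e, e ∈ K1 ↔ e ∈ RU G σ W ∨ ∃ τ ∈ T1, e ∈ τ.K := fun e => by simp [K1]
    have P1 := ih W (by omega) z hcut.hz (hcut.con hC) (hcut.lv hL) S1 T1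
      ⟨fun τ hτ => (hT.ok τ ((m1 τ).1 hτ).1).mono hcut.sub ((m1 τ).1 hτ).2,
        fun τ hτ v hv => (hS1 v).2 (Or.inr ⟨τ, hτ, hv⟩), hT.dj.filter _⟩
      (fun v hv => (hS1 v).2 (Or.inl hv))
      (by
        intro h0
        refine hF2 W x z hcut.adj hcut.hxW hcut.hz ?_
        have : S1 = W := by
          ext v; rw [hS1, h0]; simp
        exact this ▸ hES)
      (by
        intro a b hab ha hb
        by_cases hbU : b ∈ U
        · exact Or.inl (hcut.uniq b a hab.symm hbU hb ha).2
        · rcases hout a b hab (hcut.sub ha) hbU with rfl | ⟨τ, hτ, hbτ⟩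
          · exact absurd ha hyW
          · have := (hT.ok τ hτ).only hab (fun h => Finset.disjoint_left.1 (hT.ok τ hτ).hd h (hcut.sub ha)) hbτ
            exact Or.inr ⟨τ, (m1 τ).2 ⟨hτ, this ▸ ha⟩, hbτ⟩)
      K1 (fun e he => (hK1 e).1 he)
    obtain ⟨τ0, t1, t2, t3, t4, t5⟩ := newTerm (U := U \ W) hES hcut.adj hx' hxS1 hd1 P1
    have hTne : ∀ τ ∈ T1, ∀ τ' ∈ T2, Disjoint τ.S τ'.S := by
      intro τ hτ τ' hτ'
      have hne : τ ≠ τ' := fun h => ((m2 τ').1 hτ').2 (h ▸ ((m1 τ).1 hτ).2)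
      haveI : Std.Symm (fun a b : Term V => Disjoint a.S b.S) := ⟨fun a b h => h.symm⟩
      exact hT.dj.forall ((m1 τ).1 hτ).1 ((m2 τ').1 hτ').1 hne
    have P2 := ih (U \ W) (by omega) y (Finset.mem_sdiff.2 ⟨hy, hyW⟩) (hcut.symm.con hC) (hcut.symm.lv hL) S (τ0 :: T2)
      ⟨by
        intro τ hτ
        rcases List.mem_cons.1 hτ with rfl | hτ
        · exact t5
        · obtain ⟨k1, k2⟩ := (m2 τ).1 hτ
          exact (hT.ok τ k1).mono Finset.sdiff_subset (Finset.mem_sdiff.2 ⟨(hT.ok τ k1).hx, k2⟩),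
       by
        intro τ hτ
        rcases List.mem_cons.1 hτ with rfl | hτ
        · rw [t2]
          intro v hv
          rcases (hS1 v).1 hv with h | ⟨τ', hτ', h⟩
          · exact hUS (hcut.sub h)
          · exact hT.sub τ' ((m1 τ').1 hτ').1 h
        · exact hT.sub τ ((m2 τ).1 hτ).1,
       by
        rw [List.pairwise_cons]
        refine ⟨?_, hT.dj.filter _⟩
        intro τ hτ
        rw [t2, Finset.disjoint_left]
        intro v hv hv'
        rcases (hS1 v).1 hv with h | ⟨τ', hτ', h⟩
        · exact Finset.disjoint_left.1 (hT.ok τ ((m2 τ).1 hτ).1).hd hv' (hcut.sub h)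
        · exact Finset.disjoint_left.1 (hTne τ' hτ' τ hτ) h hv'⟩
      (Finset.sdiff_subset.trans hUS) (fun h => by simp at h)
      (by
        intro a b hab ha hb
        obtain ⟨haU, haW⟩ := Finset.mem_sdiff.1 ha
        by_cases hbU : b ∈ U
        · have hbW : b ∈ W := by
            by_contra hn; exact hb (Finset.mem_sdiff.2 ⟨hbU, hn⟩)
          exact Or.inr ⟨τ0, by simp, t2 ▸ (hS1 b).2 (Or.inl hbW)⟩
        · rcases hout a b hab haU hbU with rfl | ⟨τ, hτ, hbτ⟩
          · exact Or.inl rfl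
          · have := (hT.ok τ hτ).only hab (fun h => Finset.disjoint_left.1 (hT.ok τ hτ).hd h haU) hbτ
            exact Or.inr ⟨τ, List.mem_cons_of_mem _ ((m2 τ).2 ⟨hτ, this ▸ haW⟩), hbτ⟩)
      K (by
        intro e he
        rcases hK e he with h | ⟨τ, hτ, h⟩
        · rcases hcut.ru h with h | h | h
          · exact Or.inr ⟨τ0, by simp, t4 ▸ Finset.mem_insert_of_mem ((hK1 e).2 (Or.inl h))⟩
          · exact Or.inl h
          · exact Or.inr ⟨τ0, by simp, t4 ▸ h ▸ Finset.mem_insert_self _ _⟩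
        · by_cases hxW : τ.x ∈ W
          · exact Or.inr ⟨τ0, by simp, t4 ▸ Finset.mem_insert_of_mem ((hK1 e).2 (Or.inr ⟨τ, (m1 τ).2 ⟨hτ, hxW⟩, h⟩))⟩
          · exact Or.inr ⟨τ, List.mem_cons_of_mem _ ((m2 τ).2 ⟨hτ, hxW⟩), h⟩)
    refine P2.mono ?_
    have s1 := sum_filter_list (fun τ : Term V => τ.x ∈ W) Term.M T
    have s2 := hcut.mm (σ := σ) hL
    rw [← hT1, ← hT2] at s1
    rw [List.map_cons, List.sum_cons, t3]
    omega

theorem compRec (hM : Mn G σ) (hF2 : F2 G σ) (U : Finset V) (hC : Con G U) (hcl : ∀ a b, G.Adj a b → a ∈ U → b ∈ U)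
    (hN : (NU G σ U).card ≠ 1) :
    ∃ F : List (Finset (Sym2 V)), (∀ B ∈ F, SC G σ B) ∧ 2 * tl F ≤ 3 * mm G σ (EU G U) ∧
      ∀ e ∈ RU G σ U, ∃ B ∈ F, e ∈ B := by
  have hL : Lv G U := fun a b hab ha hb => absurd (hcl a b hab ha) hb
  by_cases hB : Bl G U
  · exact selfLemma (reg_of hM hC hL) hB hN
  obtain ⟨W, x, z, hcut⟩ := exists_cut1 hB
  have es : ∀ {W x z}, Cut1 G U W x z → ES G W x z := by
    intro W x z hcut a b hab ha hb
    exact hcut.uniq a b hab (hcl b a hab.symm (hcut.sub hb)) ha hb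
  have pk : ∀ {W x z}, Cut1 G U W x z → PP G σ W z (mm G σ (EU G W)) (RU G σ W) := by
    intro W x z hcut
    have := treeRec hM hF2 W.card W le_rfl z hcut.hz (hcut.con hC) (hcut.lv hL) W [] TL.nil subset_rfl
      (fun _ => hF2 W x z hcut.adj hcut.hxW hcut.hz (es hcut))
      (by
        intro a b hab ha hb
        exact Or.inl (es hcut b a hab.symm hb ha).2)
      (RU G σ W) (fun e he => Or.inl he)
    simpa using this
  obtain ⟨c1, c2, ⟨F, a, C, p1, p2, p3, p4, p5⟩, -, h3, -⟩ := pk hcut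
  obtain ⟨c1', c2', ⟨F', a', C', q1, q2, q3, q4, q5⟩, -, h3', -⟩ := pk hcut.symm
  have hdj : Disjoint (vs C) (vs C') := by
    refine Disjoint.mono p3 q3 ?_
    exact Finset.disjoint_sdiff
  have hw : (we (Walk.cons hcut.adj (Walk.nil : G.Walk z z))).card = 1 := by rw [we_cons, we_nil]; simp
  obtain ⟨B, b1, b2, b3, b4, b5⟩ := Lol.comb (p2.ext (Walk.cons hcut.adj Walk.nil)) q2 (sh_disj hdj)
  have hno : ∀ v ∈ vs C', v ∉ W := fun v hv => (Finset.mem_sdiff.1 (q3 hv)).2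
  have hno' : ∀ v ∈ vs C, v ∉ U \ W := fun v hv h => (Finset.mem_sdiff.1 h).2 (p3 hv)
  refine ⟨B :: (F ++ F'), ?_, ?_, ?_⟩
  · intro B' hB'
    rcases List.mem_cons.1 hB' with rfl | h
    · exact b1
    · exact sc_app p1 q1 B' h
  · rw [tl_cons, tl_append]
    have := hcut.mm (σ := σ) hL
    omega
  · intro e he
    have : e ∈ B ∨ (∃ D ∈ F, e ∈ D) ∨ ∃ D ∈ F', e ∈ D := by
      rcases hcut.ru he with h | h | rfl
      · rcases p5 e h with h | h | h
        · exact Or.inr (Or.inl h)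
        · exact Or.inl (b2 h)
        · exact Or.inl (b5 e (Sep.symm (Cov.sep fun v hv => (es hcut).cov p3 h (hno v hv))))
      · rcases q5 e h with h | h | h
        · exact Or.inr (Or.inr h)
        · exact Or.inl (b3 h)
        · exact Or.inl (b5 e (Cov.sep fun v hv => (es hcut.symm).cov q3 h (hno' v hv)))
      · exact Or.inl (b5 _ (Sep.symm (Cov.sep fun v hv => (es hcut).cov' p3 (hno v hv))))
    rcases this with h | ⟨D, hD, h⟩ | ⟨D, hD, h⟩
    · exact ⟨B, by simp, h⟩
    · exact ⟨D, by simp [hD], h⟩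
    · exact ⟨D, by simp [hD], h⟩

end Rec
end SCC

open SimpleGraph Set
namespace SCC
open scoped Classical
set_option linter.all false

section Fin1
variable {V : Type*} [Fintype V] {G : SimpleGraph V} {σ : Sym2 V → Bool}

noncomputable def NN (G : SimpleGraph V) (σ : Sym2 V → Bool) : Finset (Sym2 V) :=
  (EU G Finset.univ).filter fun e => wt G σ e = 1

lemma mem_NN {e : Sym2 V} : e ∈ NN G σ ↔ e ∈ G.edgeSet ∧ wt G σ e = 1 := by
  simp [NN, mem_EU]

lemma wt_one {e : Sym2 V} (h : wt G σ e = 1) :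
    ∃ Z : Finset (Sym2 V), (∀ e ∈ Z, e ∈ G.edgeSet ∧ σ e = false) ∧ Ev Z ∧ e ∈ Z := by
  by_contra hc
  unfold wt at h
  rw [if_neg hc] at h
  omega

lemma wt_of {e : Sym2 V} {Z : Finset (Sym2 V)} (h : ∀ e ∈ Z, e ∈ G.edgeSet ∧ σ e = false) (hev : Ev Z)
    (he : e ∈ Z) : wt G σ e = 1 := by
  unfold wt
  rw [if_pos ⟨Z, h, hev, he⟩]

lemma out_eq (e : Sym2 V) : s((Quot.out e).1, (Quot.out e).2) = e := Quot.out_eq e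

lemma coverN : ∃ F : List (Finset (Sym2 V)), (∀ B ∈ F, SC G σ B) ∧ 3 * tl F ≤ 5 * (NN G σ).card ∧
    ∀ e ∈ NN G σ, ∃ B ∈ F, e ∈ B := by
  let s : {e // e ∈ NN G σ} → V := fun e => (Quot.out e.1).1
  let t : {e // e ∈ NN G σ} → V := fun e => (Quot.out e.1).2
  have hst : ∀ e, s(s e, t e) = e.1 := fun e => out_eq e.1
  have hne : ∀ e, s e ≠ t e := by
    intro e h
    have h1 := (mem_NN.1 e.2).1
    rw [← hst e, h] at h1
    simp at h1
  have hcut : ∀ W : Finset V, (cut s t W).card ≠ 1 := by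
    intro W hW
    obtain ⟨e, he⟩ := Finset.card_eq_one.1 hW
    obtain ⟨Z, hZ, hev, heZ⟩ := wt_one (mem_NN.1 e.2).2
    have h1 := even_cut (fun f hf => (hZ f hf).1) hev W
    have hm : ∀ f : {e // e ∈ NN G σ}, f ∈ cut s t W ↔ Crosses (W : Set V) f.1 := by
      intro f
      rw [← hst f, cr_mk]
      simp [cut]
    have h2 : (Z.filter fun e => Crosses (W : Set V) e) = {e.1} := by
      ext f
      simp only [Finset.mem_filter, Finset.mem_singleton]
      constructor
      · rintro ⟨hf, hc⟩
        have hfN : f ∈ NN G σ := mem_NN.2 ⟨(hZ f hf).1, wt_of hZ hev hf⟩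
        have : (⟨f, hfN⟩ : {e // e ∈ NN G σ}) ∈ cut s t W := (hm _).2 hc
        rw [he, Finset.mem_singleton] at this
        rw [← this]
      · rintro rfl
        exact ⟨heZ, (hm _).1 (by rw [he]; simp)⟩
    rw [h2] at h1
    simp at h1
  obtain ⟨x, hx0, hxc, hxs⟩ := cover53 s t hcut
  let A : Fin 3 → Finset (Sym2 V) := fun i => (Finset.univ.filter fun e => x i e ≠ 0).image Subtype.val
  have hAN : ∀ i, ∀ e ∈ A i, e ∈ NN G σ := by
    intro i e he
    obtain ⟨f, -, rfl⟩ := Finset.mem_image.1 he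
    exact f.2
  have hAc : ∀ i, (A i).card = ∑ e, nz (x i e) := by
    intro i
    rw [Finset.card_image_of_injective _ Subtype.val_injective, Finset.card_filter]
    refine Finset.sum_congr rfl fun e _ => ?_
    unfold nz
    by_cases h : x i e = 0 <;> simp [h]
  have hAE : ∀ i, Ev (A i) := by
    intro i v
    have h1 := congrFun (hx0 i) v
    rw [fb_apply] at h1
    unfold bd
    rw [Finset.sum_image (fun a _ b _ h => Subtype.val_injective h), Finset.sum_filter]
    rw [Pi.zero_apply] at h1
    refine Eq.trans (Finset.sum_congr rfl fun e _ => ?_) h1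
    have hv : v ∈ e.1 ↔ v = s e ∨ v = t e := by rw [← hst e, Sym2.mem_iff]
    have hn := hne e
    by_cases h : x i e = 0
    · simp [h]
    · have h' := z2_ne _ h
      rw [h', if_pos (by simp)]
      by_cases a : s e = v
      · have b : t e ≠ v := fun b => hn (a.trans b.symm)
        rw [if_pos (hv.2 (Or.inl a.symm)), if_pos a, if_neg b]; simp
      · by_cases b : t e = v
        · rw [if_pos (hv.2 (Or.inr b.symm)), if_neg a, if_pos b]; decide
        · rw [if_neg (by rw [hv]; rintro (h | h); exacts [a h.symm, b h.symm]), if_neg a, if_neg b]; simp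
  have hdec : ∀ i, ∃ L, Dec G (A i) L := fun i =>
    exists_dec (A i) (fun e he => (mem_NN.1 (hAN i e he)).1) (hAE i)
  choose L hL using hdec
  have hsc : ∀ i, ∀ B ∈ L i, SC G σ B := by
    intro i B hB
    refine sc_pos ((hL i).1 B hB) ?_
    unfold sg
    refine Finset.sum_eq_zero fun e he => ?_
    have h1 := hAN i e (((hL i).2.2 e).2 ⟨B, hB, he⟩)
    have h2 : ¬ σ e = true := fun h => by
      have := wt_neg (G := G) h
      rw [(mem_NN.1 h1).2] at this
      omega
    rw [if_neg h2]
  refine ⟨L 0 ++ L 1 ++ L 2, ?_, ?_, ?_⟩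
  · intro B hB
    simp only [List.mem_append] at hB
    rcases hB with (h | h) | h
    exacts [hsc _ B h, hsc _ B h, hsc _ B h]
  · have hl : ∀ i, tl (L i) = ∑ e, nz (x i e) := fun i => by
      rw [← hAc]; exact (hL i).card
    rw [tl_append, tl_append, hl, hl, hl]
    rw [Fin.sum_univ_three] at hxs
    rw [Fintype.card_coe] at hxs
    exact hxs
  · intro e he
    obtain ⟨i, hi⟩ := hxc ⟨e, he⟩
    have h1 : e ∈ A i := Finset.mem_image.2 ⟨⟨e, he⟩, by simpa using hi, rfl⟩
    obtain ⟨B, hB, h2⟩ := ((hL i).2.2 e).1 h1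
    refine ⟨B, ?_, h2⟩
    simp only [List.mem_append]
    fin_cases i
    · exact Or.inl (Or.inl hB)
    · exact Or.inl (Or.inr hB)
    · exact Or.inr hB

def Cl (G : SimpleGraph V) (U : Finset V) : Prop := ∀ a b, G.Adj a b → a ∈ U → b ∈ U

noncomputable def cmp (G : SimpleGraph V) (x : V) : Finset V := Finset.univ.filter fun y => G.Reachable x y

lemma mem_cmp {x y : V} : y ∈ cmp G x ↔ G.Reachable x y := by simp [cmp]

lemma cl_cmp (x : V) : Cl G (cmp G x) := by
  intro a b hab ha
  rw [mem_cmp] at ha ⊢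
  exact ha.trans hab.reachable

lemma walk_cross {u v : V} (w : G.Walk u v) (A : Finset V) (hu : u ∈ A) (hv : v ∉ A) :
    ∃ e ∈ we w, Crosses (A : Set V) e := by
  induction w with
  | nil => exact absurd hu hv
  | @cons a b c h p ih =>
    by_cases hb : b ∈ A
    · obtain ⟨e, he, hc⟩ := ih hb hv
      exact ⟨e, by rw [we_cons]; exact Finset.mem_insert_of_mem he, hc⟩
    · exact ⟨s(a, b), by rw [we_cons]; exact Finset.mem_insert_self _ _, (cr_mk _ _ _).2 (by simp [hu, hb])⟩

lemma walk_in {U : Finset V} (hU : Cl G U) {u v : V} (w : G.Walk u v) (hu : u ∈ U) : we w ⊆ EU G U := by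
  induction w with
  | nil => simp [we_nil]
  | @cons a b c h p ih =>
    rw [we_cons]
    refine Finset.insert_subset (mem_EU'.2 ⟨h, hu, hU a b h hu⟩) (ih (hU a b h hu))

lemma con_cmp (x : V) : Con G (cmp G x) := by
  intro A u hu huA v hv hvA
  obtain ⟨w⟩ := (mem_cmp.1 hu).symm.trans (mem_cmp.1 hv)
  obtain ⟨e, he, hc⟩ := walk_cross w A huA hvA
  exact ⟨e, walk_in (cl_cmp x) w hu he, hc⟩

lemma allComp (hM : Mn G σ) (hF2 : F2 G σ) (hF1 : ∀ x, (NU G σ (cmp G x)).card ≠ 1) :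
    ∀ (n : ℕ) (W : Finset V), W.card ≤ n → Cl G W →
    ∃ F : List (Finset (Sym2 V)), (∀ B ∈ F, SC G σ B) ∧ 2 * tl F ≤ 3 * mm G σ (EU G W) ∧
      ∀ e ∈ RU G σ W, ∃ B ∈ F, e ∈ B := by
  intro n
  induction n with
  | zero =>
    intro W hW _
    have : W = ∅ := Finset.card_eq_zero.1 (by omega)
    subst this
    refine ⟨[], by simp, by simp, ?_⟩
    intro e he
    have := (mem_EU.1 (Finset.mem_filter.1 he).1).2
    induction e using Sym2.ind with
    | _ x y => exact absurd (this x (by simp)) (by simp)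
  | succ n ih =>
    intro W hW hcl
    by_cases hne : W.Nonempty
    · obtain ⟨x, hx⟩ := hne
      have hsub : cmp G x ⊆ W := by
        intro y hy
        obtain ⟨w⟩ := mem_cmp.1 hy
        by_contra hyW
        obtain ⟨e, he, hc⟩ := walk_cross w W hx hyW
        have := (mem_EU.1 (walk_in hcl w hx he)).2
        obtain ⟨a, b, rfl, ha, hb⟩ := hc
        exact hb (this b (by simp))
      have hxc : x ∈ cmp G x := mem_cmp.2 (Reachable.refl x)
      have hcl2 : Cl G (W \ cmp G x) := by
        intro a b hab ha
        rw [Finset.mem_sdiff] at ha ⊢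
        exact ⟨hcl a b hab ha.1, fun hb => ha.2 (cl_cmp x b a hab.symm hb)⟩
      have hlt : (W \ cmp G x).card < W.card :=
        Finset.card_lt_card (Finset.sdiff_ssubset hsub ⟨x, hxc⟩)
      obtain ⟨F, f1, f2, f3⟩ := ih (W \ cmp G x) (by omega) hcl2
      obtain ⟨F', g1, g2, g3⟩ := compRec hM hF2 (cmp G x) (con_cmp x) (cl_cmp x) (hF1 x)
      have hdis : Disjoint (EU G (W \ cmp G x)) (EU G (cmp G x)) := by
        rw [Finset.disjoint_left]
        intro e h1 h2
        induction e using Sym2.ind with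
        | _ a b => exact (Finset.mem_sdiff.1 (mem_EU'.1 h1).2.1).2 (mem_EU'.1 h2).2.1
      have huni : EU G W = EU G (W \ cmp G x) ∪ EU G (cmp G x) := by
        ext e
        induction e using Sym2.ind with
        | _ a b =>
          rw [Finset.mem_union, mem_EU', mem_EU', mem_EU', Finset.mem_sdiff, Finset.mem_sdiff]
          constructor
          · rintro ⟨hab, ha, hb⟩
            by_cases h : a ∈ cmp G x
            · exact Or.inr ⟨hab, h, cl_cmp x a b hab h⟩
            · exact Or.inl ⟨hab, ⟨ha, h⟩, hb, fun h' => h (cl_cmp x b a hab.symm h')⟩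
          · rintro (h | h)
            · exact ⟨h.1, h.2.1.1, h.2.2.1⟩
            · exact ⟨h.1, hsub h.2.1, hsub h.2.2⟩
      refine ⟨F ++ F', ?_, ?_, ?_⟩
      · intro B hB
        rcases List.mem_append.1 hB with h | h
        exacts [f1 B h, g1 B h]
      · rw [tl_append, huni, mm_union hdis]; omega
      · intro e he
        have h0 := Finset.mem_filter.1 he
        rw [huni, Finset.mem_union] at h0
        rcases h0.1 with h | h
        · obtain ⟨B, hB, h'⟩ := f3 e (Finset.mem_filter.2 ⟨h, h0.2⟩)
          exact ⟨B, by simp [hB], h'⟩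
        · obtain ⟨B, hB, h'⟩ := g3 e (Finset.mem_filter.2 ⟨h, h0.2⟩)
          exact ⟨B, by simp [hB], h'⟩
    · exact ih W (by rw [Finset.not_nonempty_iff_eq_empty.1 hne]; simp) hcl

lemma sc_switch (A : Set V) {B : Set (Sym2 V)} (h : IsSignedCircuit G (switchSign σ A) B) :
    IsSignedCircuit G σ B := by
  have key : ∀ C S, IsCycleSet G C S →
      (({e ∈ C | switchSign σ A e = true}.ncard : ℕ) : ZMod 2) = (({e ∈ C | σ e = true}.ncard : ℕ) : ZMod 2) := by
    rintro C S ⟨v, w, hw, hC, -⟩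
    have hcyc : IsCyc G (we w) := ⟨v, w, hw, rfl⟩
    have hCe : C = ((we w : Finset (Sym2 V)) : Set (Sym2 V)) := by
      ext e; rw [hC]; simp [mem_we]
    rw [hCe, ← sg_card, ← sg_card]
    have h1 := sum_bd G (we w) hcyc.sub A.toFinset
    rw [Finset.sum_eq_zero (fun v _ => hcyc.ev v)] at h1
    unfold sg
    have h2 : (∑ e ∈ we w, if switchSign σ A e = true then (1 : ZMod 2) else 0) =
        (∑ e ∈ we w, if σ e = true then (1 : ZMod 2) else 0) +
          ∑ e ∈ we w, if Crosses (A.toFinset : Set V) e then (1 : ZMod 2) else 0 := by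
      rw [← Finset.sum_add_distrib]
      refine Finset.sum_congr rfl fun e _ => ?_
      rw [Set.coe_toFinset]
      unfold switchSign
      by_cases hc : Crosses A e
      · rw [if_pos hc, if_pos hc]
        cases σ e <;> decide
      · rw [if_neg hc, if_neg hc, add_zero]
    rw [h2, ← h1, add_zero]
  have kneg : ∀ C S, IsNegCycle G (switchSign σ A) C S → IsNegCycle G σ C S := by
    rintro C S ⟨h1, h2⟩
    refine ⟨h1, ?_⟩
    have := key C S h1
    rw [← ZMod.natCast_eq_one_iff_odd] at h2 ⊢
    rw [← this, h2]
  rcases h with ⟨⟨S, h1⟩, h2⟩ | ⟨C1, C2, h | h⟩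
  · refine Or.inl ⟨⟨S, h1⟩, ?_⟩
    have := key B S h1
    rw [← ZMod.natCast_eq_zero_iff_even] at h2 ⊢
    rw [← this, h2]
  · obtain ⟨S1, S2, a, b, c⟩ := h
    exact Or.inr ⟨C1, C2, Or.inl ⟨S1, S2, kneg _ _ a, kneg _ _ b, c⟩⟩
  · obtain ⟨S1, S2, u, v, p, a, b, c⟩ := h
    exact Or.inr ⟨C1, C2, Or.inr ⟨S1, S2, u, v, p, kneg _ _ a, kneg _ _ b, c⟩⟩

lemma sw_sw (A B : Set V) : switchSign (switchSign σ A) B = switchSign σ (symmDiff A B) := by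
  funext e
  induction e using Sym2.ind with
  | _ x y =>
    unfold switchSign
    simp only [cr_mk, Set.mem_symmDiff]
    by_cases a : x ∈ A <;> by_cases b : x ∈ B <;> by_cases c : y ∈ A <;> by_cases d : y ∈ B <;> simp [a, b, c, d]

lemma sw_mk (A : Set V) (x y : V) : switchSign σ A s(x, y) = if (x ∈ A ↔ y ∈ A) then σ s(x, y) else !(σ s(x, y)) := by
  unfold switchSign
  by_cases h : (x ∈ A ↔ y ∈ A)
  · rw [if_neg (by rw [cr_mk]; exact not_not.2 h), if_pos h]
  · rw [if_pos (by rw [cr_mk]; exact h), if_neg h]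

def Mi (G : SimpleGraph V) (σ : Sym2 V → Bool) : Prop :=
  ∀ A : Set V, (NU G σ Finset.univ).card ≤ (NU G (switchSign σ A) Finset.univ).card

lemma exists_min (G : SimpleGraph V) (σ : Sym2 V → Bool) : ∃ U0 : Set V, Mi G (switchSign σ U0) := by
  obtain ⟨U0, h⟩ := Finite.exists_min (fun U : Set V => (NU G (switchSign σ U) Finset.univ).card)
  refine ⟨U0, fun A => ?_⟩
  rw [sw_sw]
  exact h _

lemma Mi.mn (h : Mi G σ) : Mn G σ := by
  intro A
  have h1 := h (A : Set V)
  have h2 : NU G (switchSign σ A) Finset.univ =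
      ((NU G σ Finset.univ).filter fun e => ¬ Crosses (A : Set V) e) ∪
        ((PU G σ Finset.univ).filter fun e => Crosses (A : Set V) e) := by
    ext e
    simp only [Finset.mem_union, Finset.mem_filter, mem_NU, mem_PU]
    unfold switchSign
    by_cases hc : Crosses (A : Set V) e
    · simp [hc]
    · simp [hc]
  have h3 := Finset.card_union_le ((NU G σ Finset.univ).filter fun e => ¬ Crosses (A : Set V) e)
        ((PU G σ Finset.univ).filter fun e => Crosses (A : Set V) e)
  have h4 := Finset.card_filter_add_card_filter_not (s := NU G σ Finset.univ) (fun e => Crosses (A : Set V) e)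
  rw [← h2] at h3
  omega

lemma f2_of (hfa : FlowAdmissible G σ) (U0 : Set V) : F2 G (switchSign σ U0) := by
  intro A x z hxz hx hz hES
  by_contra hne
  rw [Finset.not_nonempty_iff_eq_empty] at hne
  have hsub : ∀ y, (G.deleteEdges {s(x, z)}).Reachable z y → y ∈ A := by
    intro y hy
    by_contra hyA
    obtain ⟨w⟩ := hy.symm
    have h1 := (hES.walk (w.mapLe (G.deleteEdges_le _)) hyA hz).1
    rw [mem_we] at h1
    have h2 : s(x, z) ∈ w.edges := by simpa using h1
    have := w.edges_subset_edgeSet h2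
    simp at this
  have hbr : G.IsBridge s(x, z) := by
    rw [isBridge_iff]
    first
    | exact fun h => hx (hsub x h.symm)
    | exact ⟨hxz, fun h => hx (hsub x h.symm)⟩
  refine (hfa x).2 s(x, z) hxz hbr ?_ z (by simp) ?_
  · intro y hy
    rcases Sym2.mem_iff.1 hy with rfl | rfl
    · exact Reachable.refl _
    · exact hxz.reachable
  · unfold BalancedOn negOn
    rw [Nat.sInf_eq_zero]
    left
    refine ⟨U0, ?_⟩
    symm
    rw [Set.ncard_eq_zero]
    rw [Set.eq_empty_iff_forall_notMem]
    rintro e ⟨h1, h2, h3⟩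
    have : e ∈ NU G (switchSign σ U0) A := mem_NU.2 ⟨mem_EU.2 ⟨h1, fun y hy => hsub y (h2 y hy)⟩, h3⟩
    rw [hne] at this
    simp at this

lemma f1_of (hfa : FlowAdmissible G σ) (U0 : Set V) (hmi : Mi G (switchSign σ U0)) (x : V) :
    (NU G (switchSign σ U0) (cmp G x)).card ≠ 1 := by
  intro h1
  have hle : negOn G σ {y | G.Reachable x y} ≤ 1 := by
    unfold negOn
    refine Nat.sInf_le ⟨U0, ?_⟩
    rw [← h1, ← Set.ncard_coe_finset]
    congr 1
    ext e
    simp only [Finset.mem_coe, mem_NU, mem_EU, mem_cmp, and_assoc, Set.mem_setOf_eq]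
  have h0 : negOn G σ {y | G.Reachable x y} = 0 := by
    have := (hfa x).1
    omega
  have hmem : negOn G σ {y | G.Reachable x y} ∈ {n | ∃ U : Set V,
    n = {e | e ∈ G.edgeSet ∧ (∀ z ∈ e, z ∈ {y | G.Reachable x y}) ∧ switchSign σ U e = true}.ncard} := by
    unfold negOn
    exact Nat.sInf_mem ⟨_, U0, rfl⟩
  rw [h0] at hmem
  obtain ⟨U1, hU1⟩ := hmem
  rw [eq_comm, Set.ncard_eq_zero, Set.eq_empty_iff_forall_notMem] at hU1
  have h2 := hmi (symmDiff U0 U1 ∩ (cmp G x : Set V))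
  have h3 : NU G (switchSign (switchSign σ U0) (symmDiff U0 U1 ∩ (cmp G x : Set V))) Finset.univ ⊆
      NU G (switchSign σ U0) Finset.univ \ NU G (switchSign σ U0) (cmp G x) := by
    intro e he
    induction e using Sym2.ind with
    | _ a b =>
      obtain ⟨he1, he2⟩ := mem_NU.1 he
      have hab := (mem_EU'.1 he1).1
      by_cases ha : a ∈ cmp G x
      · exfalso
        have hb := cl_cmp x a b hab ha
        refine hU1 s(a, b) ⟨hab, ?_, ?_⟩
        · intro y hy
          rcases Sym2.mem_iff.1 hy with rfl | rfl
          · exact mem_cmp.1 ha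
          · exact mem_cmp.1 hb
        · rw [← he2]
          rw [sw_mk, sw_mk, sw_mk]
          have ha' : a ∈ (cmp G x : Set V) := ha
          have hb' : b ∈ (cmp G x : Set V) := hb
          simp only [Set.mem_inter_iff, Set.mem_symmDiff, ha', hb', and_true]
          by_cases p : a ∈ U0 <;> by_cases q : a ∈ U1 <;> by_cases r : b ∈ U0 <;> by_cases t : b ∈ U1 <;>
            simp [p, q, r, t]
      · have hb : b ∉ cmp G x := fun hb => ha (cl_cmp x b a hab.symm hb)
        rw [Finset.mem_sdiff]
        refine ⟨mem_NU.2 ⟨he1, ?_⟩, fun h => ha (mem_EU'.1 (mem_NU.1 h).1).2.1⟩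
        rw [← he2, sw_mk (σ := switchSign σ U0), if_pos]
        have ha' : a ∉ (cmp G x : Set V) := ha
        have hb' : b ∉ (cmp G x : Set V) := hb
        simp [ha', hb']
  have h4 := Finset.card_le_card h3
  have h5 : NU G (switchSign σ U0) (cmp G x) ⊆ NU G (switchSign σ U0) Finset.univ := by
    intro e he
    obtain ⟨p, q⟩ := mem_NU.1 he
    exact mem_NU.2 ⟨mem_EU.2 ⟨(mem_EU.1 p).1, by simp⟩, q⟩
  rw [Finset.card_sdiff_of_subset h5] at h4
  have h6 := Finset.card_le_card h5
  omega

lemma main (hfa : FlowAdmissible G σ) (hne : G.edgeSet.Nonempty) :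
    ∃ F : List (Finset (Sym2 V)), (∀ B ∈ F, IsSignedCircuit G σ (B : Set (Sym2 V))) ∧
      (∀ e ∈ G.edgeSet, ∃ B ∈ F, e ∈ B) ∧ 6 * tl F < 19 * G.edgeSet.ncard := by
  obtain ⟨U0, hmi⟩ := exists_min G σ
  obtain ⟨F, f1, f2, f3⟩ := coverN (G := G) (σ := switchSign σ U0)
  obtain ⟨F', g1, g2, g3⟩ := allComp hmi.mn (f2_of hfa U0) (f1_of hfa U0 hmi) _ Finset.univ le_rfl
    (fun a b _ _ => Finset.mem_univ b)
  have hE : G.edgeSet.ncard = (EU G Finset.univ).card := by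
    rw [← Set.ncard_coe_finset]
    congr 1
    ext e
    simp [mem_EU]
  have hEN : EU G Finset.univ = NN G (switchSign σ U0) ∪ RU G (switchSign σ U0) Finset.univ := by
    ext e
    simp only [NN, RU, Finset.mem_union, Finset.mem_filter]
    rcases wt_cases (G := G) (σ := switchSign σ U0) e with h | h <;> simp [h]
  have hdis : Disjoint (NN G (switchSign σ U0)) (RU G (switchSign σ U0) Finset.univ) := by
    rw [Finset.disjoint_left]
    intro e h1 h2
    have a := (Finset.mem_filter.1 h1).2
    have b := (Finset.mem_filter.1 h2).2
    omega
  have hm : mm G (switchSign σ U0) (EU G Finset.univ) =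
      (NN G (switchSign σ U0)).card + 2 * (RU G (switchSign σ U0) Finset.univ).card := by
    rw [hEN, mm_union hdis]
    unfold mm
    have a1 : ∑ e ∈ NN G (switchSign σ U0), wt G (switchSign σ U0) e = ∑ e ∈ NN G (switchSign σ U0), 1 :=
      Finset.sum_congr rfl (fun e he => (mem_NN.1 he).2)
    have a2 : ∑ e ∈ RU G (switchSign σ U0) Finset.univ, wt G (switchSign σ U0) e =
        ∑ e ∈ RU G (switchSign σ U0) Finset.univ, 2 :=
      Finset.sum_congr rfl (fun e he => (Finset.mem_filter.1 he).2)
    rw [a1, a2]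
    simp [mul_comm]
  have hc : (EU G Finset.univ).card =
      (NN G (switchSign σ U0)).card + (RU G (switchSign σ U0) Finset.univ).card := by
    rw [hEN, Finset.card_union_of_disjoint hdis]
  have hcov : ∀ e ∈ G.edgeSet, e ∈ NN G (switchSign σ U0) ∨ e ∈ RU G (switchSign σ U0) Finset.univ := by
    intro e he
    have : e ∈ EU G Finset.univ := mem_EU.2 ⟨he, by simp⟩
    rw [hEN] at this
    exact Finset.mem_union.1 this
  by_cases hR : RU G (switchSign σ U0) Finset.univ = ∅
  · refine ⟨F, fun B hB => sc_switch U0 (f1 B hB), ?_, ?_⟩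
    · intro e he
      rcases hcov e he with h | h
      · exact f3 e h
      · rw [hR] at h; simp at h
    · have : 0 < G.edgeSet.ncard := (Set.ncard_pos).2 hne
      rw [hR, Finset.card_empty] at hc
      omega
  · have hpos : 0 < (RU G (switchSign σ U0) Finset.univ).card :=
      Finset.card_pos.2 (Finset.nonempty_iff_ne_empty.2 hR)
    refine ⟨F ++ F', ?_, ?_, ?_⟩
    · intro B hB
      rcases List.mem_append.1 hB with h | h
      exacts [sc_switch U0 (f1 B h), sc_switch U0 (g1 B h)]
    · intro e he
      rcases hcov e he with h | h
      · obtain ⟨B, hB, h'⟩ := f3 e h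
        exact ⟨B, by simp [hB], h'⟩
      · obtain ⟨B, hB, h'⟩ := g3 e h
        exact ⟨B, by simp [hB], h'⟩
    · rw [tl_append]
      omega

end Fin1
end SCC

theorem stmt9 {V : Type*} [Fintype V] (G : SimpleGraph V) (σ : Sym2 V → Bool)
    (hfa : FlowAdmissible G σ) (hne : G.edgeSet.Nonempty) :
    ∃ 𝓕 : Multiset (Set (Sym2 V)), IsSignedCircuitCover G σ 𝓕 ∧
      6 * circuitLength 𝓕 < 19 * G.edgeSet.ncard := by
  obtain ⟨F, h1, h2, h3⟩ := SCC.main hfa hne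
  refine ⟨((List.map (fun B : Finset (Sym2 V) => (B : Set (Sym2 V))) F : List (Set (Sym2 V))) : Multiset (Set (Sym2 V))), ⟨?_, ?_⟩, ?_⟩
  · intro C hC
    rw [Multiset.mem_coe, List.mem_map] at hC
    obtain ⟨B, hB, rfl⟩ := hC
    exact h1 B hB
  · intro e he
    obtain ⟨B, hB, h⟩ := h2 e he
    exact ⟨(B : Set (Sym2 V)), by rw [Multiset.mem_coe, List.mem_map]; exact ⟨B, hB, rfl⟩, h⟩
  · unfold circuitLength
    rw [Multiset.map_coe, Multiset.sum_coe, List.map_map]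
    have : (Set.ncard ∘ fun B : Finset (Sym2 V) => (B : Set (Sym2 V))) = Finset.card := by
      funext B; simp
    rw [this]
    exact h3
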